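/- arXiv:2202.10427 — 3 statements merged into one kernel-verified Lean document; each statement's English description precedes it below -/
import Mathlib

section
/- Let K be an algebraically closed field and f ∈ K[x,y,z] homogeneous of degree d ≥ 3. Assume: (i) the set of singular points {[v] ∈ ℙ²(K) : f(v) = 0 and ∇f(v) = 0} is exactly the singleton {[0:0:1]}; and (ii) writing g(x,y) := f(x,y,1) (which has vanishing constant and linear parts at the origin), the degree-2 homogeneous part q(x,y) of g is such that the linear forms ∂q/∂x and ∂q/∂y are linearly independent over K (so the singularity at [0:0:1] is a non-degenerate double point). Then f is irreducible in K[x,y,z]; in particular the plane curve V(f) ⊆ ℙ²_K is integral. -/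
open MvPolynomial

/-- Scaling the arguments of a form of degree `n` by `r` scales its value by `r ^ n`. -/
lemma MvPolynomial.IsHomogeneous.aeval_mul_left {σ R A : Type*} [CommSemiring R] [CommSemiring A]
    [Algebra R A] {p : MvPolynomial σ R} {n : ℕ} (hp : p.IsHomogeneous n) (r : A) (w : σ → A) :
    MvPolynomial.aeval (fun i => r * w i) p = r ^ n * MvPolynomial.aeval w p := by
  simp only [aeval_def, eval₂_eq, Finset.mul_sum]
  refine Finset.sum_congr rfl fun m hm => ?_
  have hn : ∑ i ∈ m.support, m i = n := (hp.degree_eq_sum_deg_support hm).symm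
  simp only [mul_pow, Finset.prod_mul_distrib, Finset.prod_pow_eq_pow_sum, hn]
  ring

/-- The homomorphism `X i ↦ T * X i` separates homogeneous components. -/
lemma coeff_aeval_X_mul_C_X {σ R : Type*} [CommRing R] (p : MvPolynomial σ R) (n : ℕ) :
    (aeval (fun i => (Polynomial.X * Polynomial.C (X i) : Polynomial (MvPolynomial σ R))) p).coeff n
      = homogeneousComponent n p := by
  conv_lhs => rw [← sum_homogeneousComponent p]
  have key (i : ℕ) :
      (aeval (fun i => (Polynomial.X * Polynomial.C (X i) : Polynomial (MvPolynomial σ R)))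
        (homogeneousComponent i p)) = Polynomial.X ^ i * Polynomial.C (homogeneousComponent i p) := by
    rw [(homogeneousComponent_isHomogeneous i p).aeval_mul_left]
    congr 1
    have := aeval_algebraMap_apply (A := MvPolynomial σ R)
      (Polynomial (MvPolynomial σ R)) X (homogeneousComponent i p)
    rw [aeval_X_left_apply] at this
    simpa [Function.comp_def] using this
  simp only [map_sum, key, Polynomial.finsetSum_coeff, Polynomial.coeff_X_pow_mul',
    Polynomial.coeff_C]
  by_cases hn : n ≤ p.totalDegree
  · rw [Finset.sum_eq_single n]
    · simp
    · intro b _ hb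
      split_ifs <;> first | rfl | omega
    · simp; omega
  · rw [homogeneousComponent_eq_zero _ _ (by omega)]
    refine Finset.sum_eq_zero fun b hb => ?_
    simp only [Finset.mem_range] at hb
    split_ifs <;> first | rfl | omega

/-- Over a domain, both factors of a nonzero form are forms. -/
lemma MvPolynomial.IsHomogeneous.exists_of_mul {σ R : Type*} [CommRing R] [IsDomain R]
    {g h : MvPolynomial σ R} {d : ℕ} (hgh : (g * h).IsHomogeneous d) (h0 : g * h ≠ 0) :
    ∃ a b, g.IsHomogeneous a ∧ h.IsHomogeneous b ∧ a + b = d := by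
  let Φ : MvPolynomial σ R →ₐ[R] Polynomial (MvPolynomial σ R) :=
    MvPolynomial.aeval (fun i => Polynomial.X * Polynomial.C (X i))
  have hΦ (p : MvPolynomial σ R) (n : ℕ) : (Φ p).coeff n = homogeneousComponent n p :=
    coeff_aeval_X_mul_C_X p n
  have hΦ0 (p : MvPolynomial σ R) (hp : p ≠ 0) : Φ p ≠ 0 := by
    intro h
    apply hp
    rw [← sum_homogeneousComponent p]
    exact Finset.sum_eq_zero fun i _ => by rw [← hΦ, h, Polynomial.coeff_zero]
  have hom (p : MvPolynomial σ R) (hp : (Φ p).natDegree = (Φ p).natTrailingDegree) :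
      p.IsHomogeneous (Φ p).natDegree := by
    have : p = homogeneousComponent (Φ p).natDegree p := by
      conv_lhs => rw [← sum_homogeneousComponent p]
      simp only [← hΦ]
      have e (i : ℕ) (hi : i ≠ (Φ p).natDegree) : (Φ p).coeff i = 0 := by
        rcases lt_or_gt_of_ne hi with h | h
        · exact Polynomial.coeff_eq_zero_of_lt_natTrailingDegree (hp ▸ h)
        · exact Polynomial.coeff_eq_zero_of_natDegree_lt h
      refine Finset.sum_eq_single _ (fun i _ hi => e i hi) fun hi => ?_
      rw [hΦ, homogeneousComponent_eq_zero]
      simpa using hi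
    have hcomp := homogeneousComponent_isHomogeneous (Φ p).natDegree p
    rwa [← this] at hcomp
  have hg0 := hΦ0 g (left_ne_zero_of_mul h0)
  have hh0 := hΦ0 h (right_ne_zero_of_mul h0)
  have hf : Φ (g * h) = Polynomial.monomial d (g * h) := by
    ext1 n
    rw [hΦ, homogeneousComponent_of_mem hgh, Polynomial.coeff_monomial]
    simp [eq_comm]
  have h1 : (Φ g).natDegree + (Φ h).natDegree = d := by
    rw [← Polynomial.natDegree_mul hg0 hh0, ← map_mul, hf, Polynomial.natDegree_monomial_eq _ h0]
  have h2 : (Φ g).natTrailingDegree + (Φ h).natTrailingDegree = d := by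
    rw [← Polynomial.natTrailingDegree_mul hg0 hh0, ← map_mul, hf,
      Polynomial.natTrailingDegree_monomial h0]
  have h3 := (Φ g).natTrailingDegree_le_natDegree
  have h4 := (Φ h).natTrailingDegree_le_natDegree
  exact ⟨_, _, hom g (by omega), hom h (by omega), h1⟩

/-- First-order Taylor expansion along the line `x = y = 0`. -/
lemma taylor_mem_sq {R : Type*} [CommRing R] (p : MvPolynomial (Fin 3) R) :
    p - (aeval ![0, 0, X 2] p + X 0 * aeval ![0, 0, X 2] (pderiv 0 p)
        + X 1 * aeval ![0, 0, X 2] (pderiv 1 p))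
      ∈ (Ideal.span {X 0, X 1} : Ideal (MvPolynomial (Fin 3) R)) ^ 2 := by
  have hx : (X 0 : MvPolynomial (Fin 3) R) ∈ (Ideal.span {X 0, X 1}) :=
    Ideal.subset_span (by simp)
  have hy : (X 1 : MvPolynomial (Fin 3) R) ∈ (Ideal.span {X 0, X 1}) :=
    Ideal.subset_span (by simp)
  generalize hm : (Ideal.span {X 0, X 1} : Ideal (MvPolynomial (Fin 3) R)) = m at *
  have hxx : (X 0 * X 0 : MvPolynomial (Fin 3) R) ∈ m ^ 2 := by
    rw [pow_two]; exact Ideal.mul_mem_mul hx hx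
  have hxy : (X 0 * X 1 : MvPolynomial (Fin 3) R) ∈ m ^ 2 := by
    rw [pow_two]; exact Ideal.mul_mem_mul hx hy
  have hyy : (X 1 * X 1 : MvPolynomial (Fin 3) R) ∈ m ^ 2 := by
    rw [pow_two]; exact Ideal.mul_mem_mul hy hy
  induction p using MvPolynomial.induction_on with
  | C a => simp
  | add p q hp hq =>
    convert add_mem hp hq using 1
    simp only [map_add]
    ring
  | mul_X p i hp =>
    have key := Ideal.mul_mem_right (X i) _ hp
    simp only [Derivation.leibniz, map_add, map_mul, smul_eq_mul, aeval_X, pderiv_X]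
    fin_cases i
    · convert add_mem key (add_mem (Ideal.mul_mem_right (aeval ![0, 0, X 2] (pderiv 0 p)) _ hxx)
        (Ideal.mul_mem_right (aeval ![0, 0, X 2] (pderiv 1 p)) _ hxy)) using 1
      simp
      ring
    · convert add_mem key (add_mem (Ideal.mul_mem_right (aeval ![0, 0, X 2] (pderiv 0 p)) _ hxy)
        (Ideal.mul_mem_right (aeval ![0, 0, X 2] (pderiv 1 p)) _ hyy)) using 1
      simp
      ring
    · convert key using 1
      simp
      ring

lemma mem_radical_span_of_forall_eval {σ K : Type*} [Finite σ] [Field K] [IsAlgClosed K]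
    (S : Set (MvPolynomial σ K)) (p : MvPolynomial σ K)
    (h : ∀ v : σ → K, (∀ s ∈ S, eval v s = 0) → eval v p = 0) : p ∈ (Ideal.span S).radical := by
  rw [← vanishingIdeal_zeroLocus_eq_radical (K := K), mem_vanishingIdeal_iff]
  intro v hv
  rw [zeroLocus_span] at hv
  exact h v hv

/-- If the common zeros of `g` and `h` miss the line at infinity `z = 0` of the projective plane,
then `z` is a nonzerodivisor modulo `(g, h)`. -/
lemma mem_span_pair_of_X_mul_mem {K : Type*} [Field K] [IsAlgClosed K]
    {g h : MvPolynomial (Fin 3) K} (hg : eval 0 g = 0)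
    (hz : ∀ v : Fin 3 → K, eval v g = 0 → eval v h = 0 → v 2 = 0 → v = 0)
    {p : MvPolynomial (Fin 3) K} (hp : X 2 * p ∈ Ideal.span {g, h}) : p ∈ Ideal.span {g, h} := by
  let τ : MvPolynomial (Fin 3) K →ₐ[K] MvPolynomial (Fin 3) K := aeval ![X 0, X 1, 0]
  have hτ (q : MvPolynomial (Fin 3) K) : ∃ r, q = τ q + X 2 * r := by
    suffices X 2 ∣ q - τ q by
      obtain ⟨r, hr⟩ := this
      exact ⟨r, by rw [← hr]; ring⟩
    induction q using MvPolynomial.induction_on with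
    | C a => simp [τ]
    | add p q hp hq =>
      convert dvd_add hp hq using 1
      rw [map_add]; ring
    | mul_X q i hq =>
      rw [map_mul]
      fin_cases i
      · convert hq.mul_right (X 0) using 1
        simp [τ]; ring
      · convert hq.mul_right (X 1) using 1
        simp [τ]; ring
      · simp [τ]
  have hτz : τ (X 2) = 0 := by simp [τ]
  have hrad (i : Fin 3) : X i ∈ (Ideal.span {g, h, X 2}).radical := by
    refine mem_radical_span_of_forall_eval _ _ fun v hv => ?_
    simp only [Set.mem_insert_iff, Set.mem_singleton_iff, forall_eq_or_imp, forall_eq,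
      eval_X] at hv
    rw [hz v hv.1 hv.2.1 hv.2.2]
    simp
  have hdvd (q : MvPolynomial (Fin 3) K) (hqg : q ∣ τ g) (hqh : q ∣ τ h) (i : Fin 3) :
      ∃ n, q ∣ τ (X i) ^ n := by
    obtain ⟨n, hn⟩ := hrad i
    refine ⟨n, ?_⟩
    rw [Ideal.mem_span_insert] at hn
    obtain ⟨a, w, hw, hn⟩ := hn
    obtain ⟨b, c, rfl⟩ := Ideal.mem_span_pair.1 hw
    rw [← map_pow, hn]
    simp only [map_add, map_mul, hτz, mul_zero, add_zero]
    exact dvd_add (hqg.mul_left _) (hqh.mul_left _)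
  have hcop : IsRelPrime (τ g) (τ h) := by
    intro q hqg hqh
    obtain ⟨n, hn⟩ := hdvd q hqg hqh 0
    obtain ⟨m, hm⟩ := hdvd q hqg hqh 1
    have hxy : IsRelPrime (X 0 : MvPolynomial (Fin 3) K) (X 1) := by
      refine X_prime.irreducible.isRelPrime_iff_not_dvd.2 ?_
      simp
    exact hxy.pow (by simpa [τ] using hn) (by simpa [τ] using hm)
  have hh0 : τ h ≠ 0 := by
    intro h0
    rw [h0, isRelPrime_zero_right] at hcop
    have := hcop.map (eval (0 : Fin 3 → K))
    obtain ⟨r, hr⟩ := hτ g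
    have h1 := congrArg (eval (0 : Fin 3 → K)) hr
    simp only [map_add, map_mul, eval_X, Pi.zero_apply, zero_mul, add_zero, hg] at h1
    rw [← h1] at this
    exact not_isUnit_zero this
  obtain ⟨A, B, hAB⟩ := Ideal.mem_span_pair.1 hp
  have h1 : τ A * τ g + τ B * τ h = 0 := by
    have := congrArg τ hAB
    simpa [hτz] using this
  obtain ⟨c, hc⟩ : τ h ∣ τ A := by
    refine hcop.symm.dvd_of_dvd_mul_right ⟨-τ B, ?_⟩
    linear_combination h1
  have hB : τ B = -(c * τ g) := by
    apply mul_right_cancel₀ hh0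
    rw [hc] at h1
    linear_combination h1
  obtain ⟨A', hA'⟩ := hτ A
  obtain ⟨B', hB'⟩ := hτ B
  obtain ⟨g', hg'⟩ := hτ g
  obtain ⟨h', hh'⟩ := hτ h
  refine Ideal.mem_span_pair.2 ⟨A' - c * h', B' + c * g', ?_⟩
  have hX : (X 2 : MvPolynomial (Fin 3) K) ≠ 0 := X_ne_zero _
  apply mul_left_cancel₀ hX
  rw [← hAB]
  linear_combination (-g) * hA' - h * hB' - g * hc - h * hB + c * g * hh' - c * h * hg'

lemma pow_mul_mem_sup_pow {R : Type*} [CommRing R] {I m : Ideal R} {s : R}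
    (hs : ∀ p ∈ m, s * p ∈ I ⊔ m ^ 2) (k : ℕ) : ∀ p ∈ m, s ^ k * p ∈ I ⊔ m ^ (k + 1) := by
  induction k with
  | zero => intro p hp; simpa using Ideal.mem_sup_right hp
  | succ k ih =>
    have step : ∀ q ∈ m * m ^ k, s * q ∈ I ⊔ m ^ (k + 1 + 1) := by
      intro q hq
      induction hq using Submodule.mul_induction_on' with
      | mem_mul_mem a ha b hb =>
        obtain ⟨j, hj, t, ht, hjt⟩ := Submodule.mem_sup.1 (hs a ha)
        rw [← mul_assoc, ← hjt, add_mul]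
        refine add_mem (Ideal.mem_sup_left (I.mul_mem_right _ hj)) (Ideal.mem_sup_right ?_)
        rw [show k + 1 + 1 = 2 + k by ring, pow_add]
        exact Ideal.mul_mem_mul ht hb
      | add a _ b _ ha hb => rw [mul_add]; exact add_mem ha hb
    intro p hp
    obtain ⟨i, hi, q, hq, hiq⟩ := Submodule.mem_sup.1 (ih p hp)
    rw [pow_succ' s, mul_assoc, ← hiq, mul_add]
    exact add_mem (Ideal.mem_sup_left (I.mul_mem_left _ hi)) (step q (by rwa [← pow_succ']))

lemma MvPolynomial.IsHomogeneous.eval_zero_eq_zero {σ R : Type*} [CommSemiring R]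
    {p : MvPolynomial σ R} {n : ℕ} (hp : p.IsHomogeneous n) (hn : n ≠ 0) : eval 0 p = 0 := by
  have := hp.aeval_mul_left (0 : R) 0
  simp only [zero_mul, zero_pow hn, aeval_eq_eval] at this
  exact this

/-- A form of degree `n + 1` vanishing at `[0 : 0 : 1]` agrees with `z ^ n` times its linear part
there up to terms of order at least two in `x, y`. -/
lemma MvPolynomial.IsHomogeneous.sub_linear_mem_sq {R : Type*} [CommRing R]
    {p : MvPolynomial (Fin 3) R} {n : ℕ} (hp : p.IsHomogeneous (n + 1))
    (h0 : eval ![0, 0, 1] p = 0) :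
    p - X 2 ^ n * (C (eval ![0, 0, 1] (pderiv 0 p)) * X 0
        + C (eval ![0, 0, 1] (pderiv 1 p)) * X 1)
      ∈ (Ideal.span {X 0, X 1} : Ideal (MvPolynomial (Fin 3) R)) ^ 2 := by
  have key {q : MvPolynomial (Fin 3) R} {k : ℕ} (hq : q.IsHomogeneous k) :
      MvPolynomial.aeval (![0, 0, X 2] : Fin 3 → MvPolynomial (Fin 3) R) q = X 2 ^ k * C (eval ![0, 0, 1] q) := by
    have h1 := hq.aeval_mul_left (X 2 : MvPolynomial (Fin 3) R)
      (fun i => algebraMap R (MvPolynomial (Fin 3) R) ((![0, 0, 1] : Fin 3 → R) i))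
    have h2 : (fun i => (X 2 : MvPolynomial (Fin 3) R) *
        algebraMap R (MvPolynomial (Fin 3) R) ((![0, 0, 1] : Fin 3 → R) i)) = ![0, 0, X 2] := by
      ext1 i
      fin_cases i <;> simp
    have h3 := aeval_algebraMap_apply (MvPolynomial (Fin 3) R) (![0, 0, 1] : Fin 3 → R) q
    rw [h2] at h1
    rw [h1]
    congr 1
  convert taylor_mem_sq p using 2
  rw [key hp, key hp.pderiv, key hp.pderiv, h0]
  simp
  ring

/-- Two plane forms, one of them of degree at least two, which meet at most in `[0 : 0 : 1]` and
transversally if at all, cannot exist: by Bézout their degrees would both be one. -/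
lemma not_meet_transversally_only_once {K : Type*} [Field K] [IsAlgClosed K]
    {g h : MvPolynomial (Fin 3) K} {a b : ℕ} (hg : g.IsHomogeneous (a + 1))
    (hh : h.IsHomogeneous (b + 2))
    (hzero : ∀ v : Fin 3 → K, eval v g = 0 → eval v h = 0 → v 0 = 0 ∧ v 1 = 0)
    (htr : eval ![0, 0, 1] g = 0 → eval ![0, 0, 1] h = 0 →
      eval ![0, 0, 1] (pderiv 0 g) * eval ![0, 0, 1] (pderiv 1 h)
        - eval ![0, 0, 1] (pderiv 1 g) * eval ![0, 0, 1] (pderiv 0 h) ≠ 0) : False := by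
  have hg0 := hg.eval_zero_eq_zero (by omega)
  have hh0 := hh.eval_zero_eq_zero (by omega)
  have reg (n : ℕ) : ∀ p, X 2 ^ n * p ∈ Ideal.span {g, h} → p ∈ Ideal.span {g, h} := by
    induction n with
    | zero => simp
    | succ n ih =>
      intro p hp
      rw [pow_succ, mul_assoc] at hp
      refine mem_span_pair_of_X_mul_mem hg0 (fun v h1 h2 h3 => ?_) (ih _ hp)
      obtain ⟨h4, h5⟩ := hzero v h1 h2
      ext i
      fin_cases i <;> assumption
  by_cases hP : eval ![0, 0, 1] g = 0 ∧ eval ![0, 0, 1] h = 0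
  · obtain ⟨hgP, hhP⟩ := hP
    have hdet := htr hgP hhP
    have hgt := hg.sub_linear_mem_sq hgP
    have hht := hh.sub_linear_mem_sq hhP
    generalize eval ![0, 0, 1] (pderiv 0 g) = α at *
    generalize eval ![0, 0, 1] (pderiv 1 g) = β at *
    generalize eval ![0, 0, 1] (pderiv 0 h) = γ at *
    generalize eval ![0, 0, 1] (pderiv 1 h) = δ at *
    obtain ⟨I, hI⟩ : ∃ I, I = Ideal.span {g, h} := ⟨_, rfl⟩
    obtain ⟨m, hm⟩ : ∃ m : Ideal (MvPolynomial (Fin 3) K), m = Ideal.span {X 0, X 1} := ⟨_, rfl⟩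
    rw [← hm] at hgt hht
    have hgI : g ∈ I := hI ▸ Ideal.subset_span (by simp)
    have hhI : h ∈ I := hI ▸ Ideal.subset_span (by simp)
    have hg1 : X 2 ^ a * (C α * X 0 + C β * X 1) ∈ I ⊔ m ^ 2 := by
      convert sub_mem (Ideal.mem_sup_left hgI) (Ideal.mem_sup_right hgt) using 1
      ring
    have hh1 : X 2 ^ (b + 1) * (C γ * X 0 + C δ * X 1) ∈ I ⊔ m ^ 2 := by
      convert sub_mem (Ideal.mem_sup_left hhI) (Ideal.mem_sup_right hht) using 1
      ring
    have hinv : (C (α * δ - β * γ)⁻¹ * (C α * C δ - C β * C γ) : MvPolynomial (Fin 3) K) = 1 := by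
      rw [← C_mul, ← C_mul, ← C_sub, ← C_mul, inv_mul_cancel₀ hdet, C_1]
    have hx : X 2 ^ (a + b + 1) * X 0 ∈ I ⊔ m ^ 2 := by
      convert sub_mem (Ideal.mul_mem_left _ (C (α * δ - β * γ)⁻¹ * C δ * X 2 ^ (b + 1)) hg1)
        (Ideal.mul_mem_left _ (C (α * δ - β * γ)⁻¹ * C β * X 2 ^ a) hh1) using 1
      linear_combination (-X 2 ^ (a + b + 1) * X 0) * hinv
    have hy : X 2 ^ (a + b + 1) * X 1 ∈ I ⊔ m ^ 2 := by
      convert sub_mem (Ideal.mul_mem_left _ (C (α * δ - β * γ)⁻¹ * C α * X 2 ^ a) hh1)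
        (Ideal.mul_mem_left _ (C (α * δ - β * γ)⁻¹ * C γ * X 2 ^ (b + 1)) hg1) using 1
      linear_combination (-X 2 ^ (a + b + 1) * X 1) * hinv
    have hs : ∀ p ∈ m, X 2 ^ (a + b + 1) * p ∈ I ⊔ m ^ 2 := by
      intro p hp
      rw [hm] at hp
      obtain ⟨u, w, rfl⟩ := Ideal.mem_span_pair.1 hp
      convert add_mem (Ideal.mul_mem_left _ u hx) (Ideal.mul_mem_left _ w hy) using 1
      ring
    have hmI : m ≤ I.radical := by
      rw [hm, hI, Ideal.span_le]
      rintro p (rfl | rfl) <;> refine mem_radical_span_of_forall_eval _ _ fun v hv => ?_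
      all_goals
        have := hzero v (hv g (by simp)) (hv h (by simp))
        simp [this]
    obtain ⟨k, hk⟩ := Ideal.exists_pow_le_of_le_radical_of_fg hmI
      (hm ▸ Submodule.fg_span (Set.toFinite _))
    have hmem (p) (hp : p ∈ m) : p ∈ Ideal.span {g, h} := by
      apply reg ((a + b + 1) * k)
      rw [pow_mul, ← hI]
      exact sup_le le_rfl ((Ideal.pow_le_pow_right k.le_succ).trans hk)
        (pow_mul_mem_sup_pow hs k p hp)
    obtain ⟨A, B, hAB⟩ := Ideal.mem_span_pair.1 (hmem (X 0) (hm ▸ Ideal.subset_span (by simp)))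
    obtain ⟨A', B', hAB'⟩ := Ideal.mem_span_pair.1 (hmem (X 1) (hm ▸ Ideal.subset_span (by simp)))
    have hdh (i : Fin 3) : eval 0 (pderiv i h) = 0 := hh.pderiv.eval_zero_eq_zero (by omega)
    have e0 := congrArg (fun p => eval 0 (pderiv 0 p)) hAB
    have e1 := congrArg (fun p => eval 0 (pderiv 1 p)) hAB
    have e2 := congrArg (fun p => eval 0 (pderiv 1 p)) hAB'
    simp [-eval_zero, hdh, hg0, hh0, Derivation.leibniz, pderiv_X] at e0 e1 e2
    rcases e1 with e1 | e1
    · simp only [e1, zero_mul, zero_ne_one] at e0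
    · simp only [e1, mul_zero, zero_ne_one] at e2
  · have hrad : X 2 ∈ (Ideal.span {g, h}).radical := by
      refine mem_radical_span_of_forall_eval _ _ fun v hv => ?_
      have hvg := hv g (by simp)
      have hvh := hv h (by simp)
      obtain ⟨h0, h1⟩ := hzero v hvg hvh
      have hv : v = fun i => v 2 * (![0, 0, 1] : Fin 3 → K) i := by
        ext i
        fin_cases i <;> simp [h0, h1]
      have sg := hg.aeval_mul_left (v 2) ![0, 0, 1]
      have sh := hh.aeval_mul_left (v 2) ![0, 0, 1]
      rw [← hv, aeval_eq_eval] at sg sh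
      rw [eval_X]
      by_contra hv2
      apply hP
      constructor
      · simpa [hvg, hv2] using sg.symm
      · simpa [hvh, hv2] using sh.symm
    obtain ⟨n, hn⟩ := hrad
    obtain ⟨A, B, hAB⟩ := Ideal.mem_span_pair.1 (reg n 1 (by rwa [mul_one]))
    have := congrArg (eval (0 : Fin 3 → K)) hAB
    simp [-eval_zero, hg0, hh0] at this

/-- The quadratic part of the dehomogenization of a product of two forms through `[0 : 0 : 1]` is
the product of the linear parts of the factors. -/
lemma homogeneousComponent_two_aeval_mul {R : Type*} [CommRing R]
    {g h : MvPolynomial (Fin 3) R} {a b : ℕ} (hg : g.IsHomogeneous (a + 1))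
    (hh : h.IsHomogeneous (b + 1)) (hgP : eval ![0, 0, 1] g = 0) (hhP : eval ![0, 0, 1] h = 0) :
    homogeneousComponent 2 (aeval (![X 0, X 1, 1] : Fin 3 → MvPolynomial (Fin 2) R) (g * h)) =
      (C (eval ![0, 0, 1] (pderiv 0 g)) * X 0 + C (eval ![0, 0, 1] (pderiv 1 g)) * X 1) *
      (C (eval ![0, 0, 1] (pderiv 0 h)) * X 0 + C (eval ![0, 0, 1] (pderiv 1 h)) * X 1) := by
  let φ : MvPolynomial (Fin 3) R →ₐ[R] MvPolynomial (Fin 2) R := aeval ![X 0, X 1, 1]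
  have hmap : (Ideal.span {X 0, X 1} : Ideal (MvPolynomial (Fin 3) R)).map φ ≤ idealOfVars _ R := by
    rw [Ideal.map_span, Ideal.span_le]
    rintro _ ⟨p, rfl | rfl, rfl⟩
    · exact Ideal.subset_span ⟨0, by simp [φ]⟩
    · exact Ideal.subset_span ⟨1, by simp [φ]⟩
  have hmap2 {p} (hp : p ∈ (Ideal.span {X 0, X 1} : Ideal (MvPolynomial (Fin 3) R)) ^ 2) :
      φ p ∈ idealOfVars _ R ^ 2 := by
    have := Ideal.mem_map_of_mem φ hp
    rw [Ideal.map_pow] at this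
    exact Ideal.pow_right_mono hmap 2 this
  have hu := hmap2 (hg.sub_linear_mem_sq hgP)
  have hv := hmap2 (hh.sub_linear_mem_sq hhP)
  change homogeneousComponent 2 (φ (g * h)) = _
  rw [map_mul]
  have hX0 : φ (X 0) = X 0 := by simp [φ]
  have hX1 : φ (X 1) = X 1 := by simp [φ]
  have hX2 : φ (X 2) = 1 := by simp [φ]
  have hC (r : R) : φ (C r) = C r := by simp [φ]
  simp only [map_sub, map_mul, map_add, map_pow, hX0, hX1, hX2, hC, one_pow, one_mul] at hu hv
  generalize eval ![0, 0, 1] (pderiv 0 g) = α at *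
  generalize eval ![0, 0, 1] (pderiv 1 g) = β at *
  generalize eval ![0, 0, 1] (pderiv 0 h) = γ at *
  generalize eval ![0, 0, 1] (pderiv 1 h) = δ at *
  have hlin (r s : R) : (C r * X 0 + C s * X 1 : MvPolynomial (Fin 2) R) ∈ idealOfVars _ R :=
    add_mem (Ideal.mul_mem_left _ _ (Ideal.subset_span ⟨0, rfl⟩))
      (Ideal.mul_mem_left _ _ (Ideal.subset_span ⟨1, rfl⟩))
  have hlinh (r s : R) : (C r * X 0 + C s * X 1 : MvPolynomial (Fin 2) R).IsHomogeneous 1 :=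
    (isHomogeneous_C_mul_X r 0).add (isHomogeneous_C_mul_X s 1)
  have hL := hlin α β
  have hM := hlin γ δ
  have hLM := (hlinh α β).mul (hlinh γ δ)
  generalize (C α * X 0 + C β * X 1 : MvPolynomial (Fin 2) R) = L at *
  generalize (C γ * X 0 + C δ * X 1 : MvPolynomial (Fin 2) R) = M at *
  have hrem : φ g * φ h - L * M ∈ idealOfVars (Fin 2) R ^ 3 := by
    have h1 := Ideal.mul_mem_mul hu hv
    have h2 := Ideal.mul_mem_mul hu hM
    have h3 := Ideal.mul_mem_mul hL hv
    rw [← pow_add] at h1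
    rw [← pow_succ] at h2
    rw [← pow_succ'] at h3
    convert add_mem (add_mem (Ideal.pow_le_pow_right (by omega) h1) h2) h3 using 1
    ring
  have hz : homogeneousComponent 2 (φ g * φ h - L * M) = 0 := by
    ext c
    rw [coeff_homogeneousComponent, coeff_zero]
    split_ifs with hc
    · exact (mem_pow_idealOfVars_iff' 3 _).1 hrem c (by omega)
    · rfl
  rw [map_sub, sub_eq_zero] at hz
  rw [hz, homogeneousComponent_of_mem hLM, if_pos rfl]

lemma MvPolynomial.IsHomogeneous.isUnit_of_degree_zero {σ K : Type*} [Field K]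
    {p : MvPolynomial σ K} (hp : p.IsHomogeneous 0) (h0 : p ≠ 0) : IsUnit p := by
  have hc := totalDegree_eq_zero_iff_eq_C.1 (Nat.le_zero.1 hp.totalDegree_le)
  rw [hc] at h0 ⊢
  exact ((Ne.isUnit fun h => h0 (by rw [h, C_0])).map C)

/-- If the partial derivatives of a product of two binary linear forms are linearly independent,
then so are the linear forms. -/
lemma det_ne_zero_of_linearIndependent_pderiv {K : Type*} [Field K] {α β γ δ : K}
    (hnd : LinearIndependent K
      ![pderiv 0 ((C α * X 0 + C β * X 1) * (C γ * X 0 + C δ * X 1) : MvPolynomial (Fin 2) K),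
        pderiv 1 ((C α * X 0 + C β * X 1) * (C γ * X 0 + C δ * X 1))]) :
    α * δ - β * γ ≠ 0 := by
  intro hdet
  rw [LinearIndependent.pair_iff] at hnd
  have hd : (C α * C δ - C β * C γ : MvPolynomial (Fin 2) K) = 0 := by
    rw [← C_mul, ← C_mul, ← C_sub, hdet, C_0]
  simp only [Derivation.leibniz, map_add, smul_eq_mul, pderiv_C, pderiv_X_self, mul_zero,
    add_zero, mul_one, pderiv_X_of_ne (R := K) (show (1 : Fin 2) ≠ 0 by decide),
    pderiv_X_of_ne (R := K) (show (0 : Fin 2) ≠ 1 by decide), zero_add, smul_eq_C_mul] at hnd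
  obtain ⟨h1, h2⟩ := hnd β (-α) (by
    rw [C_neg]
    linear_combination (-(C α * X 0 + C β * X 1)) * hd)
  rw [neg_eq_zero] at h2
  exact one_ne_zero (hnd 1 0 (by simp [h1, h2])).1

/-- Lemma 4.3: a plane curve of degree `≥ 3` over an algebraically closed field
whose singular locus is exactly one non-degenerate double point is integral
(the defining form is irreducible). Variables are `x = X 0`, `y = X 1`, `z = X 2`;
`g(x,y) := f(x,y,1)` and `q` is its quadratic homogeneous part. -/
theorem stmt9 (K : Type) [Field K] [IsAlgClosed K]
    (f : MvPolynomial (Fin 3) K) (d : ℕ) (hd : 3 ≤ d) (hf : f.IsHomogeneous d)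
    (hsing : ∀ v : Fin 3 → K, v ≠ 0 →
      ((eval v f = 0 ∧ ∀ i, eval v (pderiv i f) = 0) ↔
        ∃ t : K, t ≠ 0 ∧ v = t • ![0, 0, 1]))
    (hnd : LinearIndependent K
      ![pderiv 0 (MvPolynomial.homogeneousComponent 2
          (MvPolynomial.aeval (![X 0, X 1, 1] : Fin 3 → MvPolynomial (Fin 2) K) f)),
        pderiv 1 (MvPolynomial.homogeneousComponent 2
          (MvPolynomial.aeval (![X 0, X 1, 1] : Fin 3 → MvPolynomial (Fin 2) K) f))]) :
    Irreducible f := by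
  have hf0 : f ≠ 0 := by
    rintro rfl
    obtain ⟨t, -, ht⟩ := (hsing ![1, 0, 0] (by simp)).1 (by simp)
    simpa using congrFun ht 0
  rw [irreducible_iff]
  constructor
  · intro hu
    have := hu.map (eval (0 : Fin 3 → K))
    rw [hf.eval_zero_eq_zero (by omega)] at this
    exact not_isUnit_zero this
  · rintro g h rfl
    obtain ⟨a, b, hg, hh, hab⟩ := hf.exists_of_mul hf0
    rcases Nat.eq_zero_or_pos a with rfl | ha
    · exact Or.inl (hg.isUnit_of_degree_zero (left_ne_zero_of_mul hf0))
    rcases Nat.eq_zero_or_pos b with rfl | hb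
    · exact Or.inr (hh.isUnit_of_degree_zero (right_ne_zero_of_mul hf0))
    exfalso
    have hzero (v : Fin 3 → K) (hvg : eval v g = 0) (hvh : eval v h = 0) : v 0 = 0 ∧ v 1 = 0 := by
      by_cases hv : v = 0
      · simp [hv]
      obtain ⟨t, -, rfl⟩ := (hsing v hv).1 (by simp [Derivation.leibniz, hvg, hvh])
      simp
    obtain ⟨a, rfl⟩ := Nat.exists_eq_add_of_le' ha
    obtain ⟨b, rfl⟩ := Nat.exists_eq_add_of_le' hb
    have htr (hgP : eval ![0, 0, 1] g = 0) (hhP : eval ![0, 0, 1] h = 0) :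
        eval ![0, 0, 1] (pderiv 0 g) * eval ![0, 0, 1] (pderiv 1 h)
          - eval ![0, 0, 1] (pderiv 1 g) * eval ![0, 0, 1] (pderiv 0 h) ≠ 0 := by
      rw [homogeneousComponent_two_aeval_mul hg hh hgP hhP] at hnd
      exact det_ne_zero_of_linearIndependent_pderiv hnd
    rcases b with _ | b
    · obtain ⟨a, rfl⟩ : ∃ a', a = a' + 1 := ⟨a - 1, by omega⟩
      refine not_meet_transversally_only_once hh hg (fun v h1 h2 => hzero v h2 h1)
        fun h1 h2 h3 => htr h2 h1 ?_
      linear_combination -h3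
    · exact not_meet_transversally_only_once hg hh hzero htr
end

section
/- Let k be a finite field of odd characteristic, n ≥ 1 an integer, and Q a nonzero quadratic form in n+1 variables over k, say Q(x) = xᵀAx for a symmetric (n+1)×(n+1) matrix A over k. Let X(k') := {[x] ∈ ℙ^n(k') : Q(x) = 0} for finite extensions k'/k, so dim X = n−1. Then X fails to be |E|-good — that is, there is NO constant C > 0 with |#X(k') − #ℙ^{n−1}(k')| ≤ C·|k'|^{(n−1)/2} for all finite extensions k'/k — if and only if rank(A) is even and rank(A) ≤ n. -/
open MvPolynomial Matrix

/-- Number of points of the projective subset of `ℙ^{m-1}(k)` cut out by the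
(scale-invariant) condition `P`. -/
noncomputable def projCount {m : ℕ} (k : Type) [Field k]
    (P : (Fin m → k) → Prop) : ℕ :=
  Nat.card {x : Fin m → k // x ≠ 0 ∧ P x} / (Nat.card k - 1)

/-- `#ℙ^j(𝔽_q) = 1 + q + ⋯ + q^j`. -/
def projCard (q j : ℕ) : ℕ := ∑ i ∈ Finset.range (j + 1), q ^ i

open Finset in
theorem sum_addChar_mul_sq {F K : Type*} [Field F] [Fintype F] [DecidableEq F] [Field K]
    (hF : ringChar F ≠ 2) {ψ : AddChar F K} (hψ : ψ.IsPrimitive) {b : F} (hb : b ≠ 0) :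
    ∑ x, ψ (b * x ^ 2) = (quadraticChar F b : K) *
      gaussSum ((quadraticChar F).ringHomComp (Int.castRingHom K)) ψ := by
  set η := (quadraticChar F).ringHomComp (Int.castRingHom K) with hη
  have h_fiber : ∑ x, ψ (b * x ^ 2) = ∑ y, (η y + 1) * ψ (b * y) := by
    rw [← sum_fiberwise_of_maps_to (g := fun x : F => x ^ 2) (fun x _ => mem_univ _)]
    refine sum_congr rfl fun y _ => ?_
    rw [sum_congr rfl (g := fun _ => ψ (b * y)) fun x hx => by rw [(mem_filter.1 hx).2],
      sum_const, nsmul_eq_mul]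
    congr 1
    have h := quadraticChar_card_sqrts hF y
    have h' : ({x : F | x ^ 2 = y} : Set F).toFinset = univ.filter fun x => x ^ 2 = y := by
      ext; simp
    rw [h'] at h
    have := congrArg (Int.cast : ℤ → K) h
    simpa [hη] using this
  have h_quad : η.IsQuadratic := (quadraticChar_isQuadratic F).comp _
  have h_lin : ∑ y, ψ (b * y) = 0 := by
    simpa [hb, mul_comm] using AddChar.sum_mulShift b hψ
  have h_shift := gaussSum_mulShift_eq η ψ (Units.mk0 b hb)
  rw [h_quad.inv, gaussSum] at h_shift
  simp only [AddChar.mulShift_apply, Units.val_mk0] at h_shift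
  rw [h_fiber]
  simp only [add_mul, one_mul, sum_add_distrib, h_lin, add_zero, h_shift]
  simp [hη]

open Finset in
theorem card_mul_card_weighted_sum_sq_eq_zero {F K ι : Type*} [Field F] [Fintype F]
    [DecidableEq F] [Field K] [CharZero K] [Fintype ι] [DecidableEq ι] (hF : ringChar F ≠ 2)
    {ψ : AddChar F K} (hψ : ψ.IsPrimitive) (w : ι → F) {r : ℕ}
    (hr : Fintype.card {i // w i ≠ 0} = r) :
    ∃ ε : ℤ, (ε = 1 ∨ ε = -1) ∧
      (Fintype.card F : K) * (Nat.card {x : ι → F // ∑ i, w i * x i ^ 2 = 0} : K) =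
        (Fintype.card F : K) ^ Fintype.card ι + ε * (Fintype.card F : K) ^ (Fintype.card ι - r) *
          gaussSum ((quadraticChar F).ringHomComp (Int.castRingHom K)) ψ ^ r *
          ∑ t ∈ univ.erase (0 : F), (quadraticChar F t : K) ^ r := by
  set g := gaussSum ((quadraticChar F).ringHomComp (Int.castRingHom K)) ψ
  set S : Finset ι := univ.filter fun i => w i ≠ 0 with hS
  have hSr : S.card = r := by rw [← hr, Fintype.card_subtype]
  have hSc : (univ.filter fun i => ¬ w i ≠ 0).card = Fintype.card ι - r := by
    rw [← hSr, ← card_compl]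
    congr 1
    ext; simp [hS]
  refine ⟨quadraticChar F (∏ i ∈ S, w i), quadraticChar_dichotomy
    (prod_ne_zero_iff.2 fun i hi => (mem_filter.1 hi).2), ?_⟩
  have h_prod (t : F) : ∑ x : ι → F, ψ (t * ∑ i, w i * x i ^ 2) =
      ∏ i, ∑ x, ψ (t * w i * x ^ 2) := by
    rw [prod_univ_sum, Fintype.piFinset_univ]
    refine sum_congr rfl fun x _ => ?_
    rw [mul_sum]
    simp only [mul_assoc]
    exact map_prod ψ.toMonoidHom (fun i => Multiplicative.ofAdd (t * (w i * x i ^ 2))) univ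
  have h_count : ∑ t, ∑ x : ι → F, ψ (t * ∑ i, w i * x i ^ 2) =
      (Fintype.card F : K) * (Nat.card {x : ι → F // ∑ i, w i * x i ^ 2 = 0} : K) := by
    rw [sum_comm]
    simp only [AddChar.sum_mulShift _ hψ]
    rw [Nat.card_eq_fintype_card, Fintype.card_subtype]
    push_cast
    rw [← sum_filter, sum_const, nsmul_eq_mul, mul_comm]
  rw [← h_count, ← add_sum_erase _ _ (mem_univ (0 : F)), mul_sum]
  congr 1
  · simp
  refine sum_congr rfl fun t ht => ?_
  rw [h_prod, ← prod_filter_mul_prod_filter_not univ (fun i => w i ≠ 0),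
    prod_congr (s₁ := univ.filter fun i => w i ≠ 0) rfl fun i hi => sum_addChar_mul_sq hF hψ
      (mul_ne_zero (ne_of_mem_erase ht) (mem_filter.1 hi).2),
    prod_congr (s₁ := univ.filter fun i => ¬ w i ≠ 0) rfl
      (g := fun _ => (Fintype.card F : K)) fun i hi => by
      simp [not_not.1 (mem_filter.1 hi).2],
    prod_const, hSc]
  simp only [map_mul, Int.cast_mul, prod_mul_distrib, prod_const, map_prod, Int.cast_prod]
  rw [← hS, hSr]
  ring

theorem AddChar.exists_charZero_isPrimitive (F : Type*) [Field F] [Fintype F] :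
    ∃ (K : Type) (_ : Field K) (_ : CharZero K) (ψ : AddChar F K), ψ.IsPrimitive := by
  have h_char : ringChar ℚ ≠ ringChar F := by
    rw [ringChar.eq_zero]
    exact (CharP.ringChar_ne_zero_of_finite F).symm
  let Ψ := AddChar.FiniteField.primitiveChar F ℚ h_char
  exact ⟨CyclotomicField Ψ.n ℚ, inferInstance, inferInstance, Ψ.char, Ψ.prim⟩

open Finset in
theorem card_weighted_sum_sq_eq_zero {F ι : Type*} [Field F] [Fintype F] [Fintype ι]
    [DecidableEq F] (hF : ringChar F ≠ 2) (w : ι → F) {n r : ℕ} (hn : Fintype.card ι = n + 1)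
    (hr : Fintype.card {i // w i ≠ 0} = r) (hr0 : r ≠ 0) :
    (Odd r → Nat.card {x : ι → F // ∑ i, w i * x i ^ 2 = 0} = Fintype.card F ^ n) ∧
    (∀ s, r = 2 * s → ∃ ε : ℤ, (ε = 1 ∨ ε = -1) ∧
      (Nat.card {x : ι → F // ∑ i, w i * x i ^ 2 = 0} : ℤ) =
        Fintype.card F ^ n + ε * (Fintype.card F - 1) * Fintype.card F ^ (n - s)) := by
  classical
  obtain ⟨K, _, _, ψ, hψ⟩ := AddChar.exists_charZero_isPrimitive F
  obtain ⟨ε, hε, h⟩ := card_mul_card_weighted_sum_sq_eq_zero hF hψ w hr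
  have hrn : r ≤ n + 1 := by
    rw [← hn, ← hr]
    exact Fintype.card_subtype_le _
  have hq : (Fintype.card F : K) ≠ 0 := Nat.cast_ne_zero.2 Fintype.card_ne_zero
  rw [hn] at h
  have h_sq (t : F) (ht : t ∈ univ.erase (0 : F)) : (quadraticChar F t : K) ^ 2 = 1 := by
    exact_mod_cast congrArg (Int.cast : ℤ → K) (quadraticChar_sq_one (ne_of_mem_erase ht))
  constructor
  · rintro ⟨s, rfl⟩
    have h_sum : ∑ t ∈ univ.erase (0 : F), (quadraticChar F t : K) ^ (2 * s + 1) = 0 := by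
      rw [sum_congr rfl (g := fun t => (quadraticChar F t : K)) fun t ht => by
        rw [pow_succ, pow_mul, h_sq t ht, one_pow, one_mul], ← Int.cast_sum,
        sum_erase _ (by simp), quadraticChar_sum_zero hF, Int.cast_zero]
    rw [h_sum, mul_zero, add_zero, pow_succ', mul_right_inj' hq] at h
    exact_mod_cast h
  · rintro s rfl
    have h_sum : ∑ t ∈ univ.erase (0 : F), (quadraticChar F t : K) ^ (2 * s) =
        (Fintype.card F : K) - 1 := by
      rw [sum_congr rfl (g := fun _ => (1 : K)) fun t ht => by
        rw [pow_mul, h_sq t ht, one_pow], sum_const, card_erase_of_mem (mem_univ _), card_univ,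
        nsmul_eq_mul, mul_one, Nat.cast_pred Fintype.card_pos]
    have h_ne : (quadraticChar F).ringHomComp (Int.castRingHom K) ≠ 1 := fun h1 => by
      obtain ⟨a, ha⟩ := quadraticChar_exists_neg_one' hF
      have h2 := congrFun (congrArg DFunLike.coe h1) (a : F)
      simp only [MulChar.ringHomComp_apply, ha, MulChar.one_apply_coe] at h2
      norm_num at h2
    rw [h_sum, pow_mul, gaussSum_sq h_ne ((quadraticChar_isQuadratic F).comp _) hψ] at h
    refine ⟨ε * quadraticChar F (-1) ^ s, ?_, ?_⟩
    · have h1 := quadraticChar_dichotomy (F := F) (a := -1) (by simp)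
      rcases hε with rfl | rfl <;> rcases h1 with h1 | h1 <;> rw [h1] <;>
        rcases neg_one_pow_eq_or ℤ s with h2 | h2 <;> simp [h2]
    · have h_exp : (Fintype.card F : K) ^ (n + 1 - 2 * s) * (Fintype.card F : K) ^ s =
          Fintype.card F * (Fintype.card F : K) ^ (n - s) := by
        rw [← pow_add, ← pow_succ']
        congr 1
        omega
      have h3 : (Nat.card {x : ι → F // ∑ i, w i * x i ^ 2 = 0} : K) =
          Fintype.card F ^ n + (ε * quadraticChar F (-1) ^ s : ℤ) * (Fintype.card F - 1) *
            Fintype.card F ^ (n - s) := by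
        refine mul_left_cancel₀ hq ?_
        rw [h, MulChar.ringHomComp_apply, mul_pow]
        push_cast [eq_intCast]
        linear_combination (ε : K) * (quadraticChar F (-1) : K) ^ s *
          ((Fintype.card F : K) - 1) * h_exp
      refine Int.cast_injective (α := K) ?_
      push_cast at h3 ⊢
      exact h3

theorem Matrix.rank_ne_zero {F m n : Type*} [Field F] [Fintype m] [Fintype n] {A : Matrix m n F}
    (hA : A ≠ 0) : A.rank ≠ 0 := by
  classical
  rw [Matrix.rank, Ne, Submodule.finrank_eq_zero, LinearMap.range_eq_bot]
  rw [← Matrix.toLin'_apply']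
  simpa using hA

theorem Matrix.IsSymm.exists_transpose_mul_mul_eq_diagonal {F : Type*} [Field F]
    (hF : ringChar F ≠ 2) {m : ℕ} {A : Matrix (Fin m) (Fin m) F} (hA : A.IsSymm) :
    ∃ (P : Matrix (Fin m) (Fin m) F) (w : Fin m → F), IsUnit P.det ∧
      Pᵀ * A * P = diagonal w := by
  have : Invertible (2 : F) := invertibleOfNonzero (Ring.two_ne_zero hF)
  obtain ⟨v, hv⟩ := LinearMap.BilinForm.exists_orthogonal_basis
    (B := A.toBilin') (LinearMap.BilinForm.isSymm_iff.1 (isSymm_toBilin'_iff_isSymm.2 hA))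
  let b := v.reindex (finCongr (Module.finrank_fin_fun F))
  refine ⟨(Pi.basisFun F (Fin m)).toMatrix b, fun i => A.toBilin' (b i) (b i), ?_, ?_⟩
  · rw [← Module.Basis.det_apply]
    exact Module.Basis.isUnit_det _ _
  · have h := LinearMap.BilinForm.toMatrix_mul_basis_toMatrix (Pi.basisFun F (Fin m)) b A.toBilin'
    rw [LinearMap.BilinForm.toMatrix_basisFun, LinearMap.BilinForm.toMatrix'_toBilin'] at h
    rw [h]
    ext i j
    rw [LinearMap.BilinForm.toMatrix_apply]
    rcases eq_or_ne i j with rfl | hij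
    · rw [diagonal_apply_eq]
    · rw [diagonal_apply_ne _ hij]
      simp only [b, Module.Basis.reindex_apply]
      exact hv (by simpa using hij)

theorem card_quadric_eq_card_weighted_sum_sq {F ι : Type*} [Field F] [Fintype ι] [DecidableEq ι]
    {A P : Matrix ι ι F} {w : ι → F} (hP : IsUnit P.det) (h : Pᵀ * A * P = diagonal w) :
    Nat.card {x : ι → F // x ⬝ᵥ A *ᵥ x = 0} =
      Nat.card {x : ι → F // ∑ i, w i * x i ^ 2 = 0} := by
  refine Nat.card_congr (Equiv.subtypeEquiv
    (toLinearEquiv' P (P.invertibleOfIsUnitDet hP)).toEquiv fun y => ?_).symm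
  have h_eval : (P *ᵥ y) ⬝ᵥ A *ᵥ (P *ᵥ y) = ∑ i, w i * y i ^ 2 := by
    rw [mulVec_mulVec, ← vecMul_transpose, ← dotProduct_mulVec, mulVec_mulVec, ← Matrix.mul_assoc,
      h]
    simp only [dotProduct, mulVec_diagonal]
    exact Finset.sum_congr rfl fun i _ => by ring
  rw [← h_eval]
  rfl

theorem natCast_projCount_eq {F : Type} [Field F] [Fintype F] {m : ℕ} (P : (Fin m → F) → Prop)
    (hP : P 0) {c : ℤ}
    (h : (Nat.card {x // P x} : ℤ) = 1 + (Fintype.card F - 1) * c) :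
    (projCount F P : ℤ) = c := by
  classical
  have h_card : Nat.card {x // P x} = Nat.card {x : Fin m → F // x ≠ 0 ∧ P x} + 1 := by
    simp only [Nat.card_eq_fintype_card, Fintype.card_subtype]
    rw [← Finset.filter_filter, Finset.filter_ne', Finset.filter_erase,
      Finset.card_erase_add_one (by simpa using hP)]
  have h_q : 1 < Fintype.card F := Fintype.one_lt_card
  rw [h_card] at h
  push_cast at h
  rw [projCount, Nat.card_eq_fintype_card (α := F)]
  push_cast [h_q.le]
  rw [show (Nat.card {x : Fin m → F // x ≠ 0 ∧ P x} : ℤ) = (Fintype.card F - 1) * c by linarith]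
  exact Int.mul_ediv_cancel_left _ (by omega)

theorem sub_one_mul_projCard {n : ℕ} (hn : 1 ≤ n) (q : ℕ) :
    ((q : ℤ) - 1) * projCard q (n - 1) = q ^ n - 1 := by
  rw [projCard, Nat.sub_add_cancel hn]
  push_cast
  exact mul_geom_sum _ _

/-- The point count of a quadric of rank `r`: it agrees with that of a hyperplane if `r` is odd,
and otherwise differs from it by exactly `q ^ (n - r / 2)`. -/
theorem projCount_quadric_sub_projCard {k : Type} [Field k] (hchar : ringChar k ≠ 2) {n : ℕ}
    (hn : 1 ≤ n) {A : Matrix (Fin (n + 1)) (Fin (n + 1)) k} (hA : A.IsSymm) (hA0 : A ≠ 0)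
    (k' : Type) [Field k'] [Fintype k'] [Algebra k k'] :
    (Odd A.rank → (projCount k' (fun x : Fin (n + 1) → k' =>
      x ⬝ᵥ (A.map (algebraMap k k')).mulVec x = 0) : ℤ) - projCard (Nat.card k') (n - 1) = 0) ∧
    (∀ s, A.rank = 2 * s → |(projCount k' (fun x : Fin (n + 1) → k' =>
      x ⬝ᵥ (A.map (algebraMap k k')).mulVec x = 0) : ℤ) - projCard (Nat.card k') (n - 1)| =
        (Nat.card k' : ℤ) ^ (n - s)) := by
  classical
  obtain ⟨P, w, hP, h⟩ := hA.exists_transpose_mul_mul_eq_diagonal hchar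
  have hF : ringChar k' ≠ 2 := by rwa [← Algebra.ringChar_eq k k']
  have h_map : (P.map (algebraMap k k'))ᵀ * A.map (algebraMap k k') * P.map (algebraMap k k') =
      diagonal fun i => algebraMap k k' (w i) := by
    rw [← transpose_map, ← Matrix.map_mul, ← Matrix.map_mul, h, diagonal_map (map_zero _)]
  have hP' : IsUnit (P.map (algebraMap k k')).det := by
    rw [← RingHom.mapMatrix_apply, ← RingHom.map_det]
    exact hP.map _
  have h_rank : A.rank = Fintype.card {i // w i ≠ 0} := by
    rw [← rank_diagonal, ← h, rank_mul_eq_left_of_isUnit_det _ _ hP,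
      rank_mul_eq_right_of_isUnit_det _ _ (by rwa [det_transpose])]
  have h_rank' : Fintype.card {i // algebraMap k k' (w i) ≠ 0} = A.rank := by
    rw [h_rank]
    simp
  have h_ne : A.rank ≠ 0 := rank_ne_zero hA0
  have h_count := card_weighted_sum_sq_eq_zero hF _ (Fintype.card_fin (n + 1)) h_rank' h_ne
  rw [← card_quadric_eq_card_weighted_sum_sq hP' h_map] at h_count
  have h_proj := sub_one_mul_projCard hn (Fintype.card k')
  rw [Nat.card_eq_fintype_card (α := k')]
  constructor
  · intro hr
    rw [sub_eq_zero]
    refine natCast_projCount_eq _ (by simp) ?_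
    rw [h_count.1 hr, h_proj]
    push_cast
    ring
  · intro s hs
    obtain ⟨ε, hε, h_eq⟩ := h_count.2 s hs
    rw [natCast_projCount_eq (c := projCard (Fintype.card k') (n - 1) +
      ε * (Fintype.card k' : ℤ) ^ (n - s)) _ (by simp) (by linear_combination h_eq - h_proj),
      add_sub_cancel_left, abs_mul, abs_pow, Nat.abs_cast]
    rcases hε with rfl | rfl <;> simp

/-- Proposition 5.2 (dichotomy for quadrics, odd characteristic): the quadric
`X = {xᵀAx = 0} ⊆ ℙ^n` over a finite field `k` of odd characteristic is
`|E|`-bad iff `rank A` is even and `rank A ≤ n`. -/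
theorem stmt11 (k : Type) [Field k] [Fintype k] (hchar : ringChar k ≠ 2)
    (n : ℕ) (hn : 1 ≤ n)
    (A : Matrix (Fin (n + 1)) (Fin (n + 1)) k) (hA : A.IsSymm) (hA0 : A ≠ 0) :
    (¬ ∃ C : ℝ, 0 < C ∧ ∀ (k' : Type) [Field k'] [Fintype k'] [Algebra k k'],
        |(projCount k' (fun x : Fin (n + 1) → k' =>
            x ⬝ᵥ (A.map (algebraMap k k')).mulVec x = 0) : ℝ) -
          (projCard (Nat.card k') (n - 1) : ℝ)| ≤
        C * (Nat.card k' : ℝ) ^ (((n : ℝ) - 1) / 2)) ↔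
      (Even A.rank ∧ A.rank ≤ n) := by
  have h_even {s : ℕ} (hs : A.rank = 2 * s) (k' : Type) [Field k'] [Fintype k'] [Algebra k k'] :
      |(projCount k' (fun x : Fin (n + 1) → k' =>
        x ⬝ᵥ (A.map (algebraMap k k')).mulVec x = 0) : ℝ) -
          (projCard (Nat.card k') (n - 1) : ℝ)| = (Nat.card k' : ℝ) ^ (n - s) := by
    exact_mod_cast congrArg (Int.cast : ℤ → ℝ)
      ((projCount_quadric_sub_projCard hchar hn hA hA0 k').2 s hs)
  constructor
  · intro h_bad
    by_contra h_not
    refine h_bad ⟨1, one_pos, fun k' _ _ _ => ?_⟩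
    have h_card : (1 : ℝ) ≤ Nat.card k' := by exact_mod_cast (Finite.one_lt_card (α := k')).le
    rw [one_mul]
    rcases Nat.even_or_odd' A.rank with ⟨s, hs | hs⟩
    · have h_lt : n < 2 * s := by
        rw [← hs]
        exact not_le.1 fun h => h_not ⟨hs ▸ even_two_mul s, h⟩
      rw [h_even hs, ← Real.rpow_natCast]
      refine Real.rpow_le_rpow_of_exponent_le h_card ?_
      have h_le : 2 * s ≤ n + 1 := by
        simpa [← hs] using A.rank_le_card_width
      rw [Nat.cast_sub (by omega)]
      have : (n : ℝ) + 1 ≤ 2 * s := by exact_mod_cast h_lt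
      linarith
    · have h_odd := (projCount_quadric_sub_projCard hchar hn hA hA0 k').1 ⟨s, hs⟩
      have h_zero := congrArg (Int.cast : ℤ → ℝ) h_odd
      push_cast at h_zero
      rw [h_zero, abs_zero]
      positivity
  · rintro ⟨⟨s, hs⟩, h_le⟩ ⟨C, hC, h_good⟩
    obtain ⟨N, hN⟩ := exists_nat_gt (C ^ 2)
    have : Fact (ringChar k).Prime := ⟨CharP.char_is_prime k _⟩
    let k' := FiniteField.Extension k (ringChar k) (N + 1)
    have := Fintype.ofFinite k'
    have h_bound := h_good k'
    rw [h_even (s := s) (by omega)] at h_bound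
    set q : ℝ := (Nat.card k' : ℝ) with hq
    have h_one : 1 ≤ q := by
      rw [hq]
      exact_mod_cast (Finite.one_lt_card (α := k')).le
    have h_big : C ^ 2 < q := by
      refine hN.trans_le ?_
      rw [hq, FiniteField.natCard_extension]
      exact_mod_cast (Nat.lt_succ_self N).le.trans
        (Nat.lt_pow_self (Finite.one_lt_card (α := k))).le
    have h_split : q ^ ((n : ℝ) / 2) ≤ q ^ (n - s) := by
      rw [← Real.rpow_natCast]
      refine Real.rpow_le_rpow_of_exponent_le h_one ?_
      rw [Nat.cast_sub (by omega)]
      have : (s : ℝ) + s ≤ n := by exact_mod_cast hs ▸ h_le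
      linarith
    have h_sqrt : q ^ ((n : ℝ) / 2) = √q * q ^ (((n : ℝ) - 1) / 2) := by
      rw [Real.sqrt_eq_rpow, ← Real.rpow_add (by linarith)]
      ring_nf
    have h_lt : C < √q := Real.lt_sqrt_of_sq_lt h_big
    have h_pos : 0 < q ^ (((n : ℝ) - 1) / 2) := by positivity
    have := mul_lt_mul_of_pos_right h_lt h_pos
    linarith
end

section
/- Let k be a finite field and C ∈ k[x,y,z] a nonzero homogeneous cubic form defining the plane cubic curve X := {C = 0} ⊆ ℙ²_k. Assume that C is not of the form λ·L³ for any λ ∈ \overline{k}^× and linear form L over \overline{k} (i.e. X_{\overline{k}} is not a cone over a cone). Then sup over finite extensions k'/k of |#{[v] ∈ ℙ²(k') : C(v) = 0} − #ℙ¹(k')| / |k'|^{1/2} is infinite if and only if C has a nonconstant linear factor in \overline{k}[x,y,z] (i.e. X_{\overline{k}} contains a line in ℙ²_{\overline{k}}). -/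
open MvPolynomial

open Module

/-- An exhaustive multiplicative filtration of an algebra whose Hilbert function is `D * i + O(1)`. -/
structure LinearGrowth (Ω : Type*) [Field Ω] {B : Type*} [CommRing B] [Algebra Ω B]
    (V : ℕ → Submodule Ω B) (D c : ℕ) : Prop where
  mono : Monotone V
  one_mem : 1 ∈ V 0
  mul_mem : ∀ {i j x y}, x ∈ V i → y ∈ V j → x * y ∈ V (i + j)
  exists_mem : ∀ x, ∃ i, x ∈ V i
  finite : ∀ i, Module.Finite Ω (V i)
  le_finrank : ∀ i, D * i ≤ finrank Ω (V i) + c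
  finrank_le : ∀ i, finrank Ω (V i) ≤ D * i + c

namespace LinearGrowth

variable {Ω : Type*} [Field Ω] {B : Type*} [CommRing B] [Algebra Ω B]
  {V : ℕ → Submodule Ω B} {D c : ℕ}

theorem pow_mem (H : LinearGrowth Ω V D c) {i : ℕ} {x : B} (hx : x ∈ V i) (n : ℕ) :
    x ^ n ∈ V (i * n) := by
  induction n with
  | zero => simpa using H.one_mem
  | succ n ih => rw [pow_succ, Nat.mul_succ]; exact H.mul_mem ih hx

/-- A quotient of `B` by a subspace containing the ideal `(h)` has dimension at most that of
`V m`, up to a constant, when `h ∈ V m`. -/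
theorem finrank_le_of_mul_mem_ker [IsDomain B] (H : LinearGrowth Ω V D c) {m : ℕ} {h : B}
    (hm : h ∈ V m) (h0 : h ≠ 0) {W : Type*} [AddCommGroup W] [Module Ω W] [Module.Finite Ω W]
    (f : B →ₗ[Ω] W) (hf : Function.Surjective f) (hfh : ∀ b, f (h * b) = 0) :
    finrank Ω W ≤ D * m + 2 * c := by
  have := H.finite
  let e := finBasis Ω W
  choose b hb using fun i => hf (e i)
  choose k hk using fun i => H.exists_mem (b i)
  let M := Finset.univ.sup k
  have hbM : ∀ i, b i ∈ V M := fun i => H.mono (Finset.le_sup (Finset.mem_univ i)) (hk i)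
  let g : V (m + M) →ₗ[Ω] W := f.comp (V (m + M)).subtype
  have hg : LinearMap.range g = ⊤ := by
    rw [eq_top_iff, ← e.span_eq, Submodule.span_le]
    rintro _ ⟨i, rfl⟩
    exact ⟨⟨b i, H.mono (Nat.le_add_left _ _) (hbM i)⟩, hb i⟩
  let u : V M →ₗ[Ω] LinearMap.ker g :=
    { toFun := fun x => ⟨⟨h * x, H.mul_mem hm x.2⟩, by simp [g, hfh]⟩
      map_add' := fun x y => by ext; simp [mul_add]
      map_smul' := fun a x => by ext; simp }
  have hu : Function.Injective u := by
    intro x y hxy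
    have : h * (x : B) = h * y := congrArg (fun z : LinearMap.ker g => ((z : V (m + M)) : B)) hxy
    exact Subtype.ext (mul_left_cancel₀ h0 this)
  have h1 := LinearMap.finrank_le_finrank_of_injective hu
  have h2 := LinearMap.finrank_range_add_finrank_ker g
  rw [hg, finrank_top] at h2
  have h3 := H.le_finrank M
  have h4 := H.finrank_le (m + M)
  rw [mul_add] at h4
  omega

theorem card_zeros_le [IsDomain B] (H : LinearGrowth Ω V D c) {m : ℕ} {h : B}
    (hm : h ∈ V m) (h0 : h ≠ 0) (S : Finset (B →ₐ[Ω] Ω)) (hS : ∀ ψ ∈ S, ψ h = 0) :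
    S.card ≤ D * m + 2 * c := by
  classical
  let f : B →ₗ[Ω] (S → Ω) := LinearMap.pi fun ψ => ψ.1.toLinearMap
  have hind : LinearIndependent Ω (fun ψ : S => (fun b : B => ψ.1 b)) := by
    have := (linearIndependent_monoidHom B Ω).comp
      (fun ψ : S => (ψ.1 : B →* Ω)) (fun a b hab => Subtype.ext (AlgHom.ext fun x =>
        DFunLike.congr_fun hab x))
    exact this
  have hf : Function.Surjective f := by
    rw [← LinearMap.range_eq_top]
    by_contra hne
    obtain ⟨φ, hφ0, hφ⟩ := Submodule.exists_le_ker_of_lt_top _ (lt_top_iff_ne_top.2 hne)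
    apply hφ0
    have key := Fintype.linearIndependent_iff.1 hind (fun ψ => φ (Pi.single ψ 1)) (by
      ext b
      have hb : φ (f b) = 0 := hφ ⟨b, rfl⟩
      rw [LinearMap.pi_apply_eq_sum_univ] at hb
      have hs (ψ : S) : (fun j => if ψ = j then (1 : Ω) else 0) = Pi.single ψ 1 := by
        ext j; simp [Pi.single_apply, eq_comm]
      simp only [hs] at hb
      simpa [f, mul_comm] using hb)
    refine LinearMap.pi_ext' fun ψ => LinearMap.ext_ring ?_
    simpa using key ψ
  have := H.finrank_le_of_mul_mem_ker hm h0 f hf (fun b => by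
    ext ψ; simp [f, hS ψ.1 ψ.2])
  simpa using this

theorem order_le [IsDomain B] (H : LinearGrowth Ω V D c) (E : B →ₐ[Ω] PowerSeries Ω) {t : B}
    (ht : E t = PowerSeries.X) {m : ℕ} {h : B} (hm : h ∈ V m) (h0 : h ≠ 0) {N : ℕ}
    (hN : ∀ i < N, PowerSeries.coeff i (E h) = 0) : N ≤ D * m + 2 * c := by
  let f : B →ₗ[Ω] (Fin N → Ω) := LinearMap.pi fun i => (PowerSeries.coeff (i : ℕ)).comp E.toLinearMap
  have hf : Function.Surjective f := by
    intro w
    refine ⟨∑ i, w i • t ^ (i : ℕ), ?_⟩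
    ext j
    simp [f, ht, PowerSeries.coeff_X_pow, Fin.val_inj]
  have := H.finrank_le_of_mul_mem_ker hm h0 f hf (fun b => by
    ext i
    have : PowerSeries.coeff (i : ℕ) (E h * E b) = 0 := by
      rw [PowerSeries.coeff_mul]
      refine Finset.sum_eq_zero fun x hx => ?_
      rw [hN x.1 (by have := Finset.HasAntidiagonal.mem_antidiagonal.1 hx; omega), zero_mul]
    simpa [f] using this)
  simpa using this


theorem eq_zero_of_sum_mul_pow_eq_zero [IsDomain B] (H : LinearGrowth Ω V D c) (p : ℕ)
    [Fact p.Prime] [CharP Ω p] (E : B →ₐ[Ω] PowerSeries Ω) (hE : Function.Injective E) {t : B}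
    (ht : E t = PowerSeries.X) {l ν : ℕ} (hl : D * l + 2 * c < p ^ ν) {ι : Type*} [Fintype ι]
    (e : ι → B) (he : ∀ i, e i ∈ V l) (hind : LinearIndependent Ω e) (G : ι → B)
    (hG : ∑ j, e j * G j ^ p ^ ν = 0) (j : ι) : G j = 0 := by
  classical
  by_contra hj
  have : CharP (PowerSeries Ω) p := charP_of_injective_algebraMap
    (algebraMap Ω (PowerSeries Ω)).injective p
  have hex : ∃ m j, PowerSeries.coeff m (E (G j)) ≠ 0 := by
    by_contra hcon
    push Not at hcon
    exact hj (hE (by rw [map_zero]; ext m; simpa using hcon m j))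
  let m := Nat.find hex
  obtain ⟨j₀, hj₀⟩ := Nat.find_spec hex
  have hdvd : ∀ j, (PowerSeries.X : PowerSeries Ω) ^ m ∣ E (G j) := fun j =>
    PowerSeries.X_pow_dvd_iff.2 fun i hi => by
      by_contra hne
      exact Nat.find_min hex hi ⟨j, hne⟩
  choose U hU using hdvd
  let u : ι → Ω := fun j => PowerSeries.constantCoeff (U j)
  have hm0 : ∑ j, E (e j) * U j ^ p ^ ν = 0 := by
    have h1 := congrArg E hG
    simp only [map_sum, map_mul, map_pow, map_zero] at h1
    have h2 : (PowerSeries.X : PowerSeries Ω) ^ (m * p ^ ν) * ∑ j, E (e j) * U j ^ p ^ ν = 0 := by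
      rw [← h1, Finset.mul_sum]
      refine Finset.sum_congr rfl fun j _ => ?_
      rw [hU j, mul_pow, pow_mul]
      ring
    exact (mul_eq_zero.1 h2).resolve_left (pow_ne_zero _ PowerSeries.X_ne_zero)
  have hlow : ∀ i < p ^ ν, PowerSeries.coeff i (E (∑ j, u j ^ p ^ ν • e j)) = 0 := by
    intro i hi
    have h1 := congrArg (PowerSeries.coeff i) hm0
    have h2 : ∀ j, PowerSeries.coeff i (E (e j) * U j ^ p ^ ν) =
        PowerSeries.coeff i (E (u j ^ p ^ ν • e j)) := by
      intro j
      conv_lhs => rw [PowerSeries.eq_X_mul_shift_add_const (U j)]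
      rw [add_pow_char_pow, mul_add, map_add, mul_pow, mul_left_comm, PowerSeries.coeff_X_pow_mul',
        if_neg (not_le.2 hi), zero_add, map_smul, ← map_pow, mul_comm, PowerSeries.coeff_C_mul]
      simp [u]
    rw [map_sum, map_sum, ← Finset.sum_congr rfl fun j _ => h2 j, ← map_sum, h1, map_zero]
  have hne : ∑ j, u j ^ p ^ ν • e j ≠ 0 := by
    intro h0
    have := Fintype.linearIndependent_iff.1 hind _ h0 j₀
    have hu : u j₀ = 0 := eq_zero_of_pow_eq_zero this
    apply hj₀
    rw [hU j₀]
    have h3 := PowerSeries.coeff_X_pow_mul (U j₀) m 0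
    rw [zero_add] at h3
    change PowerSeries.coeff m _ = 0
    rw [h3]
    simpa using hu
  have := H.order_le E ht (Submodule.sum_mem _ fun j _ => Submodule.smul_mem _ _ (he j)) hne hlow
  omega

/-- Stepanov's method: a bound for the number of points on which `T` acts as Frobenius. -/
theorem card_frobenius_le [IsDomain B] [IsAlgClosed Ω] (H : LinearGrowth Ω V D c) (p : ℕ)
    [Fact p.Prime] [CharP Ω p] (E : B →ₐ[Ω] PowerSeries Ω) (hE : Function.Injective E) {t : B}
    (ht : E t = PowerSeries.X) {l m μ ν : ℕ} (hl : D * l + 2 * c < p ^ ν)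
    (hlm : D * (l * p ^ μ + m) + c < (D * l - c) * (D * m - c)) (T : B → B)
    (hT : ∀ b ∈ V m, T b ∈ V m) (S : Finset (B →ₐ[Ω] Ω))
    (hS : ∀ ψ ∈ S, ∀ b, ψ (T b) = ψ b ^ p ^ (μ + ν)) :
    S.card ≤ D * (l + m * p ^ ν) + 2 * c := by
  have := H.finite
  have hp : 0 < p := (Fact.out : p.Prime).pos
  have : CharP B p := charP_of_injective_algebraMap (algebraMap Ω B).injective p
  let e := finBasis Ω (V l)
  let g := finBasis Ω (V m)
  let w : Fin (finrank Ω (V l)) × Fin (finrank Ω (V m)) → V (l * p ^ μ + m) := fun x =>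
    ⟨(e x.1 : B) ^ p ^ μ * T (g x.2), H.mul_mem (H.pow_mem (e x.1).2 _) (hT _ (g x.2).2)⟩
  have hker : LinearMap.ker (Fintype.linearCombination Ω w) ≠ ⊥ := by
    apply LinearMap.ker_ne_bot_of_finrank_lt
    have h1 := H.finrank_le (l * p ^ μ + m)
    have h2 := H.le_finrank l
    have h3 := H.le_finrank m
    have h4 : (D * l - c) * (D * m - c) ≤ finrank Ω (V l) * finrank Ω (V m) :=
      Nat.mul_le_mul (by omega) (by omega)
    simp only [finrank_fintype_fun_eq_card, Fintype.card_prod, Fintype.card_fin]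
    omega
  obtain ⟨A, hA, hA0⟩ := Submodule.exists_mem_ne_zero_of_ne_bot hker
  choose a ha using fun x => IsAlgClosed.exists_pow_nat_eq (A x) (pow_pos hp μ)
  choose b hb using fun x => IsAlgClosed.exists_pow_nat_eq (a x) (pow_pos hp ν)
  let G : Fin (finrank Ω (V l)) → B := fun i => ∑ j, b (i, j) • (g j : B)
  let h : B := ∑ i, (e i : B) * G i ^ p ^ ν
  have hm : h ∈ V (l + m * p ^ ν) := Submodule.sum_mem _ fun i _ =>
    H.mul_mem (e i).2 (H.pow_mem (Submodule.sum_mem _ fun j _ =>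
      Submodule.smul_mem _ _ (g j).2) _)
  have hind (n : ℕ) : LinearIndependent Ω fun i => ((finBasis Ω (V n)) i : B) :=
    (finBasis Ω (V n)).linearIndependent.map' (V n).subtype (Submodule.ker_subtype _)
  have h0 : h ≠ 0 := by
    intro h0
    apply hA0
    ext ⟨i, j⟩
    have h1 := H.eq_zero_of_sum_mul_pow_eq_zero p E hE ht hl (fun i => (e i : B))
      (fun i => (e i).2) (hind l) G h0 i
    have h2 := Fintype.linearIndependent_iff.1 (hind m) _ h1 j
    have h3 : a (i, j) = 0 := by rw [← hb, h2, zero_pow (pow_pos hp ν).ne']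
    rw [← ha, h3, zero_pow (pow_pos hp μ).ne', Pi.zero_apply]
  refine H.card_zeros_le hm h0 S fun ψ hψ => ?_
  have hA' : ∑ x : Fin (finrank Ω (V l)) × Fin (finrank Ω (V m)),
      A x • ((e x.1 : B) ^ p ^ μ * T (g x.2)) = 0 := by
    have := congrArg (fun y : V (l * p ^ μ + m) => (y : B)) (LinearMap.mem_ker.1 hA)
    simpa [Fintype.linearCombination_apply, w] using this
  have hz : ψ h ^ p ^ μ = 0 := by
    have h1 := congrArg ψ hA'
    rw [map_zero] at h1
    rw [← h1, Fintype.sum_prod_type]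
    simp only [h, G, map_sum, map_mul, map_pow, map_smul, smul_eq_mul]
    rw [sum_pow_char_pow]
    refine Finset.sum_congr rfl fun i _ => ?_
    rw [mul_pow, ← pow_mul, ← pow_add, sum_pow_char_pow, Finset.mul_sum]
    refine Finset.sum_congr rfl fun j _ => ?_
    rw [hS ψ hψ, mul_pow, ← ha, ← hb, add_comm ν μ]
    ring
  exact pow_eq_zero_iff (pow_pos hp μ).ne' |>.1 hz

theorem exists_stepanov_parameters (D c p : ℕ) (hD : 0 < D) (hp : 0 < p) :
    ∃ C q₀ : ℕ, ∀ a, q₀ ≤ p ^ a → ∃ l m μ ν : ℕ, μ + ν = a ∧ D * l + 2 * c < p ^ ν ∧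
      D * (l * p ^ μ + m) + c < (D * l - c) * (D * m - c) ∧
      ((D * (l + m * p ^ ν) + 2 * c : ℕ) : ℝ) ≤ p ^ a + C * √(p ^ a) := by
  obtain ⟨K, hK⟩ : ∃ K, K = 4 * (c + 1) := ⟨_, rfl⟩
  obtain ⟨R, hR⟩ : ∃ R, R = 2 * (3 * c + D) + 2 * c + K + D + 1 := ⟨_, rfl⟩
  refine ⟨(1 + c + K + D) * p, p * R ^ 2, fun a ha => ?_⟩
  obtain ⟨μ, ν, hμν, hle, hle'⟩ : ∃ μ ν, μ + ν = a ∧ μ ≤ ν ∧ ν ≤ μ + 1 :=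
    ⟨a / 2, a - a / 2, by omega⟩
  have hP : R ≤ p ^ μ := by
    by_contra hlt
    have h1 : p ^ a ≤ p * (p ^ μ) ^ 2 := by
      rw [← pow_mul, ← pow_succ']
      exact Nat.pow_le_pow_right hp (by omega)
    have h2 : (p ^ μ) ^ 2 < R ^ 2 := Nat.pow_lt_pow_left (not_le.1 hlt) (by norm_num)
    nlinarith
  have hPQ : p ^ μ ≤ p ^ ν := Nat.pow_le_pow_right hp (by omega)
  have hQ : ((p ^ ν : ℕ) : ℝ) ≤ p * √(p ^ a) := by
    have h1 : ((p : ℝ) ^ ν) ^ 2 ≤ p ^ 2 * p ^ a := by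
      rw [← pow_mul, ← pow_add]
      exact pow_le_pow_right₀ (by exact_mod_cast hp) (by omega)
    have h2 := Real.sqrt_le_sqrt h1
    rw [Real.sqrt_sq (by positivity), Real.sqrt_mul (by positivity),
      Real.sqrt_sq (by positivity)] at h2
    exact_mod_cast h2
  have hPQa : p ^ μ * p ^ ν = p ^ a := by rw [← pow_add, hμν]
  generalize hPd : p ^ μ = P at *
  generalize hQd : p ^ ν = Q at *
  obtain ⟨l, hl1, hl2⟩ : ∃ l, D * l ≤ Q - 2 * c - 1 ∧ Q - 2 * c - 1 < D * l + D :=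
    ⟨_, Nat.mul_div_le _ _, Nat.lt_mul_div_succ _ hD⟩
  obtain ⟨m, hm1, hm2⟩ : ∃ m, D * m ≤ P + c + K + D ∧ P + c + K < D * m := by
    refine ⟨(P + c + K) / D + 1, ?_, Nat.lt_mul_div_succ _ hD⟩
    have : D * ((P + c + K) / D) ≤ P + c + K := Nat.mul_div_le _ _
    rw [mul_add]; omega
  refine ⟨l, m, μ, ν, hμν, ?_, ?_, ?_⟩
  · rw [hQd]; omega
  · rw [hPd]
    obtain ⟨X, hX⟩ : ∃ X, D * l = X + c := ⟨D * l - c, by omega⟩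
    obtain ⟨Y, hY⟩ : ∃ Y, D * m = Y + c := ⟨D * m - c, by omega⟩
    have e1 : D * (l * P + m) = (X + c) * P + (Y + c) := by rw [← hX, ← hY]; ring
    rw [e1, hX, hY, Nat.add_sub_cancel, Nat.add_sub_cancel]
    have hXP : P ≤ 2 * X := by omega
    obtain ⟨Z, hZ⟩ : ∃ Z, Y = P + K + Z := ⟨Y - (P + K), by omega⟩
    have hZ' : Z ≤ D := by omega
    have hX1 : 1 ≤ X := by omega
    subst hZ
    subst hK
    have hPc : 4 * (c + 1) + 2 * c < P := by omega
    have hPc' : P ≤ (c + 1) * P := Nat.le_mul_of_pos_left _ (by omega)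
    have : 2 * (c + 1) * P ≤ X * (4 * (c + 1)) := by nlinarith
    have : Z ≤ X * Z := by nlinarith
    linarith
  · rw [hQd]
    have h1 : D * (l + m * Q) + 2 * c ≤ P * Q + (1 + c + K + D) * Q := by
      have : D * m * Q ≤ (P + c + K + D) * Q := Nat.mul_le_mul_right _ hm1
      have e : D * (l + m * Q) = D * l + D * m * Q := by ring
      rw [e]
      have : D * l + 2 * c ≤ Q := by omega
      linarith
    have h2 : ((D * (l + m * Q) + 2 * c : ℕ) : ℝ) ≤ ((P * Q + (1 + c + K + D) * Q : ℕ) : ℝ) :=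
      by exact_mod_cast h1
    refine h2.trans ?_
    rw [hPQa]
    have h3 := mul_le_mul_of_nonneg_left hQ (Nat.cast_nonneg (α := ℝ) (1 + c + K + D))
    push_cast at h3 ⊢
    linarith

/-- The constants depend on the filtration only, not on the exponent `a` or on `T`. -/
theorem exists_card_frobenius_le [IsDomain B] [IsAlgClosed Ω] (H : LinearGrowth Ω V D c)
    (hD : 0 < D) (p : ℕ) [Fact p.Prime] [CharP Ω p] (E : B →ₐ[Ω] PowerSeries Ω)
    (hE : Function.Injective E) {t : B} (ht : E t = PowerSeries.X) :
    ∃ C q₀ : ℕ, ∀ a, q₀ ≤ p ^ a → ∀ T : B → B, (∀ m, ∀ b ∈ V m, T b ∈ V m) →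
      ∀ S : Finset (B →ₐ[Ω] Ω), (∀ ψ ∈ S, ∀ b, ψ (T b) = ψ b ^ p ^ a) →
        (S.card : ℝ) ≤ p ^ a + C * √(p ^ a) := by
  obtain ⟨C, q₀, h⟩ := exists_stepanov_parameters D c p hD (Fact.out : p.Prime).pos
  refine ⟨C, q₀, fun a ha T hT S hS => ?_⟩
  obtain ⟨l, m, μ, ν, rfl, hl, hlm, hle⟩ := h a ha
  have := H.card_frobenius_le p E hE ht hl hlm T (hT m) S hS
  exact (by exact_mod_cast this : (S.card : ℝ) ≤ _).trans hle

end LinearGrowth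

open Polynomial in
/-- The span of the monomials in `X` and the elements of `Z` of weighted degree at most `m`, where
`X` has weight one and the elements of `Z` have weight `κ`. -/
noncomputable def weightFiltration {F B : Type*} [Field F] [CommRing B] [Algebra F B]
    [Algebra F[X] B] (Z : Set B) (κ m : ℕ) : Submodule F B :=
  Submodule.span F {b | ∃ (i : ℕ) (s : Multiset B), (∀ z ∈ s, z ∈ Z) ∧ i + κ * s.card ≤ m ∧
    b = algebraMap F[X] B X ^ i * s.prod}

namespace weightFiltration

open Polynomial

variable {F B : Type*} [Field F] [CommRing B] [Algebra F B] [Algebra F[X] B] {Z : Set B}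

theorem mono (κ : ℕ) : Monotone (weightFiltration (F := F) Z κ) := by
  intro m n hmn
  refine Submodule.span_mono ?_
  rintro _ ⟨i, s, hs, h, rfl⟩
  exact ⟨i, s, hs, h.trans hmn, rfl⟩

theorem one_mem (κ : ℕ) : 1 ∈ weightFiltration (F := F) Z κ 0 :=
  Submodule.subset_span ⟨0, 0, by simp, by simp, by simp⟩

theorem mul_mem {κ i j : ℕ} {x y : B} (hx : x ∈ weightFiltration (F := F) Z κ i)
    (hy : y ∈ weightFiltration (F := F) Z κ j) : x * y ∈ weightFiltration (F := F) Z κ (i + j) := by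
  have := Submodule.mul_mem_mul hx hy
  rw [weightFiltration, weightFiltration, Submodule.span_mul_span] at this
  refine Submodule.span_mono ?_ this
  rintro _ ⟨_, ⟨k, s, hs, h, rfl⟩, _, ⟨l, u, hu, h', rfl⟩, rfl⟩
  refine ⟨k + l, s + u, ?_, ?_, ?_⟩
  · intro z hz
    exact (Multiset.mem_add.1 hz).elim (hs z) (hu z)
  · rw [Multiset.card_add]; linarith
  · simp only [Multiset.prod_add]; ring

theorem X_pow_mem (κ i : ℕ) : algebraMap F[X] B X ^ i ∈ weightFiltration (F := F) Z κ i :=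
  Submodule.subset_span ⟨i, 0, by simp, by simp, by simp⟩

theorem mem_of_mem (κ : ℕ) {z : B} (hz : z ∈ Z) : z ∈ weightFiltration (F := F) Z κ κ :=
  Submodule.subset_span ⟨0, {z}, by simpa, by simp, by simp⟩

theorem algebraMap_mem [IsScalarTower F F[X] B] (κ : ℕ) {a : F[X]} {n : ℕ} (ha : a.natDegree ≤ n) :
    algebraMap F[X] B a ∈ weightFiltration (F := F) Z κ n := by
  rw [a.as_sum_range' (n + 1) (by omega), map_sum]
  refine Submodule.sum_mem _ fun i hi => ?_
  rw [← smul_X_eq_monomial, ← algebraMap_smul F[X], smul_eq_mul, map_mul,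
    ← IsScalarTower.algebraMap_apply, ← Algebra.smul_def, map_pow]
  exact Submodule.smul_mem _ _ (mono κ (by grind) (X_pow_mem κ i))

theorem exists_mem [IsScalarTower F F[X] B] (hZ : Algebra.adjoin F[X] Z = ⊤) (κ : ℕ) (b : B) :
    ∃ i, b ∈ weightFiltration (F := F) Z κ i := by
  have hb : b ∈ Algebra.adjoin F[X] Z := hZ ▸ Algebra.mem_top
  induction hb using Algebra.adjoin_induction with
  | mem x hx => exact ⟨κ, mem_of_mem κ hx⟩
  | algebraMap r => exact ⟨_, algebraMap_mem κ le_rfl⟩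
  | add x y _ _ hx hy =>
    obtain ⟨i, hi⟩ := hx
    obtain ⟨j, hj⟩ := hy
    exact ⟨i + j, Submodule.add_mem _ (mono κ (Nat.le_add_right i j) hi)
      (mono κ (Nat.le_add_left j i) hj)⟩
  | mul x y _ _ hx hy =>
    obtain ⟨i, hi⟩ := hx
    obtain ⟨j, hj⟩ := hy
    exact ⟨i + j, mul_mem hi hj⟩

/-- A ring endomorphism which is semilinear over `F`, fixes `X` and permutes `Z` preserves the
filtration. -/
theorem map_mem (κ : ℕ) (σ : F →+* F) (T : B →+* B)
    (hσ : ∀ a, T (algebraMap F B a) = algebraMap F B (σ a))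
    (hX : T (algebraMap F[X] B X) = algebraMap F[X] B X) (hTZ : ∀ z ∈ Z, T z ∈ Z) {m : ℕ} {b : B}
    (hb : b ∈ weightFiltration (F := F) Z κ m) : T b ∈ weightFiltration (F := F) Z κ m := by
  induction hb using Submodule.span_induction with
  | mem x hx =>
    obtain ⟨i, s, hs, h, rfl⟩ := hx
    refine Submodule.subset_span ⟨i, s.map T, ?_, by simpa, ?_⟩
    · intro z hz
      obtain ⟨w, hw, rfl⟩ := Multiset.mem_map.1 hz
      exact hTZ w (hs w hw)
    · rw [map_mul, map_pow, hX, map_multiset_prod]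
  | zero => rw [map_zero]; exact Submodule.zero_mem _
  | add x y _ _ hx hy => rw [map_add]; exact Submodule.add_mem _ hx hy
  | smul a x _ hx =>
    rw [Algebra.smul_def, map_mul, hσ, ← Algebra.smul_def]
    exact Submodule.smul_mem _ _ hx

theorem linearGrowth [IsScalarTower F F[X] B] (hZ : Algebra.adjoin F[X] Z = ⊤) (hfin : Z.Finite)
    {ι : Type*} [Fintype ι] (w : Basis ι F[X] B) :
    ∃ κ c, LinearGrowth F (weightFiltration (F := F) Z κ) (Fintype.card ι) c := by
  classical
  have key : ∀ s : Set B, s.Finite → ∃ n, ∀ b ∈ s, ∀ j, (w.repr b j).natDegree ≤ n := by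
    intro s hs
    refine ⟨hs.toFinset.sup fun b => Finset.univ.sup fun j => (w.repr b j).natDegree,
      fun b hb j => ?_⟩
    exact (Finset.le_sup (f := fun j => (w.repr b j).natDegree) (Finset.mem_univ j)).trans
      (Finset.le_sup (f := fun b => Finset.univ.sup fun j => (w.repr b j).natDegree)
        (hs.mem_toFinset.2 hb))
  obtain ⟨κ, hκ⟩ := key (⋃ z ∈ Z, Set.range fun j => z * w j)
    (hfin.biUnion fun z _ => Set.finite_range _)
  obtain ⟨c₀, hc₀⟩ := key {1} (Set.finite_singleton _)
  choose k hk using fun j => exists_mem hZ κ (w j)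
  let w₀ := Finset.univ.sup k
  have hw₀ : ∀ j, w j ∈ weightFiltration (F := F) Z κ w₀ := fun j =>
    mono κ (Finset.le_sup (Finset.mem_univ j)) (hk j)
  have hmul : ∀ z ∈ Z, ∀ b n, (∀ j, (w.repr b j).natDegree ≤ n) →
      ∀ j, (w.repr (z * b) j).natDegree ≤ n + κ := by
    intro z hz b n hb j
    have : z * b = ∑ i, w.repr b i • (z * w i) := by
      conv_lhs => rw [← w.sum_repr b, Finset.mul_sum]
      simp only [mul_smul_comm]
    rw [this, map_sum, Finsupp.finsetSum_apply]
    refine natDegree_sum_le_of_forall_le _ _ fun i _ => ?_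
    rw [map_smul, Finsupp.smul_apply, smul_eq_mul]
    refine natDegree_mul_le.trans (Nat.add_le_add (hb i) ?_)
    exact hκ _ (Set.mem_iUnion₂.2 ⟨z, hz, i, rfl⟩) j
  let γ (n : ℕ) : (ι → degreeLT F n) →ₗ[F] B :=
    ((w.equivFun.symm.restrictScalars F : (ι → F[X]) ≃ₗ[F] B) : (ι → F[X]) →ₗ[F] B) ∘ₗ
      LinearMap.pi fun j => (degreeLT F n).subtype ∘ₗ LinearMap.proj j
  have hγ : ∀ n f, γ n f = ∑ j, ((f j : degreeLT F n) : F[X]) • w j := fun n f => by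
    simp [γ, Basis.equivFun_symm_apply]
  have hinj : ∀ n, Function.Injective (γ n) := by
    intro n f g hfg
    have h := w.equivFun.symm.injective hfg
    funext j
    exact Subtype.ext (congrFun h j)
  have hrank : ∀ n, finrank F (LinearMap.range (γ n)) = Fintype.card ι * n := by
    intro n
    rw [LinearMap.finrank_range_of_inj (hinj n), ((LinearEquiv.piCongrRight
      fun _ : ι => degreeLTEquiv F n)).finrank_eq]
    simp [Module.finrank_pi_fintype]
  have hfing : ∀ n, Module.Finite F (LinearMap.range (γ n)) := fun n => by
    have : Module.Finite F (degreeLT F n) := Module.Finite.equiv (degreeLTEquiv F n).symm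
    infer_instance
  have hmem : ∀ n b, (∀ j, (w.repr b j).natDegree ≤ n) → b ∈ LinearMap.range (γ (n + 1)) := by
    intro n b hb
    refine ⟨fun j => ⟨w.repr b j, mem_degreeLT.2 ?_⟩, ?_⟩
    · exact lt_of_le_of_lt (degree_le_of_natDegree_le (hb j)) (by exact_mod_cast Nat.lt_succ_self n)
    · rw [hγ]; exact w.sum_repr b
  have hle : ∀ m, weightFiltration (F := F) Z κ m ≤ LinearMap.range (γ (m + c₀ + 1)) := by
    intro m
    refine Submodule.span_le.2 ?_
    rintro _ ⟨i, s, hs, h, rfl⟩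
    apply hmem
    have : ∀ j, (w.repr s.prod j).natDegree ≤ c₀ + κ * s.card := by
      clear h
      induction s using Multiset.induction_on with
      | empty => simpa using hc₀
      | cons z s ih =>
        intro j
        rw [Multiset.prod_cons, Multiset.card_cons, mul_add, mul_one, ← add_assoc]
        exact hmul z (hs z (by simp)) _ _ (ih fun z hz => hs z (by simp [hz])) j
    intro j
    rw [← map_pow, ← Algebra.smul_def, map_smul, Finsupp.smul_apply, smul_eq_mul]
    refine natDegree_mul_le.trans ?_
    rw [natDegree_X_pow]
    linarith [this j]
  have hge : ∀ m, LinearMap.range (γ (m + 1)) ≤ weightFiltration (F := F) Z κ (m + w₀) := by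
    rintro m _ ⟨f, rfl⟩
    rw [hγ]
    refine Submodule.sum_mem _ fun j _ => ?_
    rw [Algebra.smul_def]
    refine mul_mem (algebraMap_mem κ ?_) (hw₀ j)
    exact natDegree_le_iff_coeff_eq_zero.2 fun N hN =>
      (degree_lt_iff_coeff_zero _ _).1 (mem_degreeLT.1 (f j).2) N hN
  have hfinV : ∀ m, Module.Finite F (weightFiltration (F := F) Z κ m) := fun m => by
    have := hfing (m + c₀ + 1)
    exact Submodule.finiteDimensional_of_le (hle m)
  refine ⟨κ, Fintype.card ι * (w₀ + c₀ + 1), mono κ, one_mem κ, mul_mem, exists_mem hZ κ, hfinV,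
    fun i => ?_, fun i => ?_⟩
  · rcases le_total w₀ i with h | h
    · obtain ⟨m, rfl⟩ := Nat.exists_eq_add_of_le' h
      have := hfinV (m + w₀)
      have h1 := Submodule.finrank_mono (hge m)
      rw [hrank] at h1
      nlinarith
    · nlinarith [Nat.mul_le_mul_left (Fintype.card ι) h]
  · have := hfing (i + c₀ + 1)
    have h1 := Submodule.finrank_mono (hle i)
    rw [hrank] at h1
    nlinarith

end weightFiltration

namespace Polynomial

open Polynomial

section Frobenius

variable {F : Type*} [Field F] {B : Type*} [CommRing B] [Algebra F[X] B]
  {G : Type*} [Group G] [MulSemiringAction G B] [SMulCommClass G F[X] B]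

/-- Two points of an invariant extension with the same image are conjugate. -/
theorem exists_apply_smul_eq [Finite G] [Algebra.IsInvariant F[X] B G] (χ₁ χ₂ : B →+* F)
    (h : ∀ a : F[X], χ₁ (algebraMap F[X] B a) = χ₂ (algebraMap F[X] B a))
    (hs : ∀ x, ∃ a : F[X], χ₁ (algebraMap F[X] B a) = x) : ∃ τ : G, ∀ b, χ₂ (τ • b) = χ₁ b := by
  have := RingHom.ker_isPrime χ₁
  have := RingHom.ker_isPrime χ₂
  obtain ⟨τ, hτ⟩ := Algebra.IsInvariant.exists_smul_of_under_eq F[X] B G (RingHom.ker χ₂)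
    (RingHom.ker χ₁) (by ext a; simp [Ideal.under, RingHom.mem_ker, h])
  refine ⟨τ⁻¹, fun b => ?_⟩
  obtain ⟨a, ha⟩ := hs (χ₁ b)
  have hb : b - algebraMap F[X] B a ∈ RingHom.ker χ₁ := by simp [RingHom.mem_ker, ha]
  rw [hτ, Ideal.mem_pointwise_smul_iff_inv_smul_mem, RingHom.mem_ker, smul_sub, map_sub,
    smul_algebraMap, ← h, ha, sub_eq_zero] at hb
  exact hb

variable [Algebra F B] [IsScalarTower F F[X] B]

theorem algHom_comp_algebraMap (ψ : B →ₐ[F] F) :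
    (ψ : B →+* F).comp (algebraMap F[X] B) = evalRingHom (ψ (algebraMap F[X] B X)) := by
  ext c
  · have := ψ.commutes c
    rw [IsScalarTower.algebraMap_apply F F[X] B] at this
    simpa using this
  · simp

open scoped Classical in
/-- If every twisted Frobenius has at most `U` points, then the number of rational points on the
fibres over `Γ` is close to `U`. -/
theorem card_fibre_points_bounds [Fintype G] [Algebra.IsInvariant F[X] B G] {ι : Type*} [Fintype ι]
    [Nonempty ι] {z : ι → B} {g : F[X][X]} (hg : g.map (algebraMap F[X] B) = ∏ i, (X - C (z i)))
    (hz : ∀ (τ : G) i, ∃ j, τ • z i = z j) (htrans : ∀ i j, ∃ τ : G, τ • z i = z j)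
    (hfaith : ∀ τ τ' : G, (∀ i, τ • z i = τ' • z i) → τ = τ') {q : ℕ} {σ : F →+* F}
    (hσ : ∀ x, σ x = x ^ q) (hσs : Function.Surjective σ) (Φ : B →+* B)
    (hΦ : ∀ a : F[X], Φ (algebraMap F[X] B a) = algebraMap F[X] B (a.map σ))
    (hΦz : ∀ i, ∃ j, Φ (z i) = z j) (hΦi : Function.Injective Φ)
    (Γ : Finset F) (hΓ : ∀ t ∈ Γ, t ^ q = t)
    (hsep : ∀ t ∈ Γ, (g.map (evalRingHom t)).Separable)
    (hψ : ∀ t ∈ Γ, ∃ ψ : B →ₐ[F] F, ψ (algebraMap F[X] B X) = t) (U : ℝ)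
    (hU : ∀ (τ : G) (S : Finset (B →ₐ[F] F)), (∀ ψ ∈ S, ∀ b, ψ (Φ (τ • b)) = ψ b ^ q) →
      (S.card : ℝ) ≤ U) :
    ((∑ t ∈ Γ, ((g.map (evalRingHom t)).roots.toFinset.filter fun y => y ^ q = y).card : ℕ) : ℝ)
        ≤ U ∧
      U - Fintype.card ι * (U - Γ.card) ≤
        ((∑ t ∈ Γ, ((g.map (evalRingHom t)).roots.toFinset.filter fun y => y ^ q = y).card : ℕ) :
          ℝ) := by
  have hmap : ∀ ψ : B →ₐ[F] F,
      g.map (evalRingHom (ψ (algebraMap F[X] B X))) = ∏ i, (X - C (ψ (z i))) := by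
    intro ψ
    rw [← algHom_comp_algebraMap, ← Polynomial.map_map, hg, Polynomial.map_prod]
    simp
  have hinj : ∀ ψ : B →ₐ[F] F, ψ (algebraMap F[X] B X) ∈ Γ → Function.Injective fun i => ψ (z i) :=
    fun ψ h => separable_prod_X_sub_C_iff.1 (hmap ψ ▸ hsep _ h)
  have hzi : (Function.Injective z ∧ Nonempty (B →ₐ[F] F)) ∨ Γ = ∅ := by
    rcases Γ.eq_empty_or_nonempty with h | ⟨t, ht⟩
    · exact Or.inr h
    · obtain ⟨ψ, hψt⟩ := hψ t ht
      exact Or.inl ⟨fun i j hij => hinj ψ (hψt ▸ ht) (congrArg ψ hij), ⟨ψ⟩⟩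
  rcases hzi with ⟨hzi, _⟩ | rfl
  swap
  · obtain ⟨i⟩ := ‹Nonempty ι›
    have h0 : 0 ≤ U := by simpa using hU 1 ∅ (by simp)
    have h1 : (1 : ℝ) ≤ Fintype.card ι := by exact_mod_cast Fintype.card_pos_iff.2 ⟨i⟩
    constructor
    · simpa using h0
    · simp; nlinarith
  choose! ψ₀ hψ₀ using hψ
  have hGF : ∀ (τ : G) (c : F), τ • algebraMap F B c = algebraMap F B c := fun τ c => by
    rw [IsScalarTower.algebraMap_apply F F[X] B, smul_algebraMap]
  let P (x : F × G) : B →ₐ[F] F :=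
    { ((ψ₀ x.1 : B →+* F).comp (MulSemiringAction.toRingHom G B x.2)) with
      commutes' := fun c => by simp [hGF] }
  have hP : ∀ x b, P x b = ψ₀ x.1 (x.2 • b) := fun x b => rfl
  have hPX : ∀ x : F × G, x.1 ∈ Γ → P x (algebraMap F[X] B X) = x.1 := fun x hx => by
    rw [hP, smul_algebraMap, hψ₀ _ hx]
  let D := Γ ×ˢ (Finset.univ : Finset G)
  have hD : ∀ x ∈ D, x.1 ∈ Γ := fun x hx => (Finset.mem_product.1 hx).1
  have hPinj : Set.InjOn P D := by
    rintro ⟨t, ρ⟩ hx ⟨t', ρ'⟩ hx' h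
    obtain rfl : t = t' :=
      (hPX (t, ρ) (hD _ hx)).symm.trans ((DFunLike.congr_fun h _).trans (hPX (t', ρ') (hD _ hx')))
    have hi := hinj (ψ₀ t) (by rw [hψ₀ _ (hD _ hx)]; exact hD _ hx)
    rw [hfaith ρ ρ' fun i => ?_]
    have h1 : ψ₀ t (ρ • z i) = ψ₀ t (ρ' • z i) := DFunLike.congr_fun h (z i)
    obtain ⟨j, hj⟩ := hz ρ i
    obtain ⟨j', hj'⟩ := hz ρ' i
    rw [hj, hj'] at h1 ⊢
    rw [hi h1]
  have htype : ∀ x : F × G, x.1 ∈ Γ → ∃ τ : G, ∀ b, P x (Φ (τ • b)) = P x b ^ q := by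
    intro x hx
    obtain ⟨τ, hτ⟩ := exists_apply_smul_eq (G := G) (σ.comp (P x : B →+* F))
      ((P x : B →+* F).comp Φ) (fun a => by
        have h1 := RingHom.congr_fun (algHom_comp_algebraMap (P x)) a
        have h2 := RingHom.congr_fun (algHom_comp_algebraMap (P x)) (a.map σ)
        simp only [RingHom.comp_apply, coe_evalRingHom, hPX x hx] at h1 h2 ⊢
        have h3 : σ x.1 = x.1 := by rw [hσ, hΓ _ hx]
        rw [hΦ, h1, h2, ← eval_map_apply, h3]) (fun y => by
        obtain ⟨c, rfl⟩ := hσs y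
        refine ⟨C c, ?_⟩
        have h1 := RingHom.congr_fun (algHom_comp_algebraMap (P x)) (C c)
        simp only [RingHom.comp_apply, coe_evalRingHom, eval_C] at h1 ⊢
        rw [h1])
    exact ⟨τ, fun b => by simpa [hσ] using hτ b⟩
  choose! ty hty using htype
  choose π hπ using hΦz
  let fx (τ : G) : ℕ := (Finset.univ.filter fun i => Φ (τ • z i) = z i).card
  have hfx : ∀ x ∈ D, ((g.map (evalRingHom x.1)).roots.toFinset.filter fun y => y ^ q = y).card =
      fx (ty x) := by
    intro x hx
    have hi := hinj (P x) (by rw [hPX _ (hD _ hx)]; exact hD _ hx)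
    have hm := hmap (P x)
    rw [hPX _ (hD _ hx)] at hm
    have : (g.map (evalRingHom x.1)).roots.toFinset = Finset.univ.image fun i => P x (z i) := by
      rw [hm, roots_prod _ _ (Finset.prod_ne_zero_iff.2 fun i _ => X_sub_C_ne_zero _)]
      ext y
      simp [eq_comm]
    rw [this, Finset.filter_image, Finset.card_image_of_injective _ hi]
    congr 1
    ext i
    simp only [Finset.mem_filter, Finset.mem_univ, true_and]
    rw [← hty x (hD _ hx)]
    obtain ⟨j, hj⟩ := hz (ty x) i
    rw [hj, hπ]
    exact ⟨fun h => by rw [hi h], fun h => by rw [h]⟩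
  have hsum : ∑ τ, fx τ = Fintype.card G := by
    have hc : ∀ i j k, (Finset.univ.filter fun τ : G => τ • z i = z j).card =
        (Finset.univ.filter fun τ : G => τ • z i = z k).card := by
      intro i j k
      obtain ⟨ρ, hρ⟩ := htrans j k
      refine Finset.card_equiv (Equiv.mulLeft ρ) fun τ => ?_
      simp only [Finset.mem_filter, Finset.mem_univ, true_and, Equiv.coe_mulLeft, mul_smul]
      rw [← hρ, smul_left_cancel_iff]
    have hπb : Function.Bijective π := by
      refine Function.Injective.bijective_of_finite fun i j hij => ?_
      exact hzi (hΦi (by rw [hπ, hπ, hij]))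
    obtain ⟨k⟩ := ‹Nonempty ι›
    have h1 : ∑ τ, fx τ = ∑ i, (Finset.univ.filter fun τ : G => Φ (τ • z i) = z i).card := by
      simp only [fx, Finset.card_filter]
      exact Finset.sum_comm
    have h2 : ∀ i, (Finset.univ.filter fun τ : G => Φ (τ • z i) = z i).card =
        (Finset.univ.filter fun τ : G => τ • z i = z k).card := by
      intro i
      obtain ⟨j, hj⟩ := hπb.2 i
      rw [← hc i j k]
      congr 1
      ext τ
      simp only [Finset.mem_filter, Finset.mem_univ, true_and]
      have h4 : z i = Φ (z j) := by rw [hπ, hj]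
      exact (Iff.of_eq (congrArg _ h4)).trans hΦi.eq_iff
    have h3 : ∑ i, (Finset.univ.filter fun τ : G => τ • z i = z k).card =
        ∑ τ : G, (Finset.univ.filter fun i => τ • z i = z k).card := by
      simp only [Finset.card_filter]
      exact Finset.sum_comm
    rw [h1, Finset.sum_congr rfl fun i _ => h2 i, h3, Finset.sum_congr rfl fun τ _ => ?_]
    · exact (Finset.sum_const 1).trans (by simp)
    · rw [Finset.card_eq_one]
      choose ρ hρ using hz τ⁻¹
      refine ⟨ρ k, ?_⟩
      ext i
      simp only [Finset.mem_filter, Finset.mem_univ, true_and, Finset.mem_singleton]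
      rw [← eq_inv_smul_iff, hρ]
      exact hzi.eq_iff
  let n (τ : G) : ℕ := (D.filter fun x => ty x = τ).card
  have hn : ∀ τ, (n τ : ℝ) ≤ U := by
    intro τ
    have := hU τ ((D.filter fun x => ty x = τ).image P) (by
      intro ψ hψ b
      obtain ⟨x, hx, rfl⟩ := Finset.mem_image.1 hψ
      obtain ⟨hx', rfl⟩ := Finset.mem_filter.1 hx
      exact hty x (hD _ hx') b)
    rwa [Finset.card_image_of_injOn (hPinj.mono (by
      intro x hx
      exact (Finset.mem_filter.1 hx).1))] at this
  have hntot : ∑ τ, n τ = Γ.card * Fintype.card G := by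
    rw [← Finset.card_univ, ← Finset.card_product]
    exact (Finset.card_eq_sum_card_fiberwise fun x _ => Finset.mem_coe.2 (Finset.mem_univ _)).symm
  set N := ∑ t ∈ Γ, ((g.map (evalRingHom t)).roots.toFinset.filter fun y => y ^ q = y).card with hN
  have hNfx : N * Fintype.card G = ∑ τ, n τ * fx τ := by
    have h1 : ∑ x ∈ D, ((g.map (evalRingHom x.1)).roots.toFinset.filter fun y => y ^ q = y).card =
        N * Fintype.card G := by
      rw [Finset.sum_product, hN, Finset.sum_mul]
      simp [mul_comm]
    rw [← h1, Finset.sum_congr rfl hfx, ← Finset.sum_fiberwise D ty]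
    refine Finset.sum_congr rfl fun τ _ => ?_
    rw [Finset.sum_congr rfl fun x hx => by rw [(Finset.mem_filter.1 hx).2], Finset.sum_const,
      smul_eq_mul]
  have hG : (0 : ℝ) < Fintype.card G := by exact_mod_cast Fintype.card_pos
  have hNfx' : (N : ℝ) * Fintype.card G = ∑ τ, (n τ : ℝ) * fx τ := by exact_mod_cast hNfx
  have hsum' : ∑ τ, (fx τ : ℝ) = Fintype.card G := by exact_mod_cast hsum
  have hntot' : ∑ τ, (n τ : ℝ) = Γ.card * Fintype.card G := by exact_mod_cast hntot
  constructor
  · refine le_of_mul_le_mul_right ?_ hG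
    rw [hNfx', ← hsum', Finset.mul_sum]
    exact Finset.sum_le_sum fun τ _ => mul_le_mul_of_nonneg_right (hn τ) (by positivity)
  · refine le_of_mul_le_mul_right ?_ hG
    have h1 : ∑ τ, (U - n τ) * fx τ ≤ ∑ τ, (U - n τ) * (Fintype.card ι : ℝ) := by
      refine Finset.sum_le_sum fun τ _ => mul_le_mul_of_nonneg_left ?_ (sub_nonneg.2 (hn τ))
      exact_mod_cast Finset.card_le_univ _
    simp only [sub_mul, Finset.sum_sub_distrib, ← Finset.sum_mul, ← Finset.mul_sum, hsum',
      ← hNfx', hntot', Finset.sum_const, Finset.card_univ, nsmul_eq_mul] at h1 ⊢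
    linarith

end Frobenius

end Polynomial

namespace Polynomial

open Polynomial

theorem _root_.IsSplittingField.exists_ringHom {K M N : Type*} [Field K] [Field M] [Field N]
    [Algebra K M] (f : K[X]) [IsSplittingField K M f] (i : K →+* N) (h : (f.map i).Splits) :
    ∃ Ψ : M →+* N, Ψ.comp (algebraMap K M) = i := by
  let _ := i.toAlgebra
  exact ⟨(IsSplittingField.lift M f h : M →ₐ[K] N), AlgHom.comp_algebraMap _⟩

/-- The subalgebra generated by the roots of a polynomial. -/
def rootAlgebra {R : Type*} [CommRing R] (g : R[X]) (M : Type*) [Field M] [Algebra R M] :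
    Subalgebra R M :=
  Algebra.adjoin R (g.rootSet M)

namespace rootAlgebra

variable {R : Type*} [CommRing R] (g : R[X]) (M : Type*) [Field M] [Algebra R M]

/-- A root, as an element of the algebra generated by the roots. -/
def root (i : g.rootSet M) : rootAlgebra g M := ⟨i, Algebra.subset_adjoin i.2⟩

theorem adjoin_range_root : Algebra.adjoin R (Set.range (root g M)) = ⊤ := by
  have : Set.range (root g M) = Subtype.val ⁻¹' (g.rootSet M) := by
    ext x
    exact ⟨fun ⟨i, hi⟩ => hi ▸ i.2, fun hx => ⟨⟨x, hx⟩, rfl⟩⟩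
  rw [this]
  exact Algebra.adjoin_adjoin_coe_preimage

variable {g M}

theorem finite (hg : g.Monic) : Module.Finite R (rootAlgebra g M) := by
  refine Module.Finite.iff_fg.2 (fg_adjoin_of_finite (rootSet_finite g M) fun x hx => ⟨g, hg, ?_⟩)
  exact aeval_eq_zero_of_mem_rootSet hx

/-- A ring endomorphism of the ambient field which is compatible with an endomorphism of the
base ring fixing `g` restricts to the root algebra. -/
theorem apply_mem_rootSet [IsDomain R] [Module.IsTorsionFree R M] (σ : R →+* R) (hσ : g.map σ = g)
    (Φ : M →+* M) (h : ∀ a, Φ (algebraMap R M a) = algebraMap R M (σ a)) {x : M}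
    (hx : x ∈ g.rootSet M) : Φ x ∈ g.rootSet M := by
  rw [mem_rootSet] at hx ⊢
  refine ⟨hx.1, ?_⟩
  have h1 : Φ (eval₂ (algebraMap R M) x g) = 0 := by
    rw [← aeval_def, hx.2, map_zero]
  rw [hom_eval₂] at h1
  have h2 : Φ.comp (algebraMap R M) = (algebraMap R M).comp σ := RingHom.ext h
  rwa [h2, ← eval₂_map, hσ] at h1

theorem apply_mem [IsDomain R] [Module.IsTorsionFree R M] (σ : R →+* R) (hσ : g.map σ = g)
    (Φ : M →+* M) (h : ∀ a, Φ (algebraMap R M a) = algebraMap R M (σ a)) {x : M}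
    (hx : x ∈ rootAlgebra g M) : Φ x ∈ rootAlgebra g M := by
  induction hx using Algebra.adjoin_induction with
  | mem x hx => exact Algebra.subset_adjoin (apply_mem_rootSet σ hσ Φ h hx)
  | algebraMap r => rw [h]; exact Subalgebra.algebraMap_mem _ _
  | add x y _ _ hx hy => rw [map_add]; exact Subalgebra.add_mem _ hx hy
  | mul x y _ _ hx hy => rw [map_mul]; exact Subalgebra.mul_mem _ hx hy

theorem map_eq_prod (K : Type*) [Field K] [Algebra R K] [Algebra K M] [IsScalarTower R K M]
    [IsSplittingField K M (g.map (algebraMap R K))] [Fintype (g.rootSet M)] (hg : g.Monic)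
    (hsep : (g.map (algebraMap R K)).Separable) :
    g.map (algebraMap R (rootAlgebra g M)) = ∏ i, (X - C (root g M i)) := by
  have hinj : Function.Injective (algebraMap (rootAlgebra g M) M) := Subtype.val_injective
  refine map_injective _ hinj ?_
  rw [Polynomial.map_map, ← IsScalarTower.algebraMap_eq, Polynomial.map_prod]
  have hs := IsSplittingField.splits M (g.map (algebraMap R K))
  have hm : (g.map (algebraMap R K)).map (algebraMap K M) = g.map (algebraMap R M) := by
    rw [Polynomial.map_map, ← IsScalarTower.algebraMap_eq]
  rw [hm] at hs
  have hsep' : (g.map (algebraMap R M)).Separable := hm ▸ hsep.map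
  rw [hs.eq_prod_roots_of_monic (hg.map _)]
  classical
  have h1 := (Multiset.dedup_eq_self.2 (nodup_roots hsep')).symm
  rw [h1, ← Multiset.toFinset_val]
  refine (Finset.prod_subtype (p := (· ∈ g.rootSet M)) (F := ‹_›) _ (fun x => ?_) _).trans ?_
  · rw [rootSet, aroots]; exact Finset.mem_coe.symm
  · simp only [Polynomial.map_sub, map_X, map_C]
    exact Fintype.prod_congr _ _ fun _ => rfl

section Galois

variable [IsDomain R] {K : Type*} [Field K] [Algebra R K] [Algebra K M] [IsScalarTower R K M]
  [Module.IsTorsionFree R M]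

theorem algEquiv_apply_mem (τ : M ≃ₐ[K] M) {x : M} (hx : x ∈ rootAlgebra g M) :
    τ x ∈ rootAlgebra g M :=
  apply_mem (RingHom.id R) (map_id) (τ : M →+* M)
    (fun a => by simp [IsScalarTower.algebraMap_apply R K M]) hx

noncomputable instance : MulSemiringAction (M ≃ₐ[K] M) (rootAlgebra g M) where
  smul τ b := ⟨τ b, algEquiv_apply_mem τ b.2⟩
  one_smul _ := rfl
  mul_smul _ _ _ := rfl
  smul_zero τ := Subtype.ext (map_zero τ)
  smul_add τ _ _ := Subtype.ext (map_add τ _ _)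
  smul_one τ := Subtype.ext (map_one τ)
  smul_mul τ _ _ := Subtype.ext (map_mul τ _ _)

instance : SMulCommClass (M ≃ₐ[K] M) R (rootAlgebra g M) where
  smul_comm τ a b := Subtype.ext ((τ.toLinearEquiv.restrictScalars R).map_smul a (b : M))

theorem exists_smul_root (τ : M ≃ₐ[K] M) (i : g.rootSet M) :
    ∃ j, τ • root g M i = root g M j :=
  ⟨⟨τ i, apply_mem_rootSet (RingHom.id R) (map_id) (τ : M →+* M)
    (fun a => by simp [IsScalarTower.algebraMap_apply R K M]) i.2⟩, rfl⟩

variable [IsSplittingField K M (g.map (algebraMap R K))]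

variable (K) in
theorem exists_smul_root_eq (hg : g.Monic) (hirr : Irreducible (g.map (algebraMap R K)))
    (i j : g.rootSet M) : ∃ τ : M ≃ₐ[K] M, τ • root g M i = root g M j := by
  have : Normal K M := Normal.of_isSplittingField (g.map (algebraMap R K))
  have hmin : ∀ i : g.rootSet M, minpoly K (i : M) = g.map (algebraMap R K) := by
    intro i
    refine (minpoly.eq_of_irreducible_of_monic hirr ?_ (hg.map _)).symm
    rw [aeval_map_algebraMap]
    exact aeval_eq_zero_of_mem_rootSet i.2
  obtain ⟨τ, hτ⟩ := (Normal.minpoly_eq_iff_mem_orbit M).1 ((hmin j).trans (hmin i).symm)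
  exact ⟨τ, Subtype.ext hτ⟩

theorem eq_of_smul_root_eq (τ τ' : M ≃ₐ[K] M) (h : ∀ i, τ • root g M i = τ' • root g M i) :
    τ = τ' := by
  have h1 := IsSplittingField.adjoin_rootSet M (g.map (algebraMap R K))
  have h2 : (τ : M →ₐ[K] M) = τ' := by
    refine AlgHom.ext_of_adjoin_eq_top h1 fun x hx => ?_
    have hx' : x ∈ g.rootSet M := by
      rw [mem_rootSet] at hx
      rw [mem_rootSet]
      exact ⟨fun h0 => hx.1 (by rw [h0, Polynomial.map_zero]), by
        rw [← aeval_map_algebraMap K]; exact hx.2⟩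
    exact congrArg (fun x : rootAlgebra g M => (x : M)) (h ⟨x, hx'⟩)
  exact AlgEquiv.ext fun x => DFunLike.congr_fun h2 x

variable [IsFractionRing R K]

variable (K) in
theorem isInvariant [IsIntegrallyClosed R] (hg : g.Monic)
    (hsep : (g.map (algebraMap R K)).Separable) :
    Algebra.IsInvariant R (rootAlgebra g M) (M ≃ₐ[K] M) where
  isInvariant b hb := by
    have : IsGalois K M := IsGalois.of_separable_splitting_field hsep
    have : FiniteDimensional K M := IsSplittingField.finiteDimensional M (g.map (algebraMap R K))
    have := finite (M := M) hg
    obtain ⟨x, hx⟩ := (IsGalois.mem_bot_iff_fixed (F := K) (b : M)).2 fun τ =>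
      congrArg (fun x : rootAlgebra g M => (x : M)) (hb τ)
    have hi : IsIntegral R (b : M) := (Algebra.IsIntegral.isIntegral (R := R) b).map
      (rootAlgebra g M).val
    have hx' : algebraMap K M x = b := hx
    rw [← hx'] at hi
    obtain ⟨a, ha⟩ := IsIntegrallyClosed.isIntegral_iff.1
      ((isIntegral_algebraMap_iff (algebraMap K M).injective).1 hi)
    refine ⟨a, Subtype.ext ?_⟩
    rw [← hx', ← ha]
    exact IsScalarTower.algebraMap_apply R K M a

end Galois

/-- An injective endomorphism of the base ring fixing `g` extends to the root algebra. -/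
theorem exists_ringHom [IsDomain R] [Module.IsTorsionFree R M] (K : Type*) [Field K] [Algebra R K]
    [Algebra K M] [IsScalarTower R K M] [IsFractionRing R K]
    [IsSplittingField K M (g.map (algebraMap R K))] (σ : R →+* R) (hσi : Function.Injective σ) (hσ : g.map σ = g) :
    ∃ Φ : rootAlgebra g M →+* rootAlgebra g M, Function.Injective Φ ∧
      (∀ a, Φ (algebraMap R _ a) = algebraMap R _ (σ a)) ∧
        ∀ i, ∃ j, Φ (root g M i) = root g M j := by
  have hi : Function.Injective ((algebraMap R K).comp σ) := (IsFractionRing.injective R K).comp hσi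
  let σK : K →+* K := IsFractionRing.lift hi
  have hσK : ∀ a, σK (algebraMap R K a) = algebraMap R K (σ a) := fun a =>
    IsFractionRing.lift_algebraMap hi a
  obtain ⟨Φ, hΦ⟩ := IsSplittingField.exists_ringHom (M := M) (g.map (algebraMap R K))
    ((algebraMap K M).comp σK) (by
      have : ((algebraMap K M).comp σK).comp (algebraMap R K) =
          ((algebraMap K M).comp (algebraMap R K)).comp σ :=
        RingHom.ext fun a => by simp [hσK]
      rw [Polynomial.map_map, this, ← Polynomial.map_map, hσ, ← Polynomial.map_map]
      exact IsSplittingField.splits M (g.map (algebraMap R K)))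
  have hΦ' : ∀ a, Φ (algebraMap R M a) = algebraMap R M (σ a) := fun a => by
    have := RingHom.congr_fun hΦ (algebraMap R K a)
    simpa only [RingHom.comp_apply, hσK, ← IsScalarTower.algebraMap_apply R K M] using this
  refine ⟨(Φ.comp (rootAlgebra g M).val.toRingHom).codRestrict (rootAlgebra g M)
    fun x => apply_mem σ hσ Φ hΦ' x.2, fun x y h => ?_, fun a => Subtype.ext (hΦ' a),
    fun i => ⟨⟨Φ i, apply_mem_rootSet σ hσ Φ hΦ' i.2⟩, rfl⟩⟩
  exact Subtype.ext (Φ.injective (congrArg (fun x : rootAlgebra g M => (x : M)) h))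

/-- The root algebra embeds in any integrally closed domain over which the polynomial splits. -/
theorem exists_ringHom_of_splits [IsDomain R] (K : Type*) [Field K] [Algebra R K]
    [Algebra K M] [IsScalarTower R K M] [IsFractionRing R K]
    [IsSplittingField K M (g.map (algebraMap R K))] {S : Type*} [CommRing S] [IsDomain S] [IsIntegrallyClosed S]
    (i : R →+* S) (hi : Function.Injective i) (hg : g.Monic) (hs : (g.map i).Splits) :
    ∃ E : rootAlgebra g M →+* S, Function.Injective E ∧ ∀ a, E (algebraMap R _ a) = i a := by
  obtain ⟨L, _, _, _⟩ : ∃ (L : Type _) (_ : Field L) (_ : Algebra S L), IsFractionRing S L :=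
    ⟨FractionRing S, inferInstance, inferInstance, inferInstance⟩
  have hSL : Function.Injective (algebraMap S L) := IsFractionRing.injective S L
  have hi' : Function.Injective ((algebraMap S L).comp i) := hSL.comp hi
  let iK : K →+* L := IsFractionRing.lift hi'
  have hiK : iK.comp (algebraMap R K) = (algebraMap S L).comp i := RingHom.ext fun a =>
    IsFractionRing.lift_algebraMap hi' a
  obtain ⟨Ψ, hΨ⟩ := IsSplittingField.exists_ringHom (M := M) (g.map (algebraMap R K)) iK (by
    rw [Polynomial.map_map, hiK, ← Polynomial.map_map]
    exact hs.map _)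
  have hΨ' : ∀ a, Ψ (algebraMap R M a) = algebraMap S L (i a) := fun a => by
    have := RingHom.congr_fun hΨ (algebraMap R K a)
    rw [RingHom.comp_apply, ← IsScalarTower.algebraMap_apply R K M] at this
    rw [this]
    exact RingHom.congr_fun hiK a
  have := finite (M := M) hg
  have hmem : ∀ b : rootAlgebra g M, ∃ y, algebraMap S L y = Ψ b := by
    intro b
    refine IsIntegrallyClosed.isIntegral_iff.1 ?_
    obtain ⟨f, hf, hfb⟩ := Algebra.IsIntegral.isIntegral (R := R) b
    refine ⟨f.map i, hf.map _, ?_⟩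
    have h1 : (algebraMap S L).comp i =
        (Ψ.comp (rootAlgebra g M).val.toRingHom).comp (algebraMap R (rootAlgebra g M)) :=
      RingHom.ext fun a => (hΨ' a).symm
    have h2 := congrArg (Ψ.comp (rootAlgebra g M).val.toRingHom) hfb
    rw [map_zero, hom_eval₂] at h2
    rw [eval₂_map, h1]
    exact h2
  choose e he using hmem
  refine ⟨{ toFun := e, map_one' := ?_, map_zero' := ?_, map_add' := ?_, map_mul' := ?_ }, ?_, ?_⟩
  · exact hSL (by rw [he]; simp)
  · exact fun x y => hSL (by rw [map_mul, he, he, he]; simp)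
  · exact hSL (by rw [he]; simp)
  · exact fun x y => hSL (by rw [map_add, he, he, he]; simp)
  · intro x y h
    refine Subtype.ext (Ψ.injective ?_)
    rw [← he, ← he]
    exact congrArg _ h
  · exact fun a => hSL ((he _).trans (hΨ' a))

end rootAlgebra

end Polynomial

namespace Polynomial

open Polynomial

section Hensel

variable {F : Type*} [Field F]

/-- Power series expansion of a polynomial at the point `t`. -/
noncomputable def expandAt (t : F) : F[X] →+* PowerSeries F :=
  coeToPowerSeries.ringHom.comp (taylorAlgHom t : F[X] →+* F[X])

theorem expandAt_injective (t : F) : Function.Injective (expandAt t) :=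
  (coe_injective F).comp (taylor_injective t)

theorem expandAt_C (t c : F) : expandAt t (C c) = PowerSeries.C c := by
  simp [expandAt]

theorem expandAt_X (t : F) : expandAt t X = PowerSeries.X + PowerSeries.C t := by
  simp [expandAt]

theorem constantCoeff_comp_expandAt (t : F) :
    PowerSeries.constantCoeff.comp (expandAt t) = evalRingHom t := by
  ext <;> simp [expandAt_C, expandAt_X]

theorem splits_map_expandAt [IsAlgClosed F] {g : F[X][X]} (hg : g.Monic) {t : F}
    (hsep : (g.map (evalRingHom t)).Separable) : (g.map (expandAt t)).Splits := by
  classical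
  have hred : (g.map (expandAt t)).map PowerSeries.constantCoeff = g.map (evalRingHom t) := by
    rw [Polynomial.map_map, constantCoeff_comp_expandAt]
  have hlift : ∀ y ∈ (g.map (evalRingHom t)).roots,
      ∃ Y, (g.map (expandAt t)).IsRoot Y ∧ PowerSeries.constantCoeff Y = y := by
    intro y hy
    have hy' : (g.map (evalRingHom t)).IsRoot y := isRoot_of_mem_roots hy
    have h1 : ∀ f : (PowerSeries F)[X], PowerSeries.constantCoeff (f.eval (PowerSeries.C y)) =
        (f.map PowerSeries.constantCoeff).eval y := fun f => by
      rw [← eval₂_id, hom_eval₂, eval_map]; simp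
    have hu : IsUnit ((g.map (expandAt t)).derivative.eval (PowerSeries.C y)) := by
      rw [PowerSeries.isUnit_iff_constantCoeff, h1, ← derivative_map, hred, isUnit_iff_ne_zero]
      simpa using hsep.aeval_derivative_ne_zero (x := y) (by simpa using hy')
    have : HenselianRing (PowerSeries F) (Ideal.span {PowerSeries.X}) :=
      IsAdicComplete.henselianRing _ _
    obtain ⟨Y, hY, hYy⟩ := HenselianRing.is_henselian (I := Ideal.span {PowerSeries.X})
      (g.map (expandAt t)) (hg.map _) (PowerSeries.C y) (by
        rw [Ideal.mem_span_singleton, PowerSeries.X_dvd_iff, h1, hred]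
        exact hy') (hu.map _)
    refine ⟨Y, hY, ?_⟩
    rw [Ideal.mem_span_singleton, PowerSeries.X_dvd_iff, map_sub, sub_eq_zero] at hYy
    simpa using hYy
  choose! Y hY hYy using hlift
  have hnd := nodup_roots hsep
  rw [splits_iff_card_roots]
  refine le_antisymm (card_roots' _) ?_
  have hd : (g.map (expandAt t)).natDegree = (g.map (evalRingHom t)).roots.card := by
    rw [← (IsAlgClosed.splits (g.map (evalRingHom t))).natDegree_eq_card_roots, hg.natDegree_map,
      hg.natDegree_map]
  have hnd' : ((g.map (evalRingHom t)).roots.map Y).Nodup :=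
    hnd.map_on fun x hx y hy hxy => by rw [← hYy x hx, ← hYy y hy, hxy]
  rw [hd, ← Multiset.card_map Y]
  refine Multiset.card_le_card ((Multiset.le_iff_subset hnd').2 fun x hx => ?_)
  obtain ⟨y, hy, rfl⟩ := Multiset.mem_map.1 hx
  exact (mem_roots (hg.map _).ne_zero).2 (hY y hy)

end Hensel

/-- The fibres of a separable polynomial are separable away from finitely many points. -/
theorem exists_separable_map_evalRingHom {F : Type*} [Field F] {g : F[X][X]}
    (hsep : (g.map (algebraMap F[X] (FractionRing F[X]))).Separable) :
    ∃ r : F[X], r ≠ 0 ∧ ∀ t, r.eval t ≠ 0 → (g.map (evalRingHom t)).Separable := by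
  obtain ⟨u, v, huv⟩ := hsep
  obtain ⟨b, hb, hbu⟩ := IsLocalization.integerNormalization_spec (nonZeroDivisors F[X]) u
  obtain ⟨c, hc, hcv⟩ := IsLocalization.integerNormalization_spec (nonZeroDivisors F[X]) v
  set u' := IsLocalization.integerNormalization (nonZeroDivisors F[X]) u
  set v' := IsLocalization.integerNormalization (nonZeroDivisors F[X]) v
  have key : C c * u' * g + C b * v' * derivative g = C (b * c) := by
    refine map_injective (algebraMap F[X] (FractionRing F[X])) (IsFractionRing.injective _ _) ?_
    have e1 : ∀ (x : F[X]) (f : (FractionRing F[X])[X]),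
        x • f = C (algebraMap F[X] (FractionRing F[X]) x) * f := fun x f => by
      rw [← smul_eq_C_mul, algebraMap_smul]
    simp only [Polynomial.map_add, Polynomial.map_mul, map_C, hbu, hcv, e1, ← derivative_map,
      map_mul]
    linear_combination C (algebraMap F[X] (FractionRing F[X]) b) *
      C (algebraMap F[X] (FractionRing F[X]) c) * huv
  refine ⟨b * c, mul_ne_zero (nonZeroDivisors.ne_zero hb) (nonZeroDivisors.ne_zero hc),
    fun t ht => ?_⟩
  have key' := congrArg (Polynomial.map (evalRingHom t)) key
  simp only [Polynomial.map_add, Polynomial.map_mul, map_C, ← derivative_map] at key'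
  refine ⟨C ((b * c).eval t)⁻¹ * ((C (evalRingHom t c)) * u'.map (evalRingHom t)),
    C ((b * c).eval t)⁻¹ * (C (evalRingHom t b) * v'.map (evalRingHom t)), ?_⟩
  rw [mul_assoc, mul_assoc _ _ (derivative _), ← mul_add, key', ← C_mul]
  simp only [coe_evalRingHom]
  rw [inv_mul_cancel₀ ht, C_1]

end Polynomial

namespace Polynomial

open Polynomial

variable {F : Type*} [Field F]

open scoped Classical in
theorem natCard_fibres_eq_sum {q : ℕ} (hq : 1 < q) (g : F[X][X])
    (hg : ∀ t : F, g.map (evalRingHom t) ≠ 0) :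
    Nat.card {x : F × F // x.1 ^ q = x.1 ∧ x.2 ^ q = x.2 ∧ g.evalEval x.1 x.2 = 0} =
      ∑ t ∈ (X ^ q - X : F[X]).roots.toFinset,
        ((g.map (evalRingHom t)).roots.toFinset.filter fun y => y ^ q = y).card := by
  rw [← Finset.card_sigma]
  have : Nat.card {x : F × F // x.1 ^ q = x.1 ∧ x.2 ^ q = x.2 ∧ g.evalEval x.1 x.2 = 0} =
      Nat.card ((X ^ q - X : F[X]).roots.toFinset.sigma fun t =>
        (g.map (evalRingHom t)).roots.toFinset.filter fun y => y ^ q = y) := by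
    refine Nat.card_congr ((Equiv.sigmaEquivProd F F).symm.subtypeEquiv fun x => ?_)
    simp only [Equiv.sigmaEquivProd_symm_apply, Finset.mem_sigma, Multiset.mem_toFinset,
      Finset.mem_filter, mem_roots (hg x.1), mem_roots (FiniteField.X_pow_card_sub_X_ne_zero F hq),
      IsRoot, eval_sub, eval_pow, eval_X, sub_eq_zero, map_evalRingHom_eval]
    tauto
  rw [this, Nat.card_eq_fintype_card, Fintype.card_coe]

theorem card_roots_X_pow_sub_X [IsAlgClosed F] [DecidableEq F] (p a : ℕ) [Fact p.Prime] [CharP F p]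
    (ha : 0 < a) : (X ^ p ^ a - X : F[X]).roots.toFinset.card = p ^ a := by
  have hp : 1 < p ^ a := Nat.one_lt_pow ha.ne' (Fact.out : p.Prime).one_lt
  rw [Multiset.toFinset_card_of_nodup
    (nodup_roots (galois_poly_separable p _ (dvd_pow_self p ha.ne'))),
    ← (IsAlgClosed.splits _).natDegree_eq_card_roots, FiniteField.X_pow_card_sub_X_natDegree_eq F hp]

open scoped Classical in
theorem exists_card_fibres_bounds {K M : Type*} [Field K] [Field M] [Algebra F[X] K]
    [IsFractionRing F[X] K] [Algebra K M] [Algebra F[X] M] [IsScalarTower F[X] K M] [Algebra F M]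
    [IsScalarTower F F[X] M] [IsAlgClosed F] (p : ℕ) [Fact p.Prime] [CharP F p] {g : F[X][X]}
    [IsSplittingField K M (g.map (algebraMap F[X] K))] (hg : g.Monic)
    (hirr : Irreducible (g.map (algebraMap F[X] K)))
    (hsep : (g.map (algebraMap F[X] K)).Separable) {r : F[X]} (hr0 : r ≠ 0)
    (hr : ∀ t, r.eval t ≠ 0 → (g.map (evalRingHom t)).Separable) :
    ∃ C q₀ d : ℕ, ∀ a, q₀ ≤ p ^ a → g.map (mapRingHom (iterateFrobenius F p a)) = g →
      ∀ (Γ : Finset F), (∀ t ∈ Γ, t ^ p ^ a = t ∧ r.eval t ≠ 0) →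
      ((∑ t ∈ Γ, ((g.map (evalRingHom t)).roots.toFinset.filter fun y => y ^ p ^ a = y).card : ℕ) :
        ℝ) ≤ p ^ a + C * √(p ^ a) ∧
      (p ^ a + C * √(p ^ a)) - d * (p ^ a + C * √(p ^ a) - Γ.card) ≤
        ((∑ t ∈ Γ, ((g.map (evalRingHom t)).roots.toFinset.filter fun y => y ^ p ^ a = y).card : ℕ) :
          ℝ) := by

  have hKM : Function.Injective (algebraMap F[X] M) := by
    rw [IsScalarTower.algebraMap_eq F[X] K M]
    exact (algebraMap K M).injective.comp (IsFractionRing.injective F[X] K)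
  have : Module.IsTorsionFree F[X] M := by
    have := (faithfulSMul_iff_algebraMap_injective F[X] M).2 hKM
    infer_instance
  have : FiniteDimensional K M := IsSplittingField.finiteDimensional M (g.map (algebraMap F[X] K))
  have : Fintype (M ≃ₐ[K] M) := Fintype.ofFinite _
  have := rootAlgebra.finite (M := M) hg
  have : Module.Free F[X] (rootAlgebra g M) := Module.free_of_finite_type_torsion_free'
  have := rootAlgebra.isInvariant (M := M) K hg hsep
  have hprod := rootAlgebra.map_eq_prod (M := M) K hg hsep
  have : Nonempty (g.rootSet M) := by
    by_contra hne
    rw [not_nonempty_iff] at hne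
    rw [Finset.univ_eq_empty, Finset.prod_empty] at hprod
    have hd := hg.natDegree_map (algebraMap F[X] (rootAlgebra g M))
    rw [hprod, natDegree_one] at hd
    have h1 := hg.natDegree_eq_zero.1 hd.symm
    rw [h1, Polynomial.map_one] at hirr
    exact not_irreducible_one hirr
  obtain ⟨t₀, ht₀⟩ := exists_eval_ne_zero_of_natDegree_lt_card r hr0
    (Cardinal.natCast_lt_aleph0.trans_le (Cardinal.aleph0_le_mk F))
  have hE : ∀ t, r.eval t ≠ 0 → ∃ E : rootAlgebra g M →ₐ[F] PowerSeries F,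
      Function.Injective E ∧ ∀ a, E (algebraMap F[X] _ a) = expandAt t a := by
    intro t ht
    obtain ⟨E, hEi, hE⟩ := rootAlgebra.exists_ringHom_of_splits (M := M) K (expandAt t)
      (expandAt_injective t) hg (splits_map_expandAt hg (hr t ht))
    refine ⟨⟨E, fun a => ?_⟩, hEi, hE⟩
    rw [IsScalarTower.algebraMap_apply F F[X] (rootAlgebra g M)]
    exact (hE _).trans (expandAt_C t a)
  obtain ⟨E, hEi, hEX⟩ := hE t₀ ht₀
  obtain ⟨κ, c, H⟩ := weightFiltration.linearGrowth (F := F) (rootAlgebra.adjoin_range_root g M)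
    (Set.finite_range _) (Module.Free.chooseBasis F[X] (rootAlgebra g M))
  obtain ⟨C₁, q₀, hC⟩ := H.exists_card_frobenius_le Fintype.card_pos p E hEi
    (t := algebraMap F[X] _ (X - C t₀)) (by
      rw [hEX, map_sub, expandAt_X, expandAt_C, add_sub_cancel_right])
  refine ⟨C₁, q₀, Fintype.card (g.rootSet M), fun a ha hga Γ hΓ => ?_⟩
  obtain ⟨Φ, hΦi, hΦ, hΦr⟩ := rootAlgebra.exists_ringHom (M := M) K
    (mapRingHom (iterateFrobenius F p a))
    (map_injective _ (iterateFrobenius F p a).injective) hga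
  refine card_fibre_points_bounds (G := M ≃ₐ[K] M) (F := F) hprod
    (rootAlgebra.exists_smul_root) (rootAlgebra.exists_smul_root_eq K hg hirr)
    (rootAlgebra.eq_of_smul_root_eq) (σ := iterateFrobenius F p a)
    (fun x => iterateFrobenius_def _ _ _) ?_ Φ hΦ hΦr hΦi Γ
    (fun t ht => (hΓ t ht).1) (fun t ht => hr t (hΓ t ht).2) ?_ _ ?_
  · exact (bijective_iterateFrobenius F p a).2
  · intro t ht
    obtain ⟨E', -, hE'⟩ := hE t (hΓ t ht).2
    refine ⟨⟨PowerSeries.constantCoeff.comp E'.toRingHom, fun a => ?_⟩, ?_⟩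
    · simp
    · simp [hE', expandAt_X]
  · intro τ S hS
    have := hC a ha (Φ.comp (MulSemiringAction.toRingHom (M ≃ₐ[K] M) (rootAlgebra g M) τ))
      (fun m b hb => weightFiltration.map_mem κ (iterateFrobenius F p a) _ ?_ ?_ ?_ hb) S hS
    · exact_mod_cast this
    · intro x
      rw [IsScalarTower.algebraMap_apply F F[X] (rootAlgebra g M),
        IsScalarTower.algebraMap_apply F F[X] (rootAlgebra g M), RingHom.comp_apply,
        MulSemiringAction.toRingHom_apply, smul_algebraMap, hΦ]
      simp
    · rw [RingHom.comp_apply, MulSemiringAction.toRingHom_apply, smul_algebraMap, hΦ]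
      simp
    · rintro _ ⟨i, rfl⟩
      obtain ⟨j, hj⟩ := rootAlgebra.exists_smul_root (M := M) (K := K) τ i
      obtain ⟨l, hl⟩ := hΦr j
      exact ⟨l, by rw [RingHom.comp_apply, MulSemiringAction.toRingHom_apply, hj, hl]⟩

end Polynomial

namespace Polynomial

open Polynomial

variable {F : Type*} [Field F]

theorem exists_abs_card_sub_le_of_monic [IsAlgClosed F] (p : ℕ) [Fact p.Prime] [CharP F p]
    {g : F[X][X]} (hg : g.Monic)
    (hirr : Irreducible (g.map (algebraMap F[X] (FractionRing F[X]))))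
    (hsep : (g.map (algebraMap F[X] (FractionRing F[X]))).Separable) :
    ∃ C : ℝ, ∀ a, 0 < a → g.map (mapRingHom (iterateFrobenius F p a)) = g →
      |(Nat.card {x : F × F // x.1 ^ p ^ a = x.1 ∧ x.2 ^ p ^ a = x.2 ∧ g.evalEval x.1 x.2 = 0} : ℝ)
        - p ^ a| ≤ C * √(p ^ a) := by
  classical
  obtain ⟨r, hr0, hr⟩ : ∃ r : F[X], r ≠ 0 ∧
      ∀ t, r.eval t ≠ 0 → (g.map (evalRingHom t)).Separable :=
    exists_separable_map_evalRingHom hsep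
  obtain ⟨K, _, _, _, hirr, hsep⟩ : ∃ (K : Type _) (_ : Field K) (_ : Algebra F[X] K)
      (_ : IsFractionRing F[X] K), Irreducible (g.map (algebraMap F[X] K)) ∧
        (g.map (algebraMap F[X] K)).Separable :=
    ⟨FractionRing F[X], inferInstance, inferInstance, inferInstance, hirr, hsep⟩
  obtain ⟨M, _, _, _⟩ : ∃ (M : Type _) (_ : Field M) (_ : Algebra K M),
      IsSplittingField K M (g.map (algebraMap F[X] K)) :=
    ⟨SplittingField (g.map (algebraMap F[X] K)), inferInstance, inferInstance, inferInstance⟩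
  let _ : Algebra F[X] M := ((algebraMap K M).comp (algebraMap F[X] K)).toAlgebra
  let _ : Algebra F M := ((algebraMap F[X] M).comp C).toAlgebra
  have : IsScalarTower F[X] K M := IsScalarTower.of_algebraMap_eq' rfl
  have : IsScalarTower F F[X] M := IsScalarTower.of_algebraMap_eq' rfl
  obtain ⟨C₁, q₀, d, hC⟩ := exists_card_fibres_bounds (M := M) p hg hirr hsep hr0 hr
  refine ⟨C₁ + r.natDegree * g.natDegree + d * C₁ + d * r.natDegree + q₀ * (g.natDegree + 1),
    fun a ha hga => ?_⟩
  have hq : 1 < p ^ a := Nat.one_lt_pow ha.ne' (Fact.out : p.Prime).one_lt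
  have hgt : ∀ t, g.map (evalRingHom t) ≠ 0 := fun t => (hg.map _).ne_zero
  set n : F → ℕ := fun t =>
    ((g.map (evalRingHom t)).roots.toFinset.filter fun y => y ^ p ^ a = y).card with hn
  have hnle : ∀ t, n t ≤ g.natDegree := fun t =>
    (Finset.card_filter_le _ _).trans ((Multiset.toFinset_card_le _).trans
      ((card_roots' _).trans natDegree_map_le))
  set A := (X ^ p ^ a - X : F[X]).roots.toFinset with hA
  have hAq : A.card = p ^ a := card_roots_X_pow_sub_X p a ha
  rw [natCard_fibres_eq_sum hq g hgt]
  have hsum : ∑ t ∈ A, n t = ∑ t ∈ A.filter (fun t => r.eval t ≠ 0), n t +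
      ∑ t ∈ A.filter (fun t => ¬ r.eval t ≠ 0), n t := (Finset.sum_filter_add_sum_filter_not _ _ _).symm
  have hcard := Finset.card_filter_add_card_filter_not (s := A) (fun t => r.eval t ≠ 0)
  have hbad : (A.filter (fun t => ¬ r.eval t ≠ 0)).card ≤ r.natDegree := by
    refine (Finset.card_le_card (t := r.roots.toFinset) fun t ht => ?_).trans
      ((Multiset.toFinset_card_le _).trans (card_roots' _))
    simpa [hr0] using (Finset.mem_filter.1 ht).2
  have hbads : ∑ t ∈ A.filter (fun t => ¬ r.eval t ≠ 0), n t ≤ r.natDegree * g.natDegree :=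
    (Finset.sum_le_card_nsmul _ _ _ fun t _ => hnle t).trans (by
      rw [smul_eq_mul]; exact Nat.mul_le_mul_right _ hbad)
  have hall : ∑ t ∈ A, n t ≤ p ^ a * g.natDegree :=
    (Finset.sum_le_card_nsmul _ _ _ fun t _ => hnle t).trans (by
      rw [smul_eq_mul, hAq])
  have hs1 : (1 : ℝ) ≤ √((p : ℝ) ^ a) := by
    rw [Real.one_le_sqrt]
    exact_mod_cast hq.le
  set s := √((p : ℝ) ^ a) with hs
  have hd : (0 : ℝ) ≤ d := Nat.cast_nonneg _
  have hC0 : (0 : ℝ) ≤ C₁ := Nat.cast_nonneg _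
  have hr1 : (0 : ℝ) ≤ r.natDegree := Nat.cast_nonneg _
  have hg1 : (0 : ℝ) ≤ g.natDegree := Nat.cast_nonneg _
  have hq1 : (0 : ℝ) ≤ q₀ := Nat.cast_nonneg _
  have hrg := mul_nonneg hr1 hg1
  have hdr := mul_nonneg hd hr1
  have hdC := mul_nonneg hd hC0
  have hqg := mul_nonneg hq1 hg1
  change |((∑ t ∈ A, n t : ℕ) : ℝ) - _| ≤ _
  have ms : ∀ {x : ℝ}, 0 ≤ x → x ≤ x * s := fun hx => le_mul_of_one_le_right hx hs1
  rcases lt_or_ge (p ^ a) q₀ with hlt | hge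
  · have h1 : ((∑ t ∈ A, n t : ℕ) : ℝ) ≤ q₀ * g.natDegree := by
      exact_mod_cast hall.trans (Nat.mul_le_mul_right _ hlt.le)
    have h2 : ((p : ℝ) ^ a) ≤ q₀ := by exact_mod_cast hlt.le
    have h3 : (0 : ℝ) ≤ ((∑ t ∈ A, n t : ℕ) : ℝ) := Nat.cast_nonneg _
    have h4 : (0 : ℝ) ≤ (p : ℝ) ^ a := by positivity
    rw [abs_le]
    have := ms hrg
    have := ms hdr
    have := ms hdC
    have := ms hqg
    have := ms hq1
    have := ms hC0
    constructor <;> nlinarith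
  · obtain ⟨h1, h2⟩ := hC a hge hga (A.filter fun t => r.eval t ≠ 0) fun t ht => by
      obtain ⟨ht1, ht2⟩ := Finset.mem_filter.1 ht
      refine ⟨?_, ht2⟩
      rw [hA, Multiset.mem_toFinset, mem_roots (FiniteField.X_pow_card_sub_X_ne_zero F hq)] at ht1
      simpa [sub_eq_zero] using ht1
    change ((∑ t ∈ A.filter (fun t => r.eval t ≠ 0), n t : ℕ) : ℝ) ≤ _ at h1
    change _ ≤ ((∑ t ∈ A.filter (fun t => r.eval t ≠ 0), n t : ℕ) : ℝ) at h2
    have h3 : ((∑ t ∈ A, n t : ℕ) : ℝ) ≤ ((∑ t ∈ A.filter (fun t => r.eval t ≠ 0), n t : ℕ) : ℝ) +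
        r.natDegree * g.natDegree := by
      rw [hsum]; exact_mod_cast Nat.add_le_add_left hbads _
    have h4 : ((∑ t ∈ A.filter (fun t => r.eval t ≠ 0), n t : ℕ) : ℝ) ≤
        ((∑ t ∈ A, n t : ℕ) : ℝ) := by
      rw [hsum]; exact_mod_cast Nat.le_add_right _ _
    have h5 : (p : ℝ) ^ a ≤ (A.filter fun t => r.eval t ≠ 0).card + r.natDegree := by
      rw [hAq] at hcard
      exact_mod_cast hcard.symm.le.trans (Nat.add_le_add_left hbad _)
    have h6 : (d : ℝ) * (p ^ a + C₁ * s - (A.filter fun t => r.eval t ≠ 0).card) ≤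
        d * (C₁ * s + r.natDegree) := mul_le_mul_of_nonneg_left (by linarith) hd
    rw [abs_le]
    have := ms hrg
    have := ms hdr
    have := ms hdC
    have := ms hqg
    have := ms hq1
    have := ms hC0
    constructor <;> nlinarith

end Polynomial

namespace Polynomial

open Polynomial

section

variable {K : Type*} [Field K]

theorem integralNormalization_comp {f : K[X]} (hn : 1 ≤ f.natDegree) :
    f.integralNormalization.comp (C f.leadingCoeff * X) =
      C (f.leadingCoeff ^ (f.natDegree - 1)) * f := by
  have := integralNormalization_eval₂_leadingCoeff_mul hn (C : K →+* K[X]) X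
  rwa [eval₂_C_X, ← C_pow] at this

theorem irreducible_integralNormalization {f : K[X]} (hf : Irreducible f) (hn : 1 ≤ f.natDegree) :
    Irreducible f.integralNormalization := by
  have hlc : f.leadingCoeff ≠ 0 := leadingCoeff_ne_zero.2 hf.ne_zero
  let _ := invertibleOfNonzero hlc
  rw [← MulEquiv.irreducible_iff (algEquivCMulXAddC f.leadingCoeff 0)]
  have h := integralNormalization_comp hn
  have h2 : algEquivCMulXAddC f.leadingCoeff 0 f.integralNormalization =
      f.integralNormalization.comp (C f.leadingCoeff * X) := by
    rw [algEquivCMulXAddC_apply, C_0, add_zero, aeval_def, comp]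
    rfl
  rw [h2, h, irreducible_isUnit_mul (isUnit_C.2 (pow_ne_zero _ hlc).isUnit)]
  exact hf

theorem derivative_integralNormalization_ne_zero {f : K[X]} (hf : derivative f ≠ 0) :
    derivative f.integralNormalization ≠ 0 := by
  have hn : 1 ≤ f.natDegree := by
    by_contra! h
    exact hf (derivative_of_natDegree_zero (by omega))
  intro h
  have := congrArg derivative (integralNormalization_comp hn)
  rw [derivative_comp, h, zero_comp, mul_zero, derivative_C_mul, eq_comm, mul_eq_zero, C_eq_zero]
    at this
  refine this.elim (pow_ne_zero _ (leadingCoeff_ne_zero.2 ?_)) hf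
  rintro rfl
  simp at hf

end

variable {F : Type*} [Field F]

theorem map_evalRingHom_ne_zero {f : F[X][X]} (hf : Irreducible f) (hn : f.natDegree ≠ 0) (t : F) :
    f.map (evalRingHom t) ≠ 0 := by
  intro h
  have hp := hf.isPrimitive hn
  have h1 : C (X - C t) ∣ f := by
    rw [C_dvd_iff_dvd_coeff]
    intro i
    rw [dvd_iff_isRoot, IsRoot, ← coe_evalRingHom, ← coeff_map, h, coeff_zero]
  exact not_isUnit_X_sub_C t (hp _ h1)

/-- An absolutely irreducible affine plane curve `f(t, z) = 0` which is separable over the `t`-line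
has approximately `q` points over a field with `q` elements. -/
theorem exists_abs_card_sub_le [IsAlgClosed F] (p : ℕ) [Fact p.Prime] [CharP F p]
    {f : F[X][X]} (hirr : Irreducible f) (hder : derivative f ≠ 0) :
    ∃ C : ℝ, ∀ a, 0 < a → f.map (mapRingHom (iterateFrobenius F p a)) = f →
      |(Nat.card {x : F × F // x.1 ^ p ^ a = x.1 ∧ x.2 ^ p ^ a = x.2 ∧ f.evalEval x.1 x.2 = 0} : ℝ)
        - p ^ a| ≤ C * √(p ^ a) := by
  classical
  have hn : 1 ≤ f.natDegree := by
    by_contra! h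
    exact hder (derivative_of_natDegree_zero (by omega))
  have hf0 := hirr.ne_zero
  have hK : Function.Injective (algebraMap F[X] (FractionRing F[X])) :=
    IsFractionRing.injective _ _
  have hprim := hirr.isPrimitive (by omega)
  have hirrK := (hprim.irreducible_iff_irreducible_map_fraction_map
    (K := FractionRing F[X])).1 hirr
  have hlcK : algebraMap F[X] (FractionRing F[X]) f.leadingCoeff ≠ 0 := by
    rw [map_ne_zero_iff _ hK]; exact leadingCoeff_ne_zero.2 hf0
  set g := f.integralNormalization with hg
  have hgm : g.Monic := monic_integralNormalization hf0
  have hgK : g.map (algebraMap F[X] (FractionRing F[X])) =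
    (f.map (algebraMap F[X] (FractionRing F[X]))).integralNormalization :=
      (integralNormalization_map _ _ hlcK).symm
  have hgirr : Irreducible (g.map (algebraMap F[X] (FractionRing F[X]))) := by
    rw [hgK]
    exact irreducible_integralNormalization hirrK (by rwa [natDegree_map_eq_of_injective hK])
  have hgsep : (g.map (algebraMap F[X] (FractionRing F[X]))).Separable := by
    rw [separable_iff_derivative_ne_zero hgirr, hgK]
    refine derivative_integralNormalization_ne_zero ?_
    rw [derivative_map]
    exact (Polynomial.map_ne_zero_iff hK).2 hder
  obtain ⟨C₁, hC⟩ := exists_abs_card_sub_le_of_monic p hgm hgirr hgsep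
  set l := f.leadingCoeff with hl
  have hl0 : l ≠ 0 := leadingCoeff_ne_zero.2 hf0
  refine ⟨C₁ + l.natDegree * f.natDegree, fun a ha hfa => ?_⟩
  have hq : 1 < p ^ a := Nat.one_lt_pow ha.ne' (Fact.out : p.Prime).one_lt
  have hσ : Function.Injective (mapRingHom (iterateFrobenius F p a)) :=
    map_injective _ (iterateFrobenius F p a).injective
  have hga : g.map (mapRingHom (iterateFrobenius F p a)) = g := by
    rw [hg, ← integralNormalization_map _ _ ((map_ne_zero_iff _ hσ).2 hl0), hfa]
  have hla : mapRingHom (iterateFrobenius F p a) l = l := by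
    conv_rhs => rw [hl, ← hfa]
    rw [leadingCoeff_map_of_injective hσ]
  replace hC := hC a ha hga
  have hft := map_evalRingHom_ne_zero hirr (by omega)
  have hgt : ∀ t, g.map (evalRingHom t) ≠ 0 := fun t => (hgm.map _).ne_zero
  rw [natCard_fibres_eq_sum hq f hft]
  rw [natCard_fibres_eq_sum hq g hgt] at hC
  set n : F[X][X] → F → ℕ := fun f t =>
    ((f.map (evalRingHom t)).roots.toFinset.filter fun y => y ^ p ^ a = y).card with hn
  have hnle : ∀ f t, n f t ≤ f.natDegree := fun f t =>
    (Finset.card_filter_le _ _).trans ((Multiset.toFinset_card_le _).trans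
      ((card_roots' _).trans natDegree_map_le))
  have hgn : g.natDegree = f.natDegree := natDegree_integralNormalization
  set A := (X ^ p ^ a - X : F[X]).roots.toFinset with hA
  have hAt : ∀ t ∈ A, t ^ p ^ a = t := fun t ht => by
    rw [hA, Multiset.mem_toFinset, mem_roots (FiniteField.X_pow_card_sub_X_ne_zero F hq)] at ht
    simpa [sub_eq_zero] using ht
  have heq : ∀ t ∈ A, l.eval t ≠ 0 → n f t = n g t := by
    intro t ht hlt
    have hltq : (l.eval t) ^ p ^ a = l.eval t := by
      have h1 : iterateFrobenius F p a (l.eval t) =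
          (l.map (iterateFrobenius F p a)).eval (iterateFrobenius F p a t) := by
        rw [eval_map, eval, hom_eval₂, RingHom.comp_id]
      rwa [iterateFrobenius_def, iterateFrobenius_def, hAt t ht, ← coe_mapRingHom, hla] at h1
    have hev : ∀ z, (g.map (evalRingHom t)).eval (l.eval t * z) =
        l.eval t ^ (f.natDegree - 1) * (f.map (evalRingHom t)).eval z := fun z => by
      rw [eval_map, eval_map]
      exact integralNormalization_eval₂_leadingCoeff_mul ‹_› (evalRingHom t) z
    refine Finset.card_bij (fun z _ => l.eval t * z) ?_ ?_ ?_
    · intro z hz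
      simp only [Finset.mem_filter, Multiset.mem_toFinset, mem_roots (hft t), mem_roots (hgt t),
        IsRoot] at hz ⊢
      rw [hev, hz.1, mul_zero, mul_pow, hltq, hz.2]
      exact ⟨rfl, rfl⟩
    · intro z _ z' _ h
      exact mul_left_cancel₀ hlt h
    · intro w hw
      have hw' : l.eval t * ((l.eval t)⁻¹ * w) = w := mul_inv_cancel_left₀ hlt w
      refine ⟨(l.eval t)⁻¹ * w, ?_, hw'⟩
      simp only [Finset.mem_filter, Multiset.mem_toFinset, mem_roots (hft t), mem_roots (hgt t),
        IsRoot] at hw ⊢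
      refine ⟨?_, by rw [mul_pow, inv_pow, hltq, hw.2]⟩
      have h1 := hev ((l.eval t)⁻¹ * w)
      rw [hw', hw.1, eq_comm, mul_eq_zero] at h1
      exact h1.resolve_left (pow_ne_zero _ hlt)
  have hdiff : |((∑ t ∈ A, n f t : ℕ) : ℝ) - ((∑ t ∈ A, n g t : ℕ) : ℝ)| ≤
      l.natDegree * f.natDegree := by
    rw [Nat.cast_sum, Nat.cast_sum, ← Finset.sum_sub_distrib,
      ← Finset.sum_filter_of_ne (p := fun t => l.eval t = 0)]
    · refine (Finset.abs_sum_le_sum_abs _ _).trans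
        ((Finset.sum_le_card_nsmul _ _ (f.natDegree : ℝ) fun t _ => ?_).trans ?_)
      · refine abs_sub_le_of_nonneg_of_le (Nat.cast_nonneg _) ?_ (Nat.cast_nonneg _) ?_
        · exact_mod_cast hnle f t
        · exact_mod_cast hgn ▸ hnle g t
      · rw [nsmul_eq_mul]
        refine mul_le_mul_of_nonneg_right ?_ (Nat.cast_nonneg _)
        refine Nat.cast_le.2 ((Finset.card_le_card (t := l.roots.toFinset) fun t ht => ?_).trans
          ((Multiset.toFinset_card_le _).trans (card_roots' _)))
        simpa [hl0] using (Finset.mem_filter.1 ht).2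
    · intro t ht hne
      by_contra hlt
      exact hne (by rw [heq t ht hlt, sub_self])
  have hs1 : (1 : ℝ) ≤ √((p : ℝ) ^ a) := by
    rw [Real.one_le_sqrt]
    exact_mod_cast hq.le
  have h2 : (0 : ℝ) ≤ l.natDegree * f.natDegree := by positivity
  calc _ ≤ |((∑ t ∈ A, n f t : ℕ) : ℝ) - ((∑ t ∈ A, n g t : ℕ) : ℝ)| +
        |((∑ t ∈ A, n g t : ℕ) : ℝ) - p ^ a| := abs_sub_le _ _ _
    _ ≤ _ := by
      rw [add_mul, add_comm]
      exact add_le_add hC (hdiff.trans (le_mul_of_one_le_right h2 hs1))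

end Polynomial

namespace MvPolynomial

theorem IsHomogeneous.eval₂_mul {R S σ : Type*} [CommSemiring R] [CommSemiring S]
    {P : MvPolynomial σ R} {e : ℕ} (hP : P.IsHomogeneous e) (f : R →+* S) (c : S) (v : σ → S) :
    MvPolynomial.eval₂ f (fun i => c * v i) P = c ^ e * MvPolynomial.eval₂ f v P := by
  rw [eval₂_eq, eval₂_eq, Finset.mul_sum]
  refine Finset.sum_congr rfl fun d hd => ?_
  simp_rw [mul_pow]
  rw [Finset.prod_mul_distrib, Finset.prod_pow_eq_pow_sum, ← hP.degree_eq_sum_deg_support hd]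
  ring

/-- If all partial derivatives vanish over a perfect field, the polynomial is a `p`-th power. -/
theorem exists_pderiv_ne_zero_of_irreducible {F σ : Type*} [Field F] (p : ℕ) [Fact p.Prime]
    [CharP F p] [PerfectRing F p] {P : MvPolynomial σ F} (hP : Irreducible P) :
    ∃ i, pderiv i P ≠ 0 := by
  classical
  by_contra! h
  have hp : p ≠ 0 := (Fact.out : p.Prime).ne_zero
  have hdvd : ∀ d ∈ P.support, ∀ i, p ∣ d i := by
    intro d hd i
    by_contra hi
    have h1 := coeff_pderiv (i := i) P (d - Finsupp.single i 1)
    have hdi : d i ≠ 0 := by rintro h0; rw [h0] at hi; exact hi (dvd_zero _)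
    have h2 : d - Finsupp.single i 1 + Finsupp.single i 1 = d :=
      tsub_add_cancel_of_le (Finsupp.single_le_iff.2 (Nat.one_le_iff_ne_zero.2 hdi))
    rw [h i, coeff_zero, h2] at h1
    have h3 : ((d i : ℕ) : F) ≠ 0 := by rwa [Ne, CharP.cast_eq_zero_iff F p]
    have h4 : (((d - Finsupp.single i 1 : σ →₀ ℕ) i : ℕ) : F) + 1 = (d i : F) := by
      have : (d - Finsupp.single i 1 : σ →₀ ℕ) i + 1 = d i := by
        rw [Finsupp.tsub_apply, Finsupp.single_eq_same]; omega
      exact_mod_cast congrArg (Nat.cast (R := F)) this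
    rw [h4, eq_comm, mul_eq_zero] at h1
    exact (mem_support_iff.1 hd) (h1.resolve_right h3)
  obtain ⟨Q, hQ⟩ : ∃ Q : MvPolynomial σ F, Q ^ p = P := by
    have : P ∈ (RingHom.range (frobenius (MvPolynomial σ F) p)) := by
      rw [P.as_sum]
      refine Subring.sum_mem _ fun d hd => ?_
      obtain ⟨c, hc⟩ := (bijective_frobenius F p).2 (coeff d P)
      refine ⟨monomial (d.mapRange (fun n => n / p) (Nat.zero_div p)) c, ?_⟩
      rw [frobenius_def, monomial_pow, ← frobenius_def, hc]
      refine congrArg (fun d => monomial d (coeff _ P)) (Finsupp.ext fun i => ?_)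
      rw [Finsupp.smul_apply, Finsupp.mapRange_apply, smul_eq_mul]
      exact Nat.mul_div_cancel' (hdvd d hd i)
    exact this
  rw [← hQ] at hP
  exact not_irreducible_pow (Fact.out : p.Prime).ne_one hP

section Dehomogenize

variable {F : Type*} [Field F]

/-- Dehomogenization of a ternary form with respect to the first variable. -/
noncomputable def dehomogenize (F : Type*) [Field F] :
    MvPolynomial (Fin 3) F →+* Polynomial (Polynomial F) :=
  eval₂Hom (Polynomial.C.comp Polynomial.C) ![1, Polynomial.C Polynomial.X, Polynomial.X]

theorem dehomogenize_surjective : Function.Surjective (dehomogenize F) := by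
  intro f
  induction f using Polynomial.induction_on' with
  | add f g hf hg =>
    obtain ⟨a, ha⟩ := hf
    obtain ⟨b, hb⟩ := hg
    exact ⟨a + b, by rw [map_add, ha, hb]⟩
  | monomial n c =>
    have : ∃ Q, dehomogenize F Q = Polynomial.C c := by
      induction c using Polynomial.induction_on' with
      | add f g hf hg =>
        obtain ⟨a, ha⟩ := hf
        obtain ⟨b, hb⟩ := hg
        exact ⟨a + b, by rw [map_add, ha, hb, map_add]⟩
      | monomial n c =>
        refine ⟨C c * X 1 ^ n, ?_⟩
        simp [dehomogenize, ← Polynomial.C_mul_X_pow_eq_monomial]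
    obtain ⟨Q, hQ⟩ := this
    refine ⟨Q * X 2 ^ n, ?_⟩
    rw [map_mul, hQ, ← Polynomial.C_mul_X_pow_eq_monomial]
    simp [dehomogenize]

theorem evalEval_dehomogenize (t z : F) (P : MvPolynomial (Fin 3) F) :
    (dehomogenize F P).evalEval t z = eval ![1, t, z] P := by
  have : (Polynomial.evalEvalRingHom t z).comp (dehomogenize F) = eval ![1, t, z] := by
    refine ringHom_ext (fun r => by simp [dehomogenize]) fun i => ?_
    fin_cases i <;> simp [dehomogenize]
  exact RingHom.congr_fun this P

theorem map_dehomogenize (σ : F →+* F) (P : MvPolynomial (Fin 3) F) :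
    (dehomogenize F P).map (Polynomial.mapRingHom σ) = dehomogenize F (P.map σ) := by
  have : (Polynomial.mapRingHom (Polynomial.mapRingHom σ)).comp (dehomogenize F) =
      (dehomogenize F).comp (map σ) := by
    refine ringHom_ext (fun r => by simp [dehomogenize]) fun i => ?_
    fin_cases i <;> simp [dehomogenize]
  exact RingHom.congr_fun this P

theorem derivative_dehomogenize (P : MvPolynomial (Fin 3) F) :
    Polynomial.derivative (dehomogenize F P) = dehomogenize F (pderiv 2 P) := by
  induction P using MvPolynomial.induction_on with
  | C a => simp [dehomogenize]
  | add f g hf hg => rw [map_add, map_add, map_add, map_add, hf, hg]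
  | mul_X f i hf =>
    have h : Polynomial.derivative (dehomogenize F (X i)) = dehomogenize F (pderiv 2 (X i)) := by
      rw [pderiv_X]
      fin_cases i <;> simp [dehomogenize]
    rw [map_mul, Polynomial.derivative_mul, hf, pderiv_mul, map_add, map_mul, map_mul, h]

variable (L : Type*) [Field L] [Algebra (MvPolynomial (Fin 3) F) L]

/-- Rehomogenization, with values in the field of rational functions. -/
noncomputable def rehomogenize : Polynomial (Polynomial F) →+* L :=
  Polynomial.eval₂RingHom
    (Polynomial.eval₂RingHom ((algebraMap (MvPolynomial (Fin 3) F) L).comp C)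
      (algebraMap (MvPolynomial (Fin 3) F) L (X 1) / algebraMap (MvPolynomial (Fin 3) F) L (X 0)))
    (algebraMap (MvPolynomial (Fin 3) F) L (X 2) / algebraMap (MvPolynomial (Fin 3) F) L (X 0))

variable [IsFractionRing (MvPolynomial (Fin 3) F) L]

theorem algebraMap_X_zero_ne_zero : algebraMap (MvPolynomial (Fin 3) F) L (X 0) ≠ 0 := by
  rw [map_ne_zero_iff _ (IsFractionRing.injective (MvPolynomial (Fin 3) F) L)]
  exact X_ne_zero 0

theorem rehomogenize_dehomogenize_X (i : Fin 3) :
    algebraMap (MvPolynomial (Fin 3) F) L (X 0) * rehomogenize L (dehomogenize F (X i)) =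
      algebraMap (MvPolynomial (Fin 3) F) L (X i) := by
  have := algebraMap_X_zero_ne_zero (F := F) L
  fin_cases i
  · simp [dehomogenize]
  · simp [dehomogenize, rehomogenize, mul_div_cancel₀ _ this]
  · simp [dehomogenize, rehomogenize, mul_div_cancel₀ _ this]

theorem IsHomogeneous.rehomogenize_dehomogenize {P : MvPolynomial (Fin 3) F} {e : ℕ}
    (hP : P.IsHomogeneous e) : algebraMap (MvPolynomial (Fin 3) F) L (X 0) ^ e *
      rehomogenize L (dehomogenize F P) = algebraMap (MvPolynomial (Fin 3) F) L P := by
  set f : F →+* L := (algebraMap (MvPolynomial (Fin 3) F) L).comp C with hf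
  have h1 : (rehomogenize L).comp (dehomogenize F) =
      eval₂Hom f (fun i => rehomogenize L (dehomogenize F (X i))) := by
    refine ringHom_ext (fun r => ?_) fun i => by simp
    simp [dehomogenize, rehomogenize, hf]
  have h2 : algebraMap (MvPolynomial (Fin 3) F) L =
      eval₂Hom f (fun i => algebraMap (MvPolynomial (Fin 3) F) L (X i)) :=
    ringHom_ext (fun r => by simp [hf]) fun i => by simp
  have h3 := hP.eval₂_mul f (algebraMap (MvPolynomial (Fin 3) F) L (X 0))
    (fun i => rehomogenize L (dehomogenize F (X i)))
  simp_rw [rehomogenize_dehomogenize_X] at h3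
  rw [← RingHom.comp_apply, h1, coe_eval₂Hom, ← h3]
  conv_rhs => rw [h2]
  rfl

theorem exists_rehomogenize_eq (f : Polynomial (Polynomial F)) :
    ∃ (N : ℕ) (Q : MvPolynomial (Fin 3) F), dehomogenize F Q = f ∧
      algebraMap (MvPolynomial (Fin 3) F) L (X 0) ^ N * rehomogenize L f =
        algebraMap (MvPolynomial (Fin 3) F) L Q := by
  obtain ⟨P, rfl⟩ := dehomogenize_surjective f
  induction P using MvPolynomial.induction_on with
  | C a =>
    refine ⟨0, C a, rfl, ?_⟩
    simpa using (isHomogeneous_C (Fin 3) a).rehomogenize_dehomogenize L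
  | add f g hf hg =>
    obtain ⟨N, Q, h1, h2⟩ := hf
    obtain ⟨N', Q', h1', h2'⟩ := hg
    refine ⟨N + N', X 0 ^ N' * Q + X 0 ^ N * Q', ?_, ?_⟩
    · have : dehomogenize F (X 0) = 1 := by simp [dehomogenize]
      simp only [map_add, map_mul, map_pow, this, h1, h1', one_pow, one_mul]
    · simp only [map_add, map_mul, map_pow, ← h2, ← h2']
      ring
  | mul_X f i hf =>
    obtain ⟨N, Q, h1, h2⟩ := hf
    refine ⟨N + 1, Q * X i, by rw [map_mul, map_mul, h1], ?_⟩
    rw [map_mul, map_mul, map_mul, ← h2, ← rehomogenize_dehomogenize_X L i]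
    ring

theorem IsHomogeneous.dehomogenize_eq_zero_iff {P : MvPolynomial (Fin 3) F} {e : ℕ}
    (hP : P.IsHomogeneous e) : dehomogenize F P = 0 ↔ P = 0 := by
  refine ⟨fun h => ?_, fun h => by rw [h, map_zero]⟩
  have := hP.rehomogenize_dehomogenize (FractionRing (MvPolynomial (Fin 3) F))
  rw [h, map_zero, mul_zero, eq_comm, map_eq_zero_iff _ (IsFractionRing.injective _ _)] at this
  exact this

theorem IsHomogeneous.irreducible_dehomogenize {P : MvPolynomial (Fin 3) F} {e : ℕ}
    (hP : P.IsHomogeneous e) (hirr : Irreducible P) (hd : ¬ IsUnit (dehomogenize F P)) :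
    Irreducible (dehomogenize F P) := by
  have hprime : Prime P := hirr.prime
  have h0 : dehomogenize F P ≠ 0 := (hP.dehomogenize_eq_zero_iff).not.2 hirr.ne_zero
  refine ⟨hd, fun f g hfg => ?_⟩
  obtain ⟨N, Q, hQ, hQ'⟩ := exists_rehomogenize_eq (FractionRing (MvPolynomial (Fin 3) F)) f
  obtain ⟨N', Q', hR, hR'⟩ := exists_rehomogenize_eq (FractionRing (MvPolynomial (Fin 3) F)) g
  have hmul : X 0 ^ (N + N') * P = X 0 ^ e * (Q * Q') := by
    apply IsFractionRing.injective (MvPolynomial (Fin 3) F) (FractionRing (MvPolynomial (Fin 3) F))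
    simp only [map_mul, map_pow]
    rw [← hP.rehomogenize_dehomogenize (FractionRing (MvPolynomial (Fin 3) F)), hfg, map_mul, ← hQ', ← hR']
    ring
  have hX : dehomogenize F (X 0) = 1 := by simp [dehomogenize]
  have key : ∀ (f g : Polynomial (Polynomial F)) (Q : MvPolynomial (Fin 3) F), dehomogenize F P = f * g → dehomogenize F Q = f → P ∣ Q → IsUnit g := by
    rintro f g Q hfg hQ ⟨H, rfl⟩
    rw [map_mul, hfg] at hQ
    have hf0 : f ≠ 0 := by rintro rfl; rw [zero_mul] at hfg; exact h0 hfg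
    refine .of_mul_eq_one (dehomogenize F H) (mul_left_cancel₀ hf0 ?_)
    rw [← mul_assoc, hQ, mul_one]
  rcases hprime.dvd_or_dvd (hmul ▸ Dvd.intro_left _ rfl : P ∣ X 0 ^ e * (Q * Q')) with h | h
  · obtain ⟨H, hH⟩ := hprime.dvd_of_dvd_pow h
    have := congrArg (dehomogenize F) hH
    rw [hX, map_mul] at this
    exact absurd (.of_mul_eq_one _ this.symm) hd
  · rcases hprime.dvd_or_dvd h with h | h
    · exact Or.inr (key f g Q hfg hQ h)
    · exact Or.inl (key g f Q' (hfg.trans (mul_comm f g)) hR h)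

end Dehomogenize

end MvPolynomial

namespace MvPolynomial

variable {F : Type*} [Field F]

open scoped Classical in
/-- The elements of a field fixed by `x ↦ x ^ q`. -/
noncomputable def fixedFinset (F : Type*) [Field F] (q : ℕ) : Finset F :=
  (Polynomial.X ^ q - Polynomial.X : Polynomial F).roots.toFinset

theorem mem_fixedFinset {q : ℕ} (hq : 1 < q) {x : F} : x ∈ fixedFinset F q ↔ x ^ q = x := by
  classical
  rw [fixedFinset, Multiset.mem_toFinset,
    Polynomial.mem_roots (FiniteField.X_pow_card_sub_X_ne_zero F hq)]
  simp [sub_eq_zero]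

theorem card_fixedFinset [IsAlgClosed F] (p a : ℕ) [Fact p.Prime] [CharP F p] (ha : 0 < a) :
    (fixedFinset F (p ^ a)).card = p ^ a := by
  classical
  rw [fixedFinset, Polynomial.card_roots_X_pow_sub_X p a ha]

open scoped Classical in
theorem card_filter_eval_eq_zero_le {n : ℕ} {P : MvPolynomial (Fin (n + 1)) F} (hP : P ≠ 0)
    (A : Finset F) : ((Fintype.piFinset fun _ : Fin (n + 1) => A).filter fun v => eval v P = 0).card ≤
      P.totalDegree * A.card ^ n := by
  rcases A.eq_empty_or_nonempty with rfl | hA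
  · simp
  have h := schwartz_zippel_totalDegree hP A
  have hA' : (0 : ℚ≥0) < A.card := by exact_mod_cast hA.card_pos
  rw [div_le_div_iff₀ (by positivity) hA', pow_succ, ← mul_assoc] at h
  exact_mod_cast le_of_mul_le_mul_right h hA'

theorem eval_dehomogenize_smul {P : MvPolynomial (Fin 3) F} {e : ℕ} (hP : P.IsHomogeneous e)
    (s t z : F) : eval ![s, s * t, s * z] P = s ^ e * (dehomogenize F P).evalEval t z := by
  have h := hP.eval₂_mul (RingHom.id F) s ![1, t, z]
  have h1 : (fun i => s * (![1, t, z] : Fin 3 → F) i) = ![s, s * t, s * z] := by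
    ext i; fin_cases i <;> simp
  rw [h1] at h
  rw [evalEval_dehomogenize]
  exact h

open scoped Classical in
theorem card_filter_eval_eq_zero_ne_zero {P : MvPolynomial (Fin 3) F} {e : ℕ}
    (hP : P.IsHomogeneous e) {q : ℕ} (hq : 1 < q) :
    ((Fintype.piFinset fun _ : Fin 3 => fixedFinset F q).filter
      fun v => eval v P = 0 ∧ v 0 ≠ 0).card =
    ((fixedFinset F q).erase 0).card * ((fixedFinset F q ×ˢ fixedFinset F q).filter
      fun x => (dehomogenize F P).evalEval x.1 x.2 = 0).card := by
  rw [← Finset.card_product]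
  refine (Finset.card_bij (fun x _ => ![x.1, x.1 * x.2.1, x.1 * x.2.2]) ?_ ?_ ?_).symm
  · rintro ⟨s, t, z⟩ h
    simp only [Finset.mem_product, Finset.mem_erase, Finset.mem_filter, mem_fixedFinset hq,
      Fintype.mem_piFinset] at h ⊢
    obtain ⟨⟨hs, hs'⟩, ⟨ht, hz⟩, h⟩ := h
    refine ⟨fun i => ?_, ?_, hs⟩
    · fin_cases i <;> simp [hs', ht, hz, mul_pow]
    · rw [eval_dehomogenize_smul hP, h, mul_zero]
  · rintro ⟨s, t, z⟩ h ⟨s', t', z'⟩ h' heq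
    have hs : s ≠ 0 := (Finset.mem_erase.1 (Finset.mem_product.1 h).1).1
    have h0 := congrFun heq 0
    have h1 := congrFun heq 1
    have h2 := congrFun heq 2
    simp only [Matrix.cons_val] at h0 h1 h2
    subst h0
    simp [mul_left_cancel₀ hs h1, mul_left_cancel₀ hs h2]
  · intro v hv
    simp only [Finset.mem_filter, mem_fixedFinset hq, Fintype.mem_piFinset] at hv
    obtain ⟨hv, hv0, h0⟩ := hv
    have hv' : ![v 0, v 0 * (v 1 / v 0), v 0 * (v 2 / v 0)] = v := by
      ext i
      fin_cases i <;> simp [mul_div_cancel₀ _ h0]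
    refine ⟨(v 0, v 1 / v 0, v 2 / v 0), ?_, hv'⟩
    simp only [Finset.mem_product, Finset.mem_erase, Finset.mem_filter, mem_fixedFinset hq, div_pow,
      hv]
    refine ⟨⟨h0, trivial⟩, ⟨trivial, trivial⟩, ?_⟩
    have := eval_dehomogenize_smul hP (v 0) (v 1 / v 0) (v 2 / v 0)
    rw [hv', hv0, eq_comm, mul_eq_zero] at this
    exact this.resolve_left (pow_ne_zero _ h0)

theorem coeff_zero_finSuccEquiv_ne_zero {n : ℕ} {P : MvPolynomial (Fin (n + 1)) F}
    (hirr : Irreducible P) {i : Fin (n + 1)} (hi : i ≠ 0) (hd : pderiv i P ≠ 0) :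
    (finSuccEquiv F n P).coeff 0 ≠ 0 := by
  intro h
  rw [← Polynomial.X_dvd_iff, ← finSuccEquiv_X_zero] at h
  obtain ⟨H, rfl⟩ := (map_dvd_iff (finSuccEquiv F n)).1 h
  rcases hirr.isUnit_or_isUnit rfl with hu | hu
  · have := hu.map (eval (0 : Fin (n + 1) → F))
    simp at this
  · obtain ⟨c, -, rfl⟩ := isUnit_iff_eq_C_of_isReduced.1 hu
    refine hd ?_
    rw [pderiv_mul, pderiv_X_of_ne hi.symm, pderiv_C, zero_mul, mul_zero, add_zero]

open scoped Classical in
theorem card_filter_eval_eq_zero_eq_zero_le {P : MvPolynomial (Fin 3) F}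
    (h : (finSuccEquiv F 2 P).coeff 0 ≠ 0) (A : Finset F) :
    ((Fintype.piFinset fun _ : Fin 3 => A).filter fun v => eval v P = 0 ∧ v 0 = 0).card ≤
      ((finSuccEquiv F 2 P).coeff 0).totalDegree * A.card := by
  rw [← pow_one A.card]
  refine le_trans ?_ (card_filter_eval_eq_zero_le h A)
  refine Finset.card_le_card_of_injOn Fin.tail ?_ ?_
  · intro v hv
    simp only [Finset.coe_filter, Fintype.mem_piFinset, Set.mem_ofPred_eq] at hv ⊢
    refine ⟨fun i => hv.1 i.succ, ?_⟩
    have := hv.2.1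
    rw [← Fin.cons_self_tail v, hv.2.2, eval_eq_eval_mv_eval'] at this
    rwa [← Polynomial.coeff_zero_eq_eval_zero, Polynomial.coeff_map] at this
  · intro v hv w hw hvw
    simp only [Finset.coe_filter, Set.mem_ofPred_eq] at hv hw
    rw [← Fin.cons_self_tail v, ← Fin.cons_self_tail w, hvw, hv.2.2, hw.2.2]

theorem natCard_zeros_eq {σ : Type*} [Fintype σ] [DecidableEq σ] {q : ℕ} (hq : 1 < q)
    (P : (σ → F) → Prop) [DecidablePred P] :
    Nat.card {v : σ → F // (∀ i, v i ^ q = v i) ∧ P v} =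
      ((Fintype.piFinset fun _ : σ => fixedFinset F q).filter P).card := by
  refine Nat.subtype_card _ fun v => ?_
  simp [mem_fixedFinset hq]

theorem exists_abs_card_zeros_sub_le_of_pderiv [IsAlgClosed F] (p : ℕ) [Fact p.Prime] [CharP F p]
    {P : MvPolynomial (Fin 3) F} {e : ℕ} (hP : P.IsHomogeneous e) (hirr : Irreducible P)
    (hd : pderiv 2 P ≠ 0) :
    ∃ C : ℝ, ∀ a, 0 < a → map (iterateFrobenius F p a) P = P →
      |(Nat.card {v : Fin 3 → F // (∀ i, v i ^ p ^ a = v i) ∧ eval v P = 0} : ℝ) - (p ^ a) ^ 2| ≤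
        C * (p ^ a * √(p ^ a)) := by
  classical
  have hder : Polynomial.derivative (dehomogenize F P) ≠ 0 := by
    rw [derivative_dehomogenize]
    exact (IsHomogeneous.dehomogenize_eq_zero_iff (hP.pderiv (i := 2))).not.2 hd
  have hnu : ¬ IsUnit (dehomogenize F P) := by
    intro hu
    refine hder (Polynomial.derivative_of_natDegree_zero ?_)
    exact Polynomial.natDegree_eq_zero_of_isUnit hu
  obtain ⟨C₁, hC⟩ := Polynomial.exists_abs_card_sub_le p (hP.irreducible_dehomogenize hirr hnu) hder
  have hcoeff := coeff_zero_finSuccEquiv_ne_zero hirr (by decide : (2 : Fin 3) ≠ 0) hd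
  set d := ((finSuccEquiv F 2 P).coeff 0).totalDegree with hdd
  refine ⟨|C₁| + 1 + d, fun a ha hPa => ?_⟩
  have hq : 1 < p ^ a := Nat.one_lt_pow ha.ne' (Fact.out : p.Prime).one_lt
  have hA := card_fixedFinset (F := F) p a ha
  replace hC := hC a ha (by rw [map_dehomogenize, hPa])
  have hn : Nat.card {x : F × F // x.1 ^ p ^ a = x.1 ∧ x.2 ^ p ^ a = x.2 ∧
      (dehomogenize F P).evalEval x.1 x.2 = 0} =
        ((fixedFinset F (p ^ a) ×ˢ fixedFinset F (p ^ a)).filter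
          fun x => (dehomogenize F P).evalEval x.1 x.2 = 0).card := by
    refine Nat.subtype_card _ fun x => ?_
    simp [mem_fixedFinset hq, and_assoc]
  rw [hn] at hC
  have h1 := card_filter_eval_eq_zero_ne_zero hP hq
  have h2 := card_filter_eval_eq_zero_eq_zero_le hcoeff (fixedFinset F (p ^ a))
  have h0 : (0 : F) ∈ fixedFinset F (p ^ a) := by
    rw [mem_fixedFinset hq, zero_pow (by omega)]
  rw [Finset.card_erase_of_mem h0, hA] at h1
  rw [hA, ← hdd] at h2
  have h3 := Finset.card_filter_add_card_filter_not
    (s := (Fintype.piFinset fun _ : Fin 3 => fixedFinset F (p ^ a)).filter fun v => eval v P = 0)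
    (fun v => v 0 = 0)
  rw [Finset.filter_filter, Finset.filter_filter, h1] at h3
  rw [natCard_zeros_eq hq, ← h3]
  set N₀ := ((Fintype.piFinset fun _ : Fin 3 => fixedFinset F (p ^ a)).filter
    fun v => eval v P = 0 ∧ v 0 = 0).card
  set n := ((fixedFinset F (p ^ a) ×ˢ fixedFinset F (p ^ a)).filter
          fun x => (dehomogenize F P).evalEval x.1 x.2 = 0).card
  set q : ℕ := p ^ a with hqd
  have hqc : ((p : ℝ) ^ a) = q := by rw [hqd]; push_cast; rfl
  rw [hqc] at hC ⊢
  have hq1 : (1 : ℝ) ≤ q := by exact_mod_cast hq.le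
  have hs1 : (1 : ℝ) ≤ √q := by rwa [Real.one_le_sqrt]
  have h2' : (N₀ : ℝ) ≤ d * q := by exact_mod_cast h2
  rw [Nat.cast_add, Nat.cast_mul, Nat.cast_sub hq.le, Nat.cast_one]
  have e1 : (N₀ : ℝ) + (q - 1) * n - q ^ 2 = (q - 1) * (n - q) - q + N₀ := by ring
  rw [e1]
  have b1 : |((q : ℝ) - 1) * (n - q)| ≤ q * (|C₁| * √q) := by
    rw [abs_mul, abs_of_nonneg (by linarith : (0 : ℝ) ≤ q - 1)]
    refine mul_le_mul (by linarith) (hC.trans ?_) (abs_nonneg _) (by linarith)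
    exact mul_le_mul_of_nonneg_right (le_abs_self _) (Real.sqrt_nonneg _)
  have b2 : (q : ℝ) ≤ q * √q := le_mul_of_one_le_right (by linarith) hs1
  have b3 : (d : ℝ) * q ≤ d * (q * √q) := mul_le_mul_of_nonneg_left b2 (Nat.cast_nonneg _)
  have b4 : (0 : ℝ) ≤ N₀ := Nat.cast_nonneg _
  rw [abs_le] at b1 ⊢
  constructor <;> nlinarith

/-- The affine cone over an absolutely irreducible plane curve has approximately `q ^ 2` points. -/
theorem exists_abs_card_zeros_sub_le [IsAlgClosed F] (p : ℕ) [Fact p.Prime] [CharP F p]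
    {P : MvPolynomial (Fin 3) F} {e : ℕ} (hP : P.IsHomogeneous e) (hirr : Irreducible P) :
    ∃ C : ℝ, ∀ a, 0 < a → map (iterateFrobenius F p a) P = P →
      |(Nat.card {v : Fin 3 → F // (∀ i, v i ^ p ^ a = v i) ∧ eval v P = 0} : ℝ) - (p ^ a) ^ 2| ≤
        C * (p ^ a * √(p ^ a)) := by
  have : PerfectRing F p := inferInstance
  obtain ⟨i, hi⟩ := exists_pderiv_ne_zero_of_irreducible p hirr
  let s := Equiv.swap i 2
  have hd : pderiv 2 (rename s P) ≠ 0 := by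
    have := pderiv_rename s.injective i P
    rw [Equiv.swap_apply_left] at this
    rw [this, Ne, map_eq_zero_iff _ (rename_injective _ s.injective)]
    exact hi
  obtain ⟨C₁, hC⟩ := exists_abs_card_zeros_sub_le_of_pderiv p (P := rename s P)
    hP.rename_isHomogeneous
    ((MulEquiv.irreducible_iff (renameEquiv F s)).2 hirr) hd
  refine ⟨C₁, fun a ha hPa => ?_⟩
  have h := hC a ha (by rw [map_rename, hPa])
  have hcard : Nat.card {v : Fin 3 → F // (∀ i, v i ^ p ^ a = v i) ∧ eval v P = 0} =
      Nat.card {v : Fin 3 → F // (∀ i, v i ^ p ^ a = v i) ∧ eval v (rename s P) = 0} := by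
    refine Nat.card_congr ((Equiv.arrowCongr s (Equiv.refl F)).subtypeEquiv fun v => ?_)
    rw [eval_rename]
    refine and_congr ⟨fun h i => h _, fun h i => by simpa [s] using h (s i)⟩ ?_
    have : (Equiv.arrowCongr s (Equiv.refl F) v) ∘ s = v := by ext i; simp
    rw [this]
  rwa [hcard]

end MvPolynomial

namespace MvPolynomial

section HomogeneousFactors

variable {R σ : Type*} [CommRing R]

/-- Grading of a polynomial by its total degree, recorded in a new variable. -/
noncomputable def degreeGrading (R σ : Type*) [CommRing R] :
    MvPolynomial σ R →ₐ[R] Polynomial (MvPolynomial σ R) :=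
  aeval fun i => Polynomial.C (X i) * Polynomial.X

theorem coeff_degreeGrading (P : MvPolynomial σ R) (j : ℕ) :
    (degreeGrading R σ P).coeff j = homogeneousComponent j P := by
  induction P using MvPolynomial.induction_on' with
  | add p q hp hq => rw [map_add, Polynomial.coeff_add, hp, hq, map_add]
  | monomial d a =>
    have h : degreeGrading R σ (monomial d a) =
        Polynomial.C (monomial d a) * Polynomial.X ^ d.degree := by
      rw [degreeGrading, aeval_monomial, monomial_eq (s := d), Finsupp.prod, Finsupp.prod]
      simp_rw [mul_pow]
      rw [Finset.prod_mul_distrib, Finset.prod_pow_eq_pow_sum, map_mul, map_prod, ← mul_assoc]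
      simp only [map_pow]
      rfl
    rw [h, Polynomial.coeff_C_mul_X_pow,
      homogeneousComponent_of_mem (isHomogeneous_monomial a rfl)]

theorem IsHomogeneous.degreeGrading_eq {P : MvPolynomial σ R} {n : ℕ} (hP : P.IsHomogeneous n) :
    degreeGrading R σ P = Polynomial.C P * Polynomial.X ^ n := by
  ext1 j
  rw [coeff_degreeGrading, Polynomial.coeff_C_mul_X_pow, homogeneousComponent_of_mem hP]

theorem IsHomogeneous.exists_isHomogeneous_of_mul [IsDomain R] {P Q : MvPolynomial σ R} {n : ℕ}
    (h : (P * Q).IsHomogeneous n) (h0 : P * Q ≠ 0) : ∃ m, P.IsHomogeneous m := by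
  have hT := h.degreeGrading_eq
  rw [map_mul] at hT
  have hne : degreeGrading R σ P * degreeGrading R σ Q ≠ 0 := by
    rw [hT]
    exact mul_ne_zero (Polynomial.C_ne_zero.2 h0) (pow_ne_zero _ Polynomial.X_ne_zero)
  have hP := left_ne_zero_of_mul hne
  have hQ := right_ne_zero_of_mul hne
  have h1 := Polynomial.natDegree_mul hP hQ
  have h2 := Polynomial.natTrailingDegree_mul hP hQ
  rw [hT, Polynomial.natDegree_C_mul_X_pow _ _ h0] at h1
  rw [hT, Polynomial.natTrailingDegree_mul_X_pow (Polynomial.C_ne_zero.2 h0),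
    Polynomial.natTrailingDegree_C, zero_add] at h2
  have h3 := Polynomial.natTrailingDegree_le_natDegree (degreeGrading R σ P)
  have h4 := Polynomial.natTrailingDegree_le_natDegree (degreeGrading R σ Q)
  refine ⟨(degreeGrading R σ P).natDegree, ?_⟩
  intro d hd
  have hw : Finsupp.weight (1 : σ → ℕ) d = d.degree := by
    rw [Finsupp.degree_eq_weight_one]
    rfl
  rw [hw]
  by_contra hne
  have h5 : coeff d (homogeneousComponent d.degree P) = coeff d P := by
    rw [coeff_homogeneousComponent, if_pos rfl]
  refine hd ?_
  rw [← h5, ← coeff_degreeGrading]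
  rcases lt_or_gt_of_ne hne with hlt | hlt
  · rw [Polynomial.coeff_eq_zero_of_lt_natTrailingDegree (by omega), coeff_zero]
  · rw [Polynomial.coeff_eq_zero_of_natDegree_lt hlt, coeff_zero]

theorem IsHomogeneous.of_dvd [IsDomain R] {P Q : MvPolynomial σ R} {n : ℕ}
    (h : Q.IsHomogeneous n) (h0 : Q ≠ 0) (hd : P ∣ Q) : P.IsHomogeneous P.totalDegree := by
  obtain ⟨T, rfl⟩ := hd
  obtain ⟨m, hm⟩ := h.exists_isHomogeneous_of_mul h0
  rwa [hm.totalDegree (left_ne_zero_of_mul h0)]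

end HomogeneousFactors

variable {F : Type*} [Field F] {σ : Type*}

theorem isUnit_of_totalDegree_eq_zero {P : MvPolynomial σ F} (h0 : P ≠ 0)
    (h : P.totalDegree = 0) : IsUnit P := by
  rw [totalDegree_eq_zero_iff_eq_C] at h
  rw [h]
  refine (IsUnit.mk0 _ fun h1 => h0 ?_).map C
  rw [h, h1, map_zero]

theorem totalDegree_eq_zero_of_isUnit {P : MvPolynomial σ F} (h : IsUnit P) :
    P.totalDegree = 0 := by
  obtain ⟨c, -, rfl⟩ := isUnit_iff_eq_C_of_isReduced.1 h
  exact totalDegree_C c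

theorem irreducible_of_totalDegree_eq_one_of_field {L : MvPolynomial σ F} (h : L.totalDegree = 1) :
    Irreducible L := by
  have h0 : L ≠ 0 := by rintro rfl; simp at h
  refine ⟨fun hu => by rw [totalDegree_eq_zero_of_isUnit hu] at h; omega, ?_⟩
  rintro a b rfl
  have ha := left_ne_zero_of_mul h0
  have hb := right_ne_zero_of_mul h0
  rw [totalDegree_mul_of_isDomain ha hb] at h
  rcases Nat.eq_zero_or_pos a.totalDegree with h1 | h1
  · exact .inl (isUnit_of_totalDegree_eq_zero ha h1)
  · exact .inr (isUnit_of_totalDegree_eq_zero hb (by omega))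

/-- A ternary cubic form without linear factor is irreducible. -/
theorem IsHomogeneous.irreducible_of_forall_not_dvd {P : MvPolynomial σ F}
    (hP : P.IsHomogeneous 3) (h0 : P ≠ 0)
    (h : ∀ L : MvPolynomial σ F, L.IsHomogeneous 1 → L ≠ 0 → ¬ L ∣ P) : Irreducible P := by
  have hdeg := hP.totalDegree h0
  refine ⟨fun hu => by rw [totalDegree_eq_zero_of_isUnit hu] at hdeg; omega, ?_⟩
  rintro a b rfl
  have ha := left_ne_zero_of_mul h0
  have hb := right_ne_zero_of_mul h0
  rw [totalDegree_mul_of_isDomain ha hb] at hdeg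
  have ha' := hP.of_dvd h0 (dvd_mul_right a b)
  have hb' := hP.of_dvd h0 (dvd_mul_left b a)
  have h1 : a.totalDegree ≠ 1 := fun h1 => h a (h1 ▸ ha') ha (dvd_mul_right a b)
  have h2 : b.totalDegree ≠ 1 := fun h1 => h b (h1 ▸ hb') hb (dvd_mul_left b a)
  rcases Nat.eq_zero_or_pos a.totalDegree with h3 | h3
  · exact .inl (isUnit_of_totalDegree_eq_zero ha h3)
  · exact .inr (isUnit_of_totalDegree_eq_zero hb (by omega))

/-- A cubic form divisible by a line either is a multiple of its cube or has another
irreducible factor. -/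
theorem IsHomogeneous.exists_irreducible_dvd_not_associated {P L : MvPolynomial σ F} {n : ℕ}
    (hP : P.IsHomogeneous n) (h0 : P ≠ 0) (hL : L.IsHomogeneous 1) (hL0 : L ≠ 0)
    (h : ¬ ∃ c : F, c ≠ 0 ∧ P = c • L ^ n) :
    ∃ Q, Irreducible Q ∧ Q ∣ P ∧ ¬ Associated L Q := by
  by_contra! hall
  refine h ?_
  obtain ⟨s, hs, u, hu⟩ := WfDvdMonoid.exists_factors P h0
  have hs' : ∀ Q ∈ s, Associated L Q := fun Q hQ =>
    hall Q (hs Q hQ) ((Multiset.dvd_prod hQ).trans ⟨u, hu.symm⟩)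
  have hpow : Associated (L ^ s.card) P := by
    refine Associated.trans ?_ ⟨u, hu⟩
    clear hs hu
    induction s using Multiset.induction_on with
    | empty => simp
    | cons a s ih =>
      rw [Multiset.card_cons, pow_succ', Multiset.prod_cons]
      exact (hs' a (by simp)).mul_mul (ih fun Q hQ => hs' Q (by simp [hQ]))
  obtain ⟨v, hv⟩ := hpow
  obtain ⟨c, hc, hvc⟩ := isUnit_iff_eq_C_of_isReduced.1 v.isUnit
  have hdeg := hP.totalDegree h0
  rw [← hv, totalDegree_mul_of_isDomain (pow_ne_zero _ hL0) v.ne_zero,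
    totalDegree_eq_zero_of_isUnit v.isUnit, (hL.pow _).totalDegree (pow_ne_zero _ hL0), one_mul,
    add_zero] at hdeg
  refine ⟨c, hc.ne_zero, ?_⟩
  rw [← hv, hvc, smul_eq_C_mul, mul_comm, ← hdeg]

end MvPolynomial

namespace MvPolynomial

variable {F : Type*} [Field F]

theorem IsHomogeneous.exists_eq_sum {σ : Type*} [Fintype σ] {L : MvPolynomial σ F}
    (hL : L.IsHomogeneous 1) : ∃ c : σ → F, L = ∑ i, C (c i) * X i := by
  rw [← mem_homogeneousSubmodule, homogeneousSubmodule_one_eq_span_X,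
    Submodule.mem_span_range_iff_exists_fun] at hL
  obtain ⟨c, rfl⟩ := hL
  exact ⟨c, by simp [smul_eq_C_mul]⟩

open scoped Classical in
/-- A hypersurface not containing a hyperplane meets it in few points. -/
theorem IsHomogeneous.exists_card_common_zeros_le {n : ℕ} {L Q : MvPolynomial (Fin (n + 2)) F}
    (hL : L.IsHomogeneous 1) (h0 : L ≠ 0) (hQ : ¬ L ∣ Q) :
    ∃ d : ℕ, ∀ A : Finset F, ((Fintype.piFinset fun _ : Fin (n + 2) => A).filter
      fun v => eval v L = 0 ∧ eval v Q = 0).card ≤ d * A.card ^ n := by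
  obtain ⟨c, rfl⟩ := hL.exists_eq_sum
  obtain ⟨j, hj⟩ : ∃ j, c j ≠ 0 := by
    by_contra! h
    exact h0 (by simp [h])
  let ℓ : MvPolynomial (Fin (n + 1)) F := - ∑ i, C (c (j.succAbove i) / c j) * X i
  let φ : MvPolynomial (Fin (n + 2)) F →ₐ[F] MvPolynomial (Fin (n + 1)) F :=
    MvPolynomial.aeval (j.insertNth (α := fun _ => MvPolynomial (Fin (n + 1)) F) ℓ X)
  have hφ : φ Q ≠ 0 := by
    intro h
    refine hQ (Ideal.mem_span_singleton.1 (Ideal.Quotient.eq_zero_iff_mem.1 ?_))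
    let π := Ideal.Quotient.mkₐ F (Ideal.span {∑ i, C (c i) * X i})
    have hπ : (π.comp (rename j.succAbove)).comp φ = π := by
      refine algHom_ext fun i => ?_
      rcases eq_or_ne i j with rfl | hi
      · simp only [AlgHom.comp_apply, φ, aeval_X, Fin.insertNth_apply_same, ℓ]
        rw [← sub_eq_zero, ← map_sub, Ideal.Quotient.mkₐ_eq_mk, Ideal.Quotient.eq_zero_iff_mem,
          Ideal.mem_span_singleton]
        refine ⟨- C (c i)⁻¹, ?_⟩
        rw [Fin.sum_univ_succAbove _ i]
        simp only [map_neg, map_sum, map_mul, rename_X, algHom_C, algebraMap_eq]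
        rw [mul_comm, neg_mul, mul_add, ← mul_assoc, ← MvPolynomial.C_mul, inv_mul_cancel₀ hj, C_1, one_mul, neg_add,
          Finset.mul_sum, sub_eq_add_neg, add_comm (-X i)]
        simp only [div_eq_inv_mul, MvPolynomial.C_mul, mul_assoc]
      · obtain ⟨i, rfl⟩ := Fin.exists_succAbove_eq hi
        simp [φ]
    rw [← Ideal.Quotient.mkₐ_eq_mk F]
    change π Q = 0
    rw [← hπ, AlgHom.comp_apply, h, map_zero]
  refine ⟨(φ Q).totalDegree, fun A => le_trans ?_ (card_filter_eval_eq_zero_le hφ A)⟩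
  have hv : ∀ v : Fin (n + 2) → F, eval v (∑ i, C (c i) * X i) = 0 →
      v j = eval (v ∘ j.succAbove) ℓ := by
    intro v hv
    rw [Fin.sum_univ_succAbove _ j] at hv
    simp only [map_add, map_sum, map_mul, eval_C, eval_X] at hv
    simp only [ℓ, map_neg, map_sum, map_mul, eval_C, eval_X, div_mul_eq_mul_div,
      ← Finset.sum_div, Function.comp_apply]
    field_simp
    linear_combination hv
  refine Finset.card_le_card_of_injOn (fun v => v ∘ j.succAbove) ?_ ?_
  · intro v h
    simp only [Finset.coe_filter, Fintype.mem_piFinset, Set.mem_ofPred_eq] at h ⊢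
    refine ⟨fun i => h.1 _, ?_⟩
    rw [← h.2.2]
    have key : (MvPolynomial.aeval (v ∘ j.succAbove) : MvPolynomial (Fin (n + 1)) F →ₐ[F] F).comp φ =
        MvPolynomial.aeval v := by
      refine algHom_ext fun i => ?_
      rcases eq_or_ne i j with rfl | hi
      · simp [φ, hv v h.2.1, aeval_eq_eval]
      · obtain ⟨i, rfl⟩ := Fin.exists_succAbove_eq hi
        simp [φ]
    simpa [aeval_eq_eval] using DFunLike.congr_fun key Q
  · intro v h w h' hvw
    simp only [Finset.coe_filter, Set.mem_ofPred_eq] at h h'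
    funext i
    rcases eq_or_ne i j with rfl | hi
    · rw [hv v h.2.1, hv w h'.2.1]
      exact congrArg (fun u => eval u ℓ) hvw
    · obtain ⟨i, rfl⟩ := Fin.exists_succAbove_eq hi
      exact congrFun hvw i

/-- Every polynomial over an algebraic closure of a finite field is fixed by infinitely many
powers of Frobenius. -/
theorem exists_forall_map_iterateFrobenius_eq {k Ω σ : Type*} [Field k] [Finite k] [Field Ω]
    [Algebra k Ω] [Algebra.IsAlgebraic k Ω] {p f : ℕ} [Fact p.Prime] [CharP Ω p]
    (hk : Nat.card k = p ^ f) (P : MvPolynomial σ Ω) :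
    ∃ m, 0 < m ∧ ∀ n, map (iterateFrobenius Ω p (f * m * n)) P = P := by
  have hx : ∀ x : Ω, ∃ m, 0 < m ∧ x ^ Nat.card k ^ m = x := by
    intro x
    have hx_int : IsIntegral k x := (Algebra.IsAlgebraic.isAlgebraic x).isIntegral
    have := IntermediateField.adjoin.finiteDimensional hx_int
    have hfin : Finite (IntermediateField.adjoin k {x}) := Module.finite_of_finite k
    refine ⟨finrank k (IntermediateField.adjoin k {x}), Module.finrank_pos, ?_⟩
    rw [← Module.natCard_eq_pow_finrank]
    let := Fintype.ofFinite (IntermediateField.adjoin k {x})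
    have := FiniteField.pow_card (IntermediateField.AdjoinSimple.gen k x)
    rw [← Nat.card_eq_fintype_card] at this
    simpa using congrArg (algebraMap _ Ω) this
  choose m hm0 hm using hx
  refine ⟨∏ d ∈ P.support, m (coeff d P), Finset.prod_pos fun _ _ => hm0 _, fun n => ?_⟩
  ext d
  rw [coeff_map, iterateFrobenius_def]
  by_cases hd : d ∈ P.support
  · obtain ⟨e, he⟩ := Finset.dvd_prod_of_mem (fun d => m (coeff d P)) hd
    rw [he]
    have hiter : ∀ i, coeff d P ^ (Nat.card k ^ m (coeff d P)) ^ i = coeff d P := by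
      intro i
      induction i with
      | zero => simp
      | succ i ih => rw [pow_succ, pow_mul, ih, hm]
    have := hiter (e * n)
    rwa [hk, ← pow_mul, ← pow_mul, ← mul_assoc, ← mul_assoc, mul_assoc f] at this
  · rw [notMem_support_iff.1 hd, zero_pow (pow_ne_zero _ (Fact.out : p.Prime).ne_zero)]

end MvPolynomial

namespace MvPolynomial

section Transfer

variable {k k' Ω : Type*} [Field k] [Field k'] [Fintype k'] [Algebra k k'] [Field Ω]
  [Algebra k Ω] {p a : ℕ} [Fact p.Prime] [CharP Ω p]

theorem exists_apply_eq_of_pow_eq [IsAlgClosed Ω] (ha : 0 < a) (hk : Nat.card k' = p ^ a) (ι : k' →+* Ω) {x : Ω}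
    (hx : x ^ p ^ a = x) : ∃ y, ι y = x := by
  classical
  have hq : 1 < p ^ a := Nat.one_lt_pow ha.ne' (Fact.out : p.Prime).one_lt
  have h : Finset.univ.image ι = fixedFinset Ω (p ^ a) := by
    refine Finset.eq_of_subset_of_card_le ?_ ?_
    · intro x hx
      obtain ⟨y, -, rfl⟩ := Finset.mem_image.1 hx
      rw [mem_fixedFinset hq, ← map_pow, ← hk, Nat.card_eq_fintype_card, FiniteField.pow_card]
    · rw [card_fixedFinset p a ha, Finset.card_image_of_injective _ ι.injective, Finset.card_univ,
        ← Nat.card_eq_fintype_card, hk]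
  obtain ⟨y, -, hy⟩ := Finset.mem_image.1 (h ▸ (mem_fixedFinset hq).2 hx)
  exact ⟨y, hy⟩

theorem natCard_zeros_add_one [IsAlgClosed Ω] [Finite k] (ha : 0 < a) (hk : Nat.card k' = p ^ a) {σ : Type*}
    [Fintype σ] {P : MvPolynomial σ k} {n : ℕ} (hP : P.IsHomogeneous n) (hn : n ≠ 0) :
    Nat.card {x : σ → k' // x ≠ 0 ∧ eval x (map (algebraMap k k') P) = 0} + 1 =
      Nat.card {v : σ → Ω // (∀ i, v i ^ p ^ a = v i) ∧ eval v (map (algebraMap k Ω) P) = 0} := by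
  classical
  let ι : k' →ₐ[k] Ω := IsAlgClosed.lift
  have hι : (ι : k' →+* Ω).comp (algebraMap k k') = algebraMap k Ω := ι.comp_algebraMap
  have hev (x : σ → k') : eval (fun i => ι (x i)) (map (algebraMap k Ω) P) =
      ι (eval x (map (algebraMap k k') P)) := by
    rw [← hι, ← map_map]
    exact (map_eval (ι : k' →+* Ω) x _).symm ▸ rfl
  have h1 : Nat.card {x : σ → k' // eval x (map (algebraMap k k') P) = 0} =
      Nat.card {v : σ → Ω // (∀ i, v i ^ p ^ a = v i) ∧ eval v (map (algebraMap k Ω) P) = 0} := by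
    refine Nat.card_congr (Equiv.ofBijective (fun x => ⟨fun i => ι (x.1 i), fun i => ?_, ?_⟩) ⟨?_, ?_⟩)
    · rw [← map_pow, ← hk, Nat.card_eq_fintype_card, FiniteField.pow_card]
    · rw [hev, x.2, map_zero]
    · intro x y hxy
      ext i
      exact ι.injective (congrFun (congrArg Subtype.val hxy) i)
    · rintro ⟨v, hv, hv'⟩
      choose y hy using fun i => exists_apply_eq_of_pow_eq ha hk (ι : k' →+* Ω) (hv i)
      obtain rfl : (fun i => ι (y i)) = v := _root_.funext hy
      exact ⟨⟨y, (ι : k' →+* Ω).injective (by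
        change ι _ = ι _
        rw [← hev, hv', map_zero])⟩, rfl⟩
  rw [← h1, Nat.card_eq_fintype_card, Nat.card_eq_fintype_card, Fintype.card_subtype,
    Fintype.card_subtype]
  have h0 : (0 : σ → k') ∈ Finset.univ.filter fun x => eval x (map (algebraMap k k') P) = 0 := by
    have := (hP.map (algebraMap k k')).eval₂_mul (RingHom.id k') 0 0
    simp only [zero_mul, zero_pow hn] at this
    simpa using this
  rw [← Finset.card_erase_add_one h0]
  congr 2
  ext x
  simp

theorem map_iterateFrobenius_map_algebraMap [Finite k] (hk : Nat.card k' = p ^ a) {σ : Type*}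
    (P : MvPolynomial σ k) :
    map (iterateFrobenius Ω p a) (map (algebraMap k Ω) P) = map (algebraMap k Ω) P := by
  rw [map_map]
  refine congrArg (fun f => map f P) (RingHom.ext fun x => ?_)
  rw [RingHom.comp_apply, iterateFrobenius_def, ← map_pow]
  congr 1
  apply (algebraMap k k').injective
  rw [map_pow, ← hk, Nat.card_eq_fintype_card, FiniteField.pow_card]

end Transfer

end MvPolynomial

theorem Nat.abs_div_pred_sub_le {M q : ℕ} (hq : 1 < q) {C : ℝ}
    (h : |((M + 1 : ℕ) : ℝ) - (q : ℝ) ^ 2| ≤ C * (q * √q)) :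
    |((M / (q - 1) : ℕ) : ℝ) - (q + 1)| ≤ (2 * |C| + 1) * √q := by
  obtain ⟨r, rfl⟩ : ∃ r, q = r + 1 := ⟨q - 1, by omega⟩
  rw [Nat.add_sub_cancel]
  have hr : 0 < r := by omega
  have h1 := Nat.div_mul_le_self M r
  have h2 := Nat.lt_div_mul_add (a := M) hr
  set D := M / r
  have h1' : (D : ℝ) * r ≤ M := by exact_mod_cast h1
  have h2' : (M : ℝ) < D * r + r := by exact_mod_cast h2
  have hr' : (1 : ℝ) ≤ r := by exact_mod_cast hr
  push_cast at h ⊢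
  set s := √((r : ℝ) + 1) with hs
  have hs1 : 1 ≤ s := by rw [hs, Real.one_le_sqrt]; linarith
  have h3 : C * ((r + 1) * s) ≤ |C| * (2 * r * s) := by
    refine mul_le_mul (le_abs_self _) ?_ (by positivity) (abs_nonneg _)
    exact mul_le_mul_of_nonneg_right (by linarith) (by linarith)
  have hC := abs_nonneg C
  rw [abs_le] at h ⊢
  have h4 : (r : ℝ) ≤ r * s := le_mul_of_one_le_right (by linarith) hs1
  constructor
  · refine le_of_mul_le_mul_right ?_ (by linarith : (0 : ℝ) < r)
    nlinarith
  · refine le_of_mul_le_mul_right ?_ (by linarith : (0 : ℝ) < r)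
    nlinarith

namespace MvPolynomial

/-- A plane curve with two components, one of them a line, has too many points. -/
theorem exists_two_mul_sq_sub_le {F : Type*} [Field F] [IsAlgClosed F] (p : ℕ) [Fact p.Prime]
    [CharP F p] {P L Q : MvPolynomial (Fin 3) F} {e : ℕ} (hL : L.IsHomogeneous 1) (hL0 : L ≠ 0)
    (hLP : L ∣ P) (hQ : Irreducible Q) (hQh : Q.IsHomogeneous e) (hQP : Q ∣ P)
    (hne : ¬ Associated L Q) :
    ∃ C : ℝ, ∀ a, 0 < a → map (iterateFrobenius F p a) L = L →
      map (iterateFrobenius F p a) Q = Q →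
        2 * ((p : ℝ) ^ a) ^ 2 - C * (p ^ a * √(p ^ a)) ≤
          Nat.card {v : Fin 3 → F // (∀ i, v i ^ p ^ a = v i) ∧ eval v P = 0} := by
  classical
  have hLi : Irreducible L := irreducible_of_totalDegree_eq_one_of_field (hL.totalDegree hL0)
  obtain ⟨C₁, h₁⟩ := exists_abs_card_zeros_sub_le p hL hLi
  obtain ⟨C₂, h₂⟩ := exists_abs_card_zeros_sub_le p hQh hQ
  obtain ⟨d, hd⟩ := hL.exists_card_common_zeros_le hL0
    fun h => hne (hLi.associated_of_dvd hQ h)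
  refine ⟨C₁ + C₂ + d, fun a ha hLa hQa => ?_⟩
  have hq : 1 < p ^ a := Nat.one_lt_pow ha.ne' (Fact.out : p.Prime).one_lt
  have e₁ := h₁ a ha hLa
  have e₂ := h₂ a ha hQa
  have e₃ := hd (fixedFinset F (p ^ a))
  rw [card_fixedFinset p a ha, pow_one] at e₃
  rw [natCard_zeros_eq hq] at e₁ e₂ ⊢
  set A := Fintype.piFinset fun _ : Fin 3 => fixedFinset F (p ^ a)
  have h4 : (A.filter fun v => eval v L = 0 ∨ eval v Q = 0).card ≤
      (A.filter fun v => eval v P = 0).card := by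
    refine Finset.card_le_card (Finset.monotone_filter_right _ fun v _ hv => ?_)
    rcases hv with hv | hv
    · exact zero_dvd_iff.1 (hv ▸ map_dvd (eval v) hLP)
    · exact zero_dvd_iff.1 (hv ▸ map_dvd (eval v) hQP)
  have h5 := Finset.card_union_add_card_inter (A.filter fun v => eval v L = 0)
    (A.filter fun v => eval v Q = 0)
  rw [← Finset.filter_or, ← Finset.filter_and] at h5
  have h6 : (((A.filter fun v => eval v L = 0).card + (A.filter fun v => eval v Q = 0).card : ℕ) :
      ℝ) ≤ (((A.filter fun v => eval v P = 0).card + d * p ^ a : ℕ) : ℝ) := by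
    rw [← h5]
    exact_mod_cast Nat.add_le_add h4 e₃
  push_cast at h6
  have hq1 : (1 : ℝ) ≤ (p : ℝ) ^ a := by exact_mod_cast hq.le
  have hs1 : (1 : ℝ) ≤ √((p : ℝ) ^ a) := by rwa [Real.one_le_sqrt]
  have h7 : (d : ℝ) * p ^ a ≤ d * (p ^ a * √(p ^ a)) :=
    mul_le_mul_of_nonneg_left (le_mul_of_one_le_right (by linarith) hs1) (Nat.cast_nonneg _)
  rw [abs_le] at e₁ e₂
  linarith [e₁.1, e₂.1]

end MvPolynomial

theorem sqrt_le_of_two_mul_sq_sub_le {M q : ℕ} (hq : 1 < q) {B C : ℝ}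
    (h : |((M / (q - 1) : ℕ) : ℝ) - (q + 1)| ≤ B * √q)
    (h' : 2 * (q : ℝ) ^ 2 - C * (q * √q) ≤ ((M + 1 : ℕ) : ℝ)) : √q ≤ |B| + C + 2 := by
  obtain ⟨r, rfl⟩ : ∃ r, q = r + 1 := ⟨q - 1, by omega⟩
  rw [Nat.add_sub_cancel] at h
  have hr : 0 < r := by omega
  have h2 := Nat.lt_div_mul_add (a := M) hr
  set D := M / r
  have h2' : (M : ℝ) < D * r + r := by exact_mod_cast h2
  have hr' : (1 : ℝ) ≤ r := by exact_mod_cast hr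
  push_cast at h h' ⊢
  set s := √((r : ℝ) + 1) with hs
  have hs1 : 1 ≤ s := by rw [hs, Real.one_le_sqrt]; linarith
  have hss : s * s = r + 1 := Real.mul_self_sqrt (by linarith)
  have hD := (abs_le.1 h).2
  have hB : B * s ≤ |B| * s := mul_le_mul_of_nonneg_right (le_abs_self _) (by linarith)
  have hD' : (D : ℝ) * r ≤ (r + 2 + |B| * s) * r :=
    mul_le_mul_of_nonneg_right (by linarith) (by linarith)
  have hBs : 0 ≤ |B| * s := by positivity
  have h8 : (r : ℝ) + 1 ≤ (r + 1) * s := le_mul_of_one_le_right (by linarith) hs1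
  have key : ((r : ℝ) + 1) * s * s ≤ (r + 1) * s * (|B| + C + 2) := by
    rw [mul_assoc ((r : ℝ) + 1), hss]
    nlinarith
  exact le_of_mul_le_mul_left key (by positivity)

theorem projCard_one (q : ℕ) : (projCard q 1 : ℝ) = q + 1 := by
  simp [projCard, Finset.sum_range_succ, add_comm]

/-- Theorem 5.4, case `n = 2`: a plane cubic over a finite field whose base change
is not a cone over a cone (i.e. not `λL³`) is `|E|`-bad iff it contains a line
over the algebraic closure. -/
theorem stmt12 (k : Type) [Field k] [Fintype k]
    (Cf : MvPolynomial (Fin 3) k) (hC0 : Cf ≠ 0) (hC : Cf.IsHomogeneous 3)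
    (hnc : ¬ ∃ (lam : AlgebraicClosure k) (L : MvPolynomial (Fin 3) (AlgebraicClosure k)),
      lam ≠ 0 ∧ L.IsHomogeneous 1 ∧
      map (algebraMap k (AlgebraicClosure k)) Cf = lam • L ^ 3) :
    ((¬ ∃ B : ℝ, ∀ (k' : Type) [Field k'] [Fintype k'] [Algebra k k'],
        |(projCount k' (fun x : Fin 3 → k' =>
            eval x (map (algebraMap k k') Cf) = 0) : ℝ) -
          (projCard (Nat.card k') 1 : ℝ)| ≤
        B * (Nat.card k' : ℝ) ^ ((1 : ℝ) / 2)) ↔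
      ∃ L : MvPolynomial (Fin 3) (AlgebraicClosure k),
        L.IsHomogeneous 1 ∧ L ≠ 0 ∧
        L ∣ map (algebraMap k (AlgebraicClosure k)) Cf) := by
  have hP := hC.map (algebraMap k (AlgebraicClosure k))
  have hP0 : map (algebraMap k (AlgebraicClosure k)) Cf ≠ 0 :=
    (map_ne_zero_iff _ (map_injective _ (algebraMap k (AlgebraicClosure k)).injective)).2 hC0
  obtain ⟨p, hp⟩ := CharP.exists k
  obtain ⟨f, hprime, hf⟩ := FiniteField.card k p
  have := Fact.mk hprime
  have : CharP (AlgebraicClosure k) p :=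
    charP_of_injective_algebraMap (algebraMap k (AlgebraicClosure k)).injective p
  simp_rw [← Real.sqrt_eq_rpow, projCard_one, projCount]
  constructor
  · intro h
    by_contra! hno
    refine h ?_
    obtain ⟨C₀, hC₀⟩ := exists_abs_card_zeros_sub_le p hP
      (hP.irreducible_of_forall_not_dvd hP0 hno)
    refine ⟨2 * |C₀| + 1, fun k' _ _ _ => ?_⟩
    have : CharP k' p := charP_of_injective_algebraMap (algebraMap k k').injective p
    obtain ⟨a, -, ha⟩ := FiniteField.card k' p
    rw [← Nat.card_eq_fintype_card] at ha
    have h1 := hC₀ a a.pos (map_iterateFrobenius_map_algebraMap ha Cf)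
    rw [← natCard_zeros_add_one a.pos ha hC three_ne_zero] at h1
    refine Nat.abs_div_pred_sub_le Finite.one_lt_card ?_
    rw [ha]
    exact_mod_cast h1
  · rintro ⟨L, hL, hL0, hLP⟩ ⟨B, hB⟩
    obtain ⟨Q, hQ, hQP, hne⟩ := hP.exists_irreducible_dvd_not_associated hP0 hL hL0
      fun ⟨c, hc, h⟩ => hnc ⟨c, L, hc, hL, h⟩
    obtain ⟨C₀, hC₀⟩ := exists_two_mul_sq_sub_le p hL hL0 hLP hQ (hP.of_dvd hP0 hQP) hQP hne
    rw [← Nat.card_eq_fintype_card] at hf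
    obtain ⟨m₁, hm₁, h₁⟩ := exists_forall_map_iterateFrobenius_eq hf L
    obtain ⟨m₂, hm₂, h₂⟩ := exists_forall_map_iterateFrobenius_eq hf Q
    obtain ⟨n, hn⟩ := exists_nat_gt ((|B| + C₀ + 2) ^ 2)
    have hn0 : 0 < n := by exact_mod_cast (sq_nonneg _).trans_lt hn
    have hmn : 0 < m₁ * m₂ * n := by positivity
    have : NeZero (m₁ * m₂ * n) := ⟨hmn.ne'⟩
    let k' := FiniteField.Extension k p (m₁ * m₂ * n)
    have : Finite k' := Module.finite_of_finite k
    let _ : Fintype k' := Fintype.ofFinite k'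
    have ha : 0 < (f : ℕ) * (m₁ * m₂ * n) := Nat.mul_pos f.pos hmn
    have hcard : Nat.card k' = p ^ ((f : ℕ) * (m₁ * m₂ * n)) := by
      rw [pow_mul, ← hf]
      exact FiniteField.natCard_extension k p _
    have h₁' := h₁ (m₂ * n)
    have h₂' := h₂ (m₁ * n)
    rw [show (f : ℕ) * m₁ * (m₂ * n) = f * (m₁ * m₂ * n) by ring] at h₁'
    rw [show (f : ℕ) * m₂ * (m₁ * n) = f * (m₁ * m₂ * n) by ring] at h₂'
    have h3 := hC₀ _ ha h₁' h₂'
    rw [← natCard_zeros_add_one ha hcard hC three_ne_zero] at h3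
    have hcardR : (Nat.card k' : ℝ) = (p : ℝ) ^ ((f : ℕ) * (m₁ * m₂ * n)) := by
      rw [hcard]; push_cast; rfl
    rw [← hcardR] at h3
    have h4 := sqrt_le_of_two_mul_sq_sub_le Finite.one_lt_card (hB k') h3
    have h5 : (Nat.card k' : ℝ) ≤ (|B| + C₀ + 2) ^ 2 := by
      rw [← Real.sq_sqrt (Nat.cast_nonneg (Nat.card k'))]
      exact pow_le_pow_left₀ (Real.sqrt_nonneg _) h4 2
    have h6 : n ≤ Nat.card k' := by
      rw [hcard]
      refine le_trans ?_ (Nat.lt_pow_self hprime.one_lt).le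
      rw [← mul_assoc]
      exact Nat.le_mul_of_pos_left n (by positivity)
    have h7 : (n : ℝ) ≤ Nat.card k' := by exact_mod_cast h6
    linarith
end
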